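/- Assume the dilations are isotropic, a_j = α_j I with α_j real nonzero and |α_j| → ∞. Take an analyzer φ ∈ L¹(ℝ^d) with ∫_{ℝ^d} φ dx = 1, and suppose φ is a Schwartz function whose Fourier transform is supported in C₀ b^{-1}. Then for all f ∈ H¹(ℝ^d), ‖f‖_{H¹} ≈ ‖Tf‖_{ℓ^∞(h¹)} = sup_{j>0} |det b| ‖{⟨f, φ_{j,k}⟩}_{k∈ℤ^d}‖_{h¹}, with implied constants independent of f; in particular the analysis operator T is linear, bounded and injective from H¹ onto its range in ℓ^∞(h¹). -/

import Mathlib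

open MeasureTheory Filter Matrix Set
open scoped ENNReal NNReal Topology

noncomputable section

namespace AffinePaper

/-- Embed an integer lattice point `k ∈ ℤ^d` into `ℝ^d`. -/
def intVec {d : ℕ} (k : Fin d → ℤ) : Fin d → ℝ := fun i => (k i : ℝ)

/-- Euclidean norm `|x|` on `ℝ^d`. -/
def eucNorm {d : ℕ} (x : Fin d → ℝ) : ℝ := Real.sqrt (∑ i, x i ^ 2)

/-- The constant `C_d = Γ((d+1)/2) π^{-(d+1)/2}` of the Riesz kernel. -/
def rieszConst (d : ℕ) : ℝ :=
  Real.Gamma (((d : ℝ) + 1) / 2) / Real.pi ^ (((d : ℝ) + 1) / 2)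

/-- The (vector-valued) Riesz kernel `Z(x) = C_d x / |x|^{d+1}`, with `Z(0) = 0`. -/
def rieszKernel (d : ℕ) (x : Fin d → ℝ) : Fin d → ℝ :=
  if x = 0 then 0 else fun i => rieszConst d * x i / eucNorm x ^ (d + 1)

/-- The truncated singular integral `∫_{|y| > ε} f(x-y) Z(y) dy` (vector-valued). -/
def truncRiesz {d : ℕ} (f : (Fin d → ℝ) → ℂ) (x : Fin d → ℝ) (ε : ℝ) : Fin d → ℂ :=
  ∫ y in {y : Fin d → ℝ | ε < eucNorm y}, (fun i => f (x - y) * ((rieszKernel d y i : ℝ) : ℂ))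

/-- `g` is the Riesz transform `Rf = f * Z` of `f`, in the principal value sense:
for a.e. `x` the truncated integrals converge to `g(x)` as `ε → 0+`. -/
def HasRiesz {d : ℕ} (f : (Fin d → ℝ) → ℂ) (g : (Fin d → ℝ) → Fin d → ℂ) : Prop :=
  ∀ᵐ x : Fin d → ℝ, Tendsto (fun ε : ℝ => truncRiesz f x ε) (𝓝[>] 0) (𝓝 (g x))

/-- Membership in the Hardy space `H¹(ℝ^d) = { f ∈ L¹ : Rf ∈ L¹ }`. -/
def MemH1 {d : ℕ} (f : (Fin d → ℝ) → ℂ) : Prop :=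
  Integrable f volume ∧ ∃ g : (Fin d → ℝ) → Fin d → ℂ, Integrable g volume ∧ HasRiesz f g

/-- The Hardy norm `‖f‖_{H¹} = ‖f‖₁ + ‖Rf‖₁`, as a value in `[0,∞]` (equal to `∞` when
`f` admits no integrable Riesz transform; the Riesz transform is a.e. unique, so the
infimum below is over a set of at most one value). -/
def hardyNorm {d : ℕ} (f : (Fin d → ℝ) → ℂ) : ℝ≥0∞ :=
  ENNReal.ofReal (∫ x : Fin d → ℝ, ‖f x‖) +
    sInf {r : ℝ≥0∞ | ∃ g : (Fin d → ℝ) → Fin d → ℂ,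
      Integrable g volume ∧ HasRiesz f g ∧ r = ENNReal.ofReal (∫ x : Fin d → ℝ, ‖g x‖)}

/-- The centered open unit cube `C₀ = (-1/2, 1/2)^d`. -/
def centeredCube (d : ℕ) : Set (Fin d → ℝ) :=
  Set.univ.pi fun _ => Set.Ioo (-(1/2) : ℝ) (1/2)

/-- `ν` is a smooth cut-off function: supported in the centered unit cube `C₀` and
identically `1` near the origin. -/
structure IsCutoff (d : ℕ) (ν : (Fin d → ℝ) → ℝ) : Prop where
  smooth : ContDiff ℝ (⊤ : ℕ∞) ν
  supp : tsupport ν ⊆ centeredCube d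
  one_near_zero : ∀ᶠ ξ in 𝓝 0, ν ξ = 1

/-- The periodic function `ζ(ξ) = -i (ξ b⁻¹ / |ξ b⁻¹|) ν(ξ)` (vector-valued), whose Fourier
coefficients define the discrete Riesz kernel. -/
def zetaFn {d : ℕ} (b : Matrix (Fin d) (Fin d) ℝ) (ν : (Fin d → ℝ) → ℝ)
    (ξ : Fin d → ℝ) : Fin d → ℂ :=
  fun i => -Complex.I * ((((ξ ᵥ* b⁻¹) i / eucNorm (ξ ᵥ* b⁻¹) : ℝ)) : ℂ) * ((ν ξ : ℝ) : ℂ)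

/-- The discrete Riesz kernel `z = {z_k}`, defined through its Fourier series
`Σ_k z_k e^{-2πi ξ k} = ζ(ξ)`, `ξ ∈ C₀`; that is, `z_k = ∫_{C₀} ζ(ξ) e^{2πi ξ k} dξ`. -/
def zKernel {d : ℕ} (b : Matrix (Fin d) (Fin d) ℝ) (ν : (Fin d → ℝ) → ℝ)
    (k : Fin d → ℤ) : Fin d → ℂ :=
  ∫ ξ in centeredCube d,
    Complex.exp (((2 * Real.pi * ∑ i, ξ i * (k i : ℝ) : ℝ)) * Complex.I) • zetaFn b ν ξ

/-- Discrete convolution `(s * z)_k = Σ_l s_{k-l} z_l` of a scalar sequence with the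
(vector-valued) kernel `z`, in the `k`-index. -/
def dConv {d : ℕ} (s : (Fin d → ℤ) → ℂ) (z : (Fin d → ℤ) → Fin d → ℂ)
    (k : Fin d → ℤ) : Fin d → ℂ :=
  ∑' l : Fin d → ℤ, s (k - l) • z l

/-- The discrete Hardy norm `‖s‖_{h¹} = ‖s‖_{ℓ¹} + ‖s * z‖_{ℓ¹}` (value in `[0,∞]`). -/
def h1Norm {d : ℕ} (b : Matrix (Fin d) (Fin d) ℝ) (ν : (Fin d → ℝ) → ℝ)
    (s : (Fin d → ℤ) → ℂ) : ℝ≥0∞ :=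
  (∑' k : Fin d → ℤ, (‖s k‖₊ : ℝ≥0∞)) +
    ∑' k : Fin d → ℤ, (‖dConv s (zKernel b ν) k‖₊ : ℝ≥0∞)

/-- The mixed norm `‖c‖_{ℓ¹(h¹)} = Σ_j ‖c_j‖_{h¹}` (value in `[0,∞]`). -/
def l1h1Norm {d : ℕ} (b : Matrix (Fin d) (Fin d) ℝ) (ν : (Fin d → ℝ) → ℝ)
    (c : ℕ → (Fin d → ℤ) → ℂ) : ℝ≥0∞ :=
  ∑' j : ℕ, h1Norm b ν (c j)

/-- `ψ_{j,k}(x) = |det a_j| ψ(a_j x - bk)` for isotropic dilations `a_j = α_j I`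
(Hardy-space normalization, `p = 1`). -/
def rescH {d : ℕ} (α : ℕ → ℝ) (b : Matrix (Fin d) (Fin d) ℝ) (ψ : (Fin d → ℝ) → ℂ)
    (j : ℕ) (k : Fin d → ℤ) (x : Fin d → ℝ) : ℂ :=
  ((|α j| ^ d : ℝ) : ℂ) * ψ (α j • x - b *ᵥ intVec k)

/-- The synthesis series `Sc = Σ_j Σ_k c_{j,k} ψ_{j,k}` converges to `f` in `H¹`:
for each `j` the sum over `k` converges absolutely in `L¹` to a function belonging to
`H¹`, and the sum over `j` converges absolutely in `H¹`, with limit `f`. -/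
def H1SynthesisTo {d : ℕ} (α : ℕ → ℝ) (b : Matrix (Fin d) (Fin d) ℝ)
    (ψ : (Fin d → ℝ) → ℂ) (c : ℕ → (Fin d → ℤ) → ℂ) (f : (Fin d → ℝ) → ℂ) : Prop :=
  (∀ j : ℕ, Summable fun k : Fin d → ℤ => ∫ x : Fin d → ℝ, ‖c j k * rescH α b ψ j k x‖) ∧
  (∀ j : ℕ, MemH1 (fun x => ∑' k : Fin d → ℤ, c j k * rescH α b ψ j k x)) ∧
  Summable (fun j : ℕ =>
    (hardyNorm (fun x => ∑' k : Fin d → ℤ, c j k * rescH α b ψ j k x)).toReal) ∧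
  Tendsto (fun J : ℕ => hardyNorm
      (fun x => f x - ∑ j ∈ Finset.range J, ∑' k : Fin d → ℤ, c j k * rescH α b ψ j k x))
    atTop (𝓝 0)

/-- Analysis operator at scale `j` in the Hardy-space setting (`p = 1`, `q = ∞`):
`(T_j f)_k = |det b| ⟨f, φ_{j,k}⟩` with `φ_{j,k}(x) = φ(α_j x - bk)`. -/
def TjH {d : ℕ} (α : ℕ → ℝ) (b : Matrix (Fin d) (Fin d) ℝ) (φ : (Fin d → ℝ) → ℂ)
    (f : (Fin d → ℝ) → ℂ) (j : ℕ) (k : Fin d → ℤ) : ℂ :=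
  ((|b.det| : ℝ) : ℂ) *
    ∫ x : Fin d → ℝ, f x * (starRingEnd ℂ) (φ (α j • x - b *ᵥ intVec k))

/-- Dot product of row vector `ξ` and column vector `x`. -/
def dotP {d : ℕ} (ξ x : Fin d → ℝ) : ℝ := ∑ i, ξ i * x i

/-- Fourier transform `f̂(ξ) = ∫ f(x) e^{-2πi ξ x} dx`. -/
def ft {d : ℕ} (f : (Fin d → ℝ) → ℂ) (ξ : Fin d → ℝ) : ℂ :=
  ∫ x : Fin d → ℝ, Complex.exp ((-(2 * Real.pi * dotP ξ x) : ℝ) * Complex.I) * f x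

/-- Inverse Fourier transform `ǧ(x) = ∫ g(ξ) e^{2πi ξ x} dξ`. -/
def ftInv {d : ℕ} (g : (Fin d → ℝ) → ℂ) (x : Fin d → ℝ) : ℂ :=
  ∫ ξ : Fin d → ℝ, Complex.exp (((2 * Real.pi * dotP ξ x) : ℝ) * Complex.I) * g ξ

/-- `f` is a Schwartz function. -/
def IsSchwartz {d : ℕ} (f : (Fin d → ℝ) → ℂ) : Prop :=
  ∃ Φ : SchwartzMap (Fin d → ℝ) ℂ, ∀ x, f x = Φ x

/-- Convolution `(f * g)(x) = ∫ f(y) g(x - y) dy`. -/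
def conv {d : ℕ} (f g : (Fin d → ℝ) → ℂ) (x : Fin d → ℝ) : ℂ :=
  ∫ y : Fin d → ℝ, f y * g (x - y)

/-- The periodization `Pg(x) = |det b| Σ_{k ∈ ℤ^d} g(x - bk)` of a real-valued function. -/
def periodization {d : ℕ} (b : Matrix (Fin d) (Fin d) ℝ) (g : (Fin d → ℝ) → ℝ)
    (x : Fin d → ℝ) : ℝ :=
  |b.det| * ∑' k : Fin d → ℤ, g (x - b *ᵥ intVec k)

section Plancherel

open scoped FourierTransform ContDiff

variable {E : Type*} [NormedAddCommGroup E] [InnerProductSpace ℝ E] [FiniteDimensional ℝ E]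
  [MeasurableSpace E] [BorelSpace E]

/-- On `L¹ ∩ L²` the `L²` Fourier transform is given by the Fourier integral. -/
theorem fourier_toLp_ae_eq {F : E → ℂ} (h₁ : Integrable F) (h₂ : MemLp F 2) :
    (𝓕 (h₂.toLp F) : Lp ℂ 2 (volume : Measure E)) =ᵐ[volume] 𝓕 F := by
  have hcont : Continuous (𝓕 F) :=
    VectorFourier.fourierIntegral_continuous Real.continuous_fourierChar
      (by exact continuous_inner) h₁
  apply ae_eq_of_integral_contDiff_smul_eq
  · exact (Lp.memLp _).locallyIntegrable (by norm_num)
  · exact hcont.locallyIntegrable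
  intro g g_smooth g_cpt
  have hg₁ : HasCompactSupport (Complex.ofRealCLM ∘ g) := g_cpt.comp_left rfl
  have hg₂ : ContDiff ℝ ∞ (Complex.ofRealCLM ∘ g) := by fun_prop
  set h := hg₁.toSchwartzMap hg₂ with hh
  have hval : ∀ x, h x = (g x : ℂ) := fun x => rfl
  set u : Lp ℂ 2 (volume : Measure E) := h₂.toLp F with hu
  have e1 := congrArg (fun T => T h) (Lp.fourier_toTemperedDistribution_eq u)
  simp only [TemperedDistribution.fourier_apply, Lp.toTemperedDistribution_apply] at e1
  set v : Lp ℂ 2 (volume : Measure E) := 𝓕 u with hv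
  have e2 : ∫ x, g x • v x = ∫ x, h x • v x := by
    simp [hval]
  rw [e2, ← e1]
  have e3 : ∫ x, (𝓕 h) x • u x = ∫ x, (𝓕 h) x • F x := by
    apply integral_congr_ae
    filter_upwards [h₂.coeFn_toLp] with x hx
    rw [hu, hx]
  rw [e3]
  have e4 := VectorFourier.integral_fourierIntegral_smul_eq_flip (μ := (volume : Measure E))
    (ν := (volume : Measure E)) (L := innerₗ E) (f := (h : E → ℂ)) (g := F)
    Real.continuous_fourierChar (by exact continuous_inner) h.integrable h₁
  rw [flip_innerₗ] at e4
  refine e4.trans ?_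
  apply integral_congr_ae
  filter_upwards with x
  simp only [hval, Complex.real_smul, smul_eq_mul]
  rfl

/-- Plancherel's theorem for functions in `L¹ ∩ L²`. -/
theorem eLpNorm_fourier_eq {F : E → ℂ} (h₁ : Integrable F) (h₂ : MemLp F 2) :
    eLpNorm (𝓕 F) 2 = eLpNorm F 2 := by
  rw [← eLpNorm_congr_ae (fourier_toLp_ae_eq h₁ h₂), ← Lp.enorm_def, ← Lp.enorm_toLp h₂]
  rw [← ofReal_norm, ← ofReal_norm, Lp.norm_fourier_eq]

end Plancherel

section FourierBasics

open scoped FourierTransform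

variable {d : ℕ}

/-- The pairing `dotP` as a bilinear form. -/
def dotForm (d : ℕ) : (Fin d → ℝ) →ₗ[ℝ] (Fin d → ℝ) →ₗ[ℝ] ℝ :=
  LinearMap.mk₂ ℝ (fun x ξ => dotP ξ x)
    (by intros; simp [dotP, mul_add, Finset.sum_add_distrib])
    (by intros; simp only [dotP, Pi.smul_apply, smul_eq_mul, Finset.mul_sum]; congr; ext; ring)
    (by intros; simp [dotP, add_mul, Finset.sum_add_distrib])
    (by intros; simp only [dotP, Pi.smul_apply, smul_eq_mul, Finset.mul_sum]; congr; ext; ring)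

theorem dotForm_apply (x ξ : Fin d → ℝ) : dotForm d x ξ = dotP ξ x := rfl

theorem dotP_comm (x y : Fin d → ℝ) : dotP x y = dotP y x := by
  simp [dotP, mul_comm]

theorem dotForm_flip : (dotForm d).flip = dotForm d := by
  ext x y; simp [dotForm_apply, dotP, Pi.single_apply, mul_comm]

theorem continuous_dotForm :
    Continuous fun p : (Fin d → ℝ) × (Fin d → ℝ) => dotForm d p.1 p.2 := by
  simp only [dotForm_apply, dotP]
  fun_prop

theorem ft_eq_vectorFourier (f : (Fin d → ℝ) → ℂ) :
    ft f = VectorFourier.fourierIntegral Real.fourierChar volume (dotForm d) f := by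
  ext ξ
  simp only [ft, VectorFourier.fourierIntegral, Circle.smul_def, Real.fourierChar_apply,
    dotForm_apply, smul_eq_mul]
  congr; ext x; congr 3; push_cast; ring

theorem ft_eq_fourier (f : (Fin d → ℝ) → ℂ) (ξ : Fin d → ℝ) :
    ft f ξ = 𝓕 (fun x : EuclideanSpace ℝ (Fin d) => f x.ofLp) (WithLp.toLp 2 ξ) := by
  rw [Real.fourier_eq', ft]
  rw [← (PiLp.volume_preserving_toLp (Fin d)).integral_comp
    (MeasurableEquiv.toLp 2 (Fin d → ℝ)).measurableEmbedding]
  simp only [smul_eq_mul, dotP, PiLp.inner_apply, RCLike.inner_apply, conj_trivial]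
  congr; ext x; push_cast; congr 2; ring

theorem continuous_ft {f : (Fin d → ℝ) → ℂ} (hf : Integrable f) : Continuous (ft f) := by
  rw [ft_eq_vectorFourier]
  exact VectorFourier.fourierIntegral_continuous Real.continuous_fourierChar continuous_dotForm hf

theorem norm_ft_le (f : (Fin d → ℝ) → ℂ) (ξ : Fin d → ℝ) : ‖ft f ξ‖ ≤ ∫ x, ‖f x‖ := by
  rw [ft_eq_vectorFourier]
  exact VectorFourier.norm_fourierIntegral_le_integral_norm _ _ _ _ _

/-- The Fourier transform is self-adjoint. -/
theorem integral_ft_mul {f g : (Fin d → ℝ) → ℂ} (hf : Integrable f) (hg : Integrable g) :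
    ∫ ξ, ft f ξ * g ξ = ∫ x, f x * ft g x := by
  have := VectorFourier.integral_fourierIntegral_smul_eq_flip (μ := (volume : Measure (Fin d → ℝ)))
    (ν := (volume : Measure (Fin d → ℝ))) (L := dotForm d) (f := f) (g := g)
    Real.continuous_fourierChar continuous_dotForm hf hg
  rw [dotForm_flip] at this
  simpa [ft_eq_vectorFourier] using this

theorem eLpNorm_ft_eq {f : (Fin d → ℝ) → ℂ} (h₁ : Integrable f) (h₂ : MemLp f 2) :
    eLpNorm (ft f) 2 = eLpNorm f 2 := by
  have hmp := PiLp.volume_preserving_ofLp (Fin d)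
  have h₁' : Integrable (fun x : EuclideanSpace ℝ (Fin d) => f x.ofLp) :=
    hmp.integrable_comp_of_integrable h₁
  have h₂' : MemLp (fun x : EuclideanSpace ℝ (Fin d) => f x.ofLp) 2 :=
    h₂.comp_measurePreserving hmp
  have key := eLpNorm_fourier_eq h₁' h₂'
  have e1 : eLpNorm (fun x : EuclideanSpace ℝ (Fin d) => f x.ofLp) 2 = eLpNorm f 2 :=
    eLpNorm_comp_measurePreserving h₂.1 hmp
  have e2 : eLpNorm (𝓕 (fun x : EuclideanSpace ℝ (Fin d) => f x.ofLp)) 2 = eLpNorm (ft f) 2 := by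
    rw [← eLpNorm_comp_measurePreserving (continuous_ft h₁).aestronglyMeasurable hmp]
    congr 1
    ext ξ
    simp [ft_eq_fourier]
  rw [← e2, key, e1]

end FourierBasics

section Kernel

open scoped FourierTransform

variable {d : ℕ}

/-- The squared Euclidean length. -/
def sqN (y : Fin d → ℝ) : ℝ := ∑ j, y j ^ 2

theorem sqN_nonneg (y : Fin d → ℝ) : 0 ≤ sqN y := Finset.sum_nonneg fun _ _ => sq_nonneg _

theorem eucNorm_sq (y : Fin d → ℝ) : eucNorm y ^ 2 = sqN y := Real.sq_sqrt (sqN_nonneg y)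

theorem eucNorm_nonneg (y : Fin d → ℝ) : 0 ≤ eucNorm y := Real.sqrt_nonneg _

theorem eucNorm_eq_norm (y : Fin d → ℝ) : eucNorm y = ‖WithLp.toLp 2 y‖ := by
  simp [eucNorm, EuclideanSpace.norm_eq]

theorem continuous_sqN : Continuous (sqN : (Fin d → ℝ) → ℝ) := by
  unfold sqN; fun_prop

theorem continuous_eucNorm : Continuous (eucNorm : (Fin d → ℝ) → ℝ) :=
  continuous_sqN.sqrt

theorem abs_apply_le_eucNorm (y : Fin d → ℝ) (i : Fin d) : |y i| ≤ eucNorm y := by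
  apply Real.abs_le_sqrt
  exact Finset.single_le_sum (f := fun j => y j ^ 2) (fun _ _ => sq_nonneg _) (Finset.mem_univ i)

theorem norm_le_eucNorm (y : Fin d → ℝ) : ‖y‖ ≤ eucNorm y :=
  (pi_norm_le_iff_of_nonneg (eucNorm_nonneg y)).2 fun i => abs_apply_le_eucNorm y i

theorem eucNorm_le (y : Fin d → ℝ) : eucNorm y ≤ d * ‖y‖ := by
  have h1 : sqN y ≤ (d * ‖y‖) ^ 2 := by
    have : ∀ j ∈ (Finset.univ : Finset (Fin d)), y j ^ 2 ≤ ‖y‖ ^ 2 := fun j _ => by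
      rw [← sq_abs]
      exact pow_le_pow_left₀ (abs_nonneg _) (norm_le_pi_norm y j) 2
    have h2 := Finset.sum_le_sum this
    simp only [Finset.sum_const, Finset.card_univ, Fintype.card_fin, nsmul_eq_mul] at h2
    refine h2.trans ?_
    rw [mul_pow]
    gcongr
    rcases Nat.eq_zero_or_pos d with h | h
    · simp [h]
    · have : (1 : ℝ) ≤ d := by exact_mod_cast h
      nlinarith
  exact Real.sqrt_le_iff.2 ⟨by positivity, h1⟩

theorem eucNorm_pos {y : Fin d → ℝ} (h : y ≠ 0) : 0 < eucNorm y :=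
  (norm_pos_iff.2 h).trans_le (norm_le_eucNorm y)

/-- A multiple of the `i`-th partial derivative of the Gaussian at frequency scale `w`. -/
def gaussK (i : Fin d) (w : ℝ) (y : Fin d → ℝ) : ℝ :=
  2 * w ^ d * y i * Real.exp (-Real.pi * w ^ 2 * sqN y)

/-- The truncated Riesz kernel obtained by superposing Gaussian derivatives. -/
def kerK (a b : ℝ) (i : Fin d) (y : Fin d → ℝ) : ℝ := ∫ w in a..b, gaussK i w y

theorem continuous_gaussK (i : Fin d) :
    Continuous fun p : (Fin d → ℝ) × ℝ => gaussK i p.2 p.1 := by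
  unfold gaussK sqN; fun_prop

theorem continuous_kerK (a b : ℝ) (i : Fin d) : Continuous (kerK a b i) :=
  intervalIntegral.continuous_parametric_intervalIntegral_of_continuous'
    (continuous_gaussK i) a b

theorem integrable_mul_exp_sqN {c : ℝ} (hc : 0 < c) (i : Fin d) :
    Integrable fun y : Fin d → ℝ => y i * Real.exp (-c * sqN y) := by
  have := Integrable.fintype_prod (μ := fun _ : Fin d => (volume : Measure ℝ))
    (f := fun j t => (if j = i then t else 1) * Real.exp (-c * t ^ 2)) (fun j => by
      by_cases h : j = i
      · simpa [h] using integrable_mul_exp_neg_mul_sq hc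
      · simpa [h] using integrable_exp_neg_mul_sq hc)
  refine this.congr (Eventually.of_forall fun y => ?_)
  simp only [Finset.prod_mul_distrib, ← Real.exp_sum, sqN, Finset.mul_sum]
  congr 1
  simp

theorem abs_gaussK_le {a b w : ℝ} (ha : 0 ≤ a) (h1 : a ≤ w) (h2 : w ≤ b) (i : Fin d)
    (y : Fin d → ℝ) :
    |gaussK i w y| ≤ 2 * b ^ d * (|y i| * Real.exp (-(Real.pi * a ^ 2) * sqN y)) := by
  have hw : 0 ≤ w := ha.trans h1
  have hb : 0 ≤ b := hw.trans h2
  have := sqN_nonneg y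
  rw [gaussK, abs_mul, abs_mul, abs_mul, abs_of_pos (Real.exp_pos _), abs_of_nonneg
    (by positivity : (0:ℝ) ≤ w ^ d), abs_two, ← mul_assoc]
  gcongr
  have := Real.pi_pos
  rw [neg_mul]
  gcongr

theorem abs_kerK_le {a b : ℝ} (ha : 0 ≤ a) (hab : a ≤ b) (i : Fin d) (y : Fin d → ℝ) :
    |kerK a b i y| ≤ 2 * b ^ d * (|y i| * Real.exp (-(Real.pi * a ^ 2) * sqN y)) * (b - a) := by
  have := intervalIntegral.norm_integral_le_of_norm_le_const (a := a) (b := b)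
    (f := fun w => gaussK i w y)
    (C := 2 * b ^ d * (|y i| * Real.exp (-(Real.pi * a ^ 2) * sqN y))) (fun w hw => by
      rw [uIoc_of_le hab] at hw
      exact abs_gaussK_le ha hw.1.le hw.2 i y)
  rwa [abs_of_nonneg (sub_nonneg.2 hab)] at this

theorem integrable_kerK {a b : ℝ} (ha : 0 < a) (hab : a ≤ b) (i : Fin d) :
    Integrable (kerK a b i) := by
  have h := ((integrable_mul_exp_sqN (d := d) (c := Real.pi * a ^ 2)
    (by have := Real.pi_pos; positivity) i).norm.const_mul (2 * b ^ d)).mul_const (b - a)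
  refine h.mono' (continuous_kerK a b i).aestronglyMeasurable (Eventually.of_forall fun y => ?_)
  rw [norm_mul, Real.norm_of_nonneg (Real.exp_pos _).le]
  exact abs_kerK_le ha.le hab i y

theorem exists_abs_kerK_le {a b : ℝ} (ha : 0 < a) (hab : a ≤ b) (i : Fin d) :
    ∃ C, ∀ y, |kerK a b i y| ≤ C := by
  have hc : 0 < Real.pi * a ^ 2 := by have := Real.pi_pos; positivity
  have hb : 0 ≤ b := ha.le.trans hab
  refine ⟨2 * b ^ d * (1 / (Real.pi * a ^ 2) + 1) * (b - a), fun y => ?_⟩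
  refine (abs_kerK_le ha.le hab i y).trans ?_
  have hba : 0 ≤ b - a := sub_nonneg.2 hab
  gcongr
  set c := Real.pi * a ^ 2
  have h1 : y i ^ 2 ≤ sqN y :=
    Finset.single_le_sum (f := fun j => y j ^ 2) (fun _ _ => sq_nonneg _) (Finset.mem_univ i)
  have h2 : |y i| ≤ 1 + sqN y := by nlinarith [sq_abs (y i), sq_nonneg (|y i| - 1), abs_nonneg (y i)]
  have h3 : c * sqN y ≤ Real.exp (c * sqN y) := by linarith [Real.add_one_le_exp (c * sqN y)]
  have h4 : 1 ≤ Real.exp (c * sqN y) := Real.one_le_exp (mul_nonneg hc.le (sqN_nonneg y))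
  rw [neg_mul, Real.exp_neg, ← div_eq_mul_inv, div_le_iff₀ (Real.exp_pos _)]
  have h5 : sqN y ≤ 1 / c * Real.exp (c * sqN y) := by
    rw [one_div, inv_mul_eq_div, le_div_iff₀ hc]; linarith
  nlinarith

/-! ### The Fourier transform of the kernels -/

theorem integral_exp_gaussian {w : ℝ} (hw : 0 < w) (ξ : ℝ) :
    ∫ t : ℝ, Complex.exp ((-(2 * Real.pi * (ξ * t)) : ℝ) * Complex.I) *
      (Real.exp (-Real.pi * w ^ 2 * t ^ 2) : ℂ) =
      (w⁻¹ * Real.exp (-Real.pi * ξ ^ 2 / w ^ 2) : ℝ) := by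
  have h := congrFun (fourier_gaussian_pi (b := ((w : ℂ)) ^ 2)
    (by rw [← Complex.ofReal_pow, Complex.ofReal_re]; positivity)) ξ
  rw [Real.fourier_eq'] at h
  convert! h using 1
  · congr; ext t
    simp only [smul_eq_mul, RCLike.inner_apply, conj_trivial]
    push_cast
    congr 2; ring
  · have : ((w : ℂ) ^ 2) ^ ((1 : ℂ) / 2) = w := by
      have := Complex.ofReal_cpow (x := w ^ 2) (by positivity) (1 / 2)
      push_cast at this
      rw [← this, ← Real.sqrt_eq_rpow, Real.sqrt_sq hw.le]
    rw [this]
    push_cast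
    rw [one_div]
    congr 2; field_simp

theorem integral_exp_mul_gaussian {w : ℝ} (hw : 0 < w) (ξ : ℝ) :
    ∫ t : ℝ, Complex.exp ((-(2 * Real.pi * (ξ * t)) : ℝ) * Complex.I) *
      ((t * Real.exp (-Real.pi * w ^ 2 * t ^ 2) : ℝ) : ℂ) =
      -Complex.I * (ξ * (w⁻¹ ^ 3 * Real.exp (-Real.pi * ξ ^ 2 / w ^ 2)) : ℝ) := by
  have hpi := Real.pi_pos
  set F : ℝ → ℂ := fun t => (Real.exp (-Real.pi * w ^ 2 * t ^ 2) : ℂ)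
  have hc : 0 < Real.pi * w ^ 2 := by positivity
  have hder : ∀ t, HasDerivAt F
      (((-(2 * Real.pi * w ^ 2)) * (t * Real.exp (-Real.pi * w ^ 2 * t ^ 2)) : ℝ) : ℂ) t := by
    intro t
    have : HasDerivAt (fun t : ℝ => Real.exp (-Real.pi * w ^ 2 * t ^ 2))
      ((-(2 * Real.pi * w ^ 2)) * (t * Real.exp (-Real.pi * w ^ 2 * t ^ 2))) t := by
      have := (((hasDerivAt_pow 2 t).const_mul (-Real.pi * w ^ 2))).exp
      convert! this using 1; push_cast; ring
    exact this.ofReal_comp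
  have hF : Integrable F := by
    have := (integrable_exp_neg_mul_sq hc).ofReal (𝕜 := ℂ)
    refine this.congr (Eventually.of_forall fun t => ?_)
    simp [F]
  have hF' : Integrable (deriv F) := by
    have := ((integrable_mul_exp_neg_mul_sq hc).const_mul (-(2 * Real.pi * w ^ 2))).ofReal (𝕜 := ℂ)
    refine this.congr (Eventually.of_forall fun t => ?_)
    simp only [(hder t).deriv, neg_mul]
    rfl
  have h := congrFun (Real.fourier_deriv hF (fun t => (hder t).differentiableAt) hF') ξ
  rw [Real.fourier_eq', Real.fourier_eq'] at h
  have e1 : ∫ t : ℝ, Complex.exp ((-2 * Real.pi * inner ℝ t ξ : ℝ) * Complex.I) • F t =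
      (w⁻¹ * Real.exp (-Real.pi * ξ ^ 2 / w ^ 2) : ℝ) := by
    rw [← integral_exp_gaussian hw ξ]
    congr; ext t
    simp only [smul_eq_mul, RCLike.inner_apply, conj_trivial, F]
    congr 4; ring
  have e2 : ∫ t : ℝ, Complex.exp ((-2 * Real.pi * inner ℝ t ξ : ℝ) * Complex.I) • deriv F t =
      (-(2 * Real.pi * w ^ 2) : ℝ) *
      ∫ t : ℝ, Complex.exp ((-(2 * Real.pi * (ξ * t)) : ℝ) * Complex.I) *
      ((t * Real.exp (-Real.pi * w ^ 2 * t ^ 2) : ℝ) : ℂ) := by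
    rw [← integral_const_mul]
    congr; ext t
    simp only [smul_eq_mul, RCLike.inner_apply, conj_trivial, (hder t).deriv]
    push_cast
    rw [mul_left_comm]
    congr 3; ring
  rw [e1, e2] at h
  have h3 : ((-(2 * Real.pi * w ^ 2) : ℝ) : ℂ) ≠ 0 := by
    rw [Complex.ofReal_ne_zero]; apply neg_ne_zero.2; positivity
  apply mul_left_cancel₀ h3
  rw [h, smul_eq_mul]
  have hw' : (w : ℂ) ≠ 0 := by exact_mod_cast hw.ne'
  push_cast
  field_simp

theorem ft_gaussK {w : ℝ} (hw : 0 < w) (i : Fin d) (ξ : Fin d → ℝ) :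
    ft (fun y => (gaussK i w y : ℂ)) ξ =
      -Complex.I * (ξ i * (2 * (w ^ 2)⁻¹ * Real.exp (-Real.pi * sqN ξ / w ^ 2)) : ℝ) := by
  have h := integral_fintype_prod_volume_eq_prod (ι := Fin d) (𝕜 := ℂ)
    (E := fun _ => ℝ)
    (fun j t => Complex.exp ((-(2 * Real.pi * (ξ j * t)) : ℝ) * Complex.I) *
      (((if j = i then t else 1) * Real.exp (-Real.pi * w ^ 2 * t ^ 2) : ℝ) : ℂ))
  have e1 : ft (fun y => (gaussK i w y : ℂ)) ξ = ((2 * w ^ d : ℝ) : ℂ) *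
      ∫ y : Fin d → ℝ, ∏ j, Complex.exp ((-(2 * Real.pi * (ξ j * y j)) : ℝ) * Complex.I) *
      (((if j = i then y j else 1) * Real.exp (-Real.pi * w ^ 2 * y j ^ 2) : ℝ) : ℂ) := by
    rw [ft, ← integral_const_mul]
    congr; ext y
    rw [Finset.prod_mul_distrib, ← Complex.exp_sum, ← Finset.sum_mul, ← Complex.ofReal_prod,
      Finset.prod_mul_distrib, ← Real.exp_sum, ← Complex.ofReal_sum, mul_left_comm]
    congr 1
    · simp [dotP, Finset.mul_sum]
    · rw [← Complex.ofReal_mul]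
      simp [gaussK, sqN, Finset.mul_sum, mul_assoc]
  have e2 : ∀ j, ∫ t : ℝ, Complex.exp ((-(2 * Real.pi * (ξ j * t)) : ℝ) * Complex.I) *
      (((if j = i then t else 1) * Real.exp (-Real.pi * w ^ 2 * t ^ 2) : ℝ) : ℂ) =
      (if j = i then -Complex.I * (ξ i * (w⁻¹ ^ 2 : ℝ)) else 1) *
        (w⁻¹ * Real.exp (-Real.pi * ξ j ^ 2 / w ^ 2) : ℝ) := by
    intro j
    by_cases hj : j = i
    · simp only [hj, if_true]
      rw [integral_exp_mul_gaussian hw]; push_cast; ring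
    · simp only [hj, if_false, one_mul]
      rw [integral_exp_gaussian hw]
  rw [e1, h]
  simp only [e2]
  rw [Finset.prod_mul_distrib, ← Complex.ofReal_prod, Finset.prod_mul_distrib, ← Real.exp_sum]
  simp only [Finset.prod_ite_eq', Finset.mem_univ, if_true, Finset.prod_const, Finset.card_univ,
    Fintype.card_fin]
  have : ∑ x, -Real.pi * ξ x ^ 2 / w ^ 2 = -Real.pi * sqN ξ / w ^ 2 := by
    rw [sqN, Finset.mul_sum, Finset.sum_div]
  rw [this]
  have hw' : (w : ℂ) ≠ 0 := by exact_mod_cast hw.ne'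
  push_cast
  have : (w : ℂ) ^ d * ((w : ℂ)⁻¹) ^ d = 1 := by
    rw [← mul_pow, mul_inv_cancel₀ hw', one_pow]
  linear_combination (2 * -Complex.I * ξ i * (w : ℂ)⁻¹ ^ 2 *
    Complex.exp (-Real.pi * sqN ξ / w ^ 2)) * this

end Kernel

section Gamma

/-- The radial profile whose integral over `(0, ∞)` is `rieszConst m`. -/
def gam (m : ℕ) (v : ℝ) : ℝ := 2 * v ^ m * Real.exp (-Real.pi * v ^ 2)

/-- The primitive of `gam m` vanishing at the origin. -/
def gamI (m : ℕ) (x : ℝ) : ℝ := ∫ v in (0 : ℝ)..x, gam m v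

theorem continuous_gam (m : ℕ) : Continuous (gam m) := by unfold gam; fun_prop

theorem gam_nonneg (m : ℕ) {v : ℝ} (hv : 0 ≤ v) : 0 ≤ gam m v := by unfold gam; positivity

theorem integrableOn_gam (m : ℕ) : IntegrableOn (gam m) (Ioi 0) := by
  have := (integrableOn_rpow_mul_exp_neg_mul_sq Real.pi_pos
    (s := (m : ℝ)) (by have : (0:ℝ) ≤ m := m.cast_nonneg
                       linarith)).const_mul 2
  refine this.congr (Eventually.of_forall fun v => ?_)
  simp [gam, Real.rpow_natCast, mul_assoc]

theorem integral_gam (m : ℕ) : ∫ v in Ioi (0 : ℝ), gam m v = rieszConst m := by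
  have := integral_rpow_mul_exp_neg_mul_rpow (p := 2) (q := (m : ℝ)) two_pos
    (by have : (0:ℝ) ≤ m := m.cast_nonneg
        linarith) Real.pi_pos
  have e : ∫ v in Ioi (0 : ℝ), gam m v =
      2 * ∫ x in Ioi (0 : ℝ), x ^ (m : ℝ) * Real.exp (-Real.pi * x ^ (2 : ℝ)) := by
    rw [← integral_const_mul]
    refine integral_congr_ae (Eventually.of_forall fun v => ?_)
    simp [gam, Real.rpow_natCast, mul_assoc]
  rw [e, this, rieszConst, neg_div, Real.rpow_neg Real.pi_pos.le]
  ring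

theorem rieszConst_pos (m : ℕ) : 0 < rieszConst m := by
  unfold rieszConst
  have := Real.Gamma_pos_of_pos (s := ((m : ℝ) + 1) / 2) (by positivity)
  have := Real.rpow_pos_of_pos Real.pi_pos (((m : ℝ) + 1) / 2)
  positivity

theorem rieszConst_zero : rieszConst 0 = 1 := by
  have := Real.rpow_pos_of_pos Real.pi_pos (1 / 2)
  rw [rieszConst, Nat.cast_zero, zero_add, Real.Gamma_one_half_eq, Real.sqrt_eq_rpow]
  exact div_self this.ne'

theorem gamI_eq {m : ℕ} {x : ℝ} (hx : 0 ≤ x) : gamI m x = ∫ v in Ioc 0 x, gam m v :=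
  intervalIntegral.integral_of_le hx

theorem gamI_nonneg (m : ℕ) {x : ℝ} (hx : 0 ≤ x) : 0 ≤ gamI m x :=
  intervalIntegral.integral_nonneg hx fun _ hv => gam_nonneg m hv.1

theorem gamI_mono (m : ℕ) {x y : ℝ} (hx : 0 ≤ x) (hxy : x ≤ y) : gamI m x ≤ gamI m y :=
  intervalIntegral.integral_mono_interval le_rfl hx hxy
    ((ae_restrict_iff' measurableSet_Ioc).2
      (Eventually.of_forall fun _ hv => gam_nonneg m hv.1.le))
    ((continuous_gam m).intervalIntegrable _ _)

theorem tendsto_gamI (m : ℕ) : Tendsto (gamI m) atTop (𝓝 (rieszConst m)) := by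
  rw [← integral_gam]
  exact intervalIntegral_tendsto_integral_Ioi 0 (integrableOn_gam m) tendsto_id

theorem gamI_le (m : ℕ) {x : ℝ} (hx : 0 ≤ x) : gamI m x ≤ rieszConst m :=
  ge_of_tendsto (tendsto_gamI m) (eventually_atTop.2 ⟨x, fun _ hy => gamI_mono m hx hy⟩)

theorem hasDerivAt_gamI (m : ℕ) (x : ℝ) : HasDerivAt (gamI m) (gam m x) x :=
  intervalIntegral.integral_hasDerivAt_right ((continuous_gam m).intervalIntegrable _ _)
    ((continuous_gam m).stronglyMeasurableAtFilter _ _) (continuous_gam m).continuousAt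

theorem continuous_gamI (m : ℕ) : Continuous (gamI m) :=
  continuous_iff_continuousAt.2 fun x => (hasDerivAt_gamI m x).continuousAt

theorem gamI_zero_right (m : ℕ) : gamI m 0 = 0 := by simp [gamI]

theorem integral_gam_comp_mul (m : ℕ) {r : ℝ} (hr : 0 < r) (a b : ℝ) :
    ∫ w in a..b, 2 * w ^ m * Real.exp (-Real.pi * w ^ 2 * r ^ 2) =
      (gamI m (b * r) - gamI m (a * r)) / r ^ (m + 1) := by
  have h : ∀ w ∈ uIcc a b, HasDerivAt (fun w => gamI m (w * r) / r ^ (m + 1))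
      (2 * w ^ m * Real.exp (-Real.pi * w ^ 2 * r ^ 2)) w := fun w _ => by
    have := ((hasDerivAt_gamI m (w * r)).comp w ((hasDerivAt_id w).mul_const r)).div_const
      (r ^ (m + 1))
    convert! this using 1
    rw [gam, mul_pow, mul_pow, one_mul, ← mul_assoc]
    field_simp
    ring
  rw [intervalIntegral.integral_eq_sub_of_hasDerivAt h
    (Continuous.intervalIntegrable (by fun_prop) _ _), sub_div]

theorem integral_gam_comp_mul_le (m : ℕ) {r : ℝ} (hr : 0 < r) {a b : ℝ} (ha : 0 ≤ a)
    (hab : a ≤ b) :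
    ∫ w in a..b, 2 * w ^ m * Real.exp (-Real.pi * w ^ 2 * r ^ 2) ≤
      rieszConst m / r ^ (m + 1) := by
  rw [integral_gam_comp_mul m hr]
  have h1 := gamI_nonneg m (mul_nonneg ha hr.le)
  have h2 := gamI_le m (mul_nonneg (ha.trans hab) hr.le)
  gcongr
  linarith

theorem integral_gam_zero_comp_div {r a b : ℝ} (ha : 0 < a) (hab : a ≤ b) :
    ∫ w in a..b, r * (2 * (w ^ 2)⁻¹ * Real.exp (-Real.pi * r ^ 2 / w ^ 2)) =
      gamI 0 (r / a) - gamI 0 (r / b) := by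
  have hpos : ∀ w ∈ uIcc a b, 0 < w := fun w hw => by
    rw [uIcc_of_le hab] at hw; exact ha.trans_le hw.1
  have h : ∀ w ∈ uIcc a b, HasDerivAt (fun w => - gamI 0 (r / w))
      (r * (2 * (w ^ 2)⁻¹ * Real.exp (-Real.pi * r ^ 2 / w ^ 2))) w := fun w hw => by
    have hw := (hpos w hw).ne'
    have := ((hasDerivAt_gamI 0 (r / w)).comp w ((hasDerivAt_inv hw).const_mul r)).neg
    convert! this using 1
    rw [gam, div_pow]
    field_simp
  rw [intervalIntegral.integral_eq_sub_of_hasDerivAt h, neg_sub_neg]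
  apply ContinuousOn.intervalIntegrable
  have h1 : ∀ w ∈ uIcc a b, w ^ 2 ≠ 0 := fun w hw => pow_ne_zero 2 (hpos w hw).ne'
  fun_prop (disch := assumption)

end Gamma

section KernelEstimates

variable {d : ℕ}

theorem ft_kerK {a b : ℝ} (ha : 0 < a) (hab : a ≤ b) (i : Fin d) (ξ : Fin d → ℝ) :
    ft (fun y => (kerK a b i y : ℂ)) ξ =
      -Complex.I * ((ξ i / eucNorm ξ) *
        (gamI 0 (eucNorm ξ / a) - gamI 0 (eucNorm ξ / b)) : ℝ) := by
  have hmeas : AEStronglyMeasurable (fun p : ℝ × (Fin d → ℝ) =>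
      Complex.exp ((-(2 * Real.pi * dotP ξ p.2) : ℝ) * Complex.I) * (gaussK i p.1 p.2 : ℂ))
      ((volume.restrict (uIoc a b)).prod volume) := by
    apply Continuous.aestronglyMeasurable
    have := (continuous_gaussK i).comp
      (continuous_swap : Continuous (Prod.swap : ℝ × (Fin d → ℝ) → _))
    simp only [Function.comp_def, Prod.fst_swap, Prod.snd_swap] at this
    unfold dotP
    fun_prop
  have hint : Integrable (fun p : ℝ × (Fin d → ℝ) =>
      Complex.exp ((-(2 * Real.pi * dotP ξ p.2) : ℝ) * Complex.I) * (gaussK i p.1 p.2 : ℂ))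
      ((volume.restrict (uIoc a b)).prod volume) := by
    have h := ((integrable_mul_exp_sqN (d := d) (c := Real.pi * a ^ 2)
      (by have := Real.pi_pos; positivity) i).norm.const_mul (2 * b ^ d))
    have h2 : Integrable (fun _ : ℝ => (1 : ℝ)) (volume.restrict (uIoc a b)) := by
      rw [uIoc_of_le hab]; exact integrable_const _
    refine (h2.mul_prod h).mono' hmeas ?_
    have : ∀ᵐ p ∂((volume.restrict (uIoc a b)).prod (volume : Measure (Fin d → ℝ))),
        p.1 ∈ uIoc a b :=
      Measure.quasiMeasurePreserving_fst.ae (ae_restrict_mem measurableSet_uIoc)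
    filter_upwards [this] with p hp
    rw [uIoc_of_le hab] at hp
    rw [norm_mul, Complex.norm_exp_ofReal_mul_I, one_mul, Complex.norm_real, one_mul, norm_mul,
      Real.norm_of_nonneg (Real.exp_pos _).le]
    exact abs_gaussK_le ha.le hp.1.le hp.2 i p.2
  have hswap := intervalIntegral_integral_swap (f := fun w y =>
    Complex.exp ((-(2 * Real.pi * dotP ξ y) : ℝ) * Complex.I) * (gaussK i w y : ℂ)) hint
  have e1 : ft (fun y => (kerK a b i y : ℂ)) ξ = ∫ y : Fin d → ℝ, ∫ w in a..b,
      Complex.exp ((-(2 * Real.pi * dotP ξ y) : ℝ) * Complex.I) * (gaussK i w y : ℂ) := by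
    rw [ft]
    congr; ext y
    rw [intervalIntegral.integral_const_mul, kerK, intervalIntegral.integral_ofReal]
  rw [e1, ← hswap]
  have e2 : ∀ w ∈ uIcc a b, ∫ y : Fin d → ℝ,
      Complex.exp ((-(2 * Real.pi * dotP ξ y) : ℝ) * Complex.I) * (gaussK i w y : ℂ) =
      -Complex.I * (ξ i * (2 * (w ^ 2)⁻¹ * Real.exp (-Real.pi * sqN ξ / w ^ 2)) : ℝ) := by
    intro w hw
    rw [uIcc_of_le hab] at hw
    exact ft_gaussK (ha.trans_le hw.1) i ξ
  rw [intervalIntegral.integral_congr e2, intervalIntegral.integral_const_mul,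
    intervalIntegral.integral_ofReal]
  congr 2
  rw [← integral_gam_zero_comp_div ha hab, ← intervalIntegral.integral_const_mul]
  by_cases h0 : ξ = 0
  · simp [h0]
  have h1 := (eucNorm_pos h0).ne'
  apply intervalIntegral.integral_congr
  intro w _
  simp only [← eucNorm_sq]
  field_simp

theorem norm_ft_kerK_le {a b : ℝ} (ha : 0 < a) (hab : a ≤ b) (i : Fin d) (ξ : Fin d → ℝ) :
    ‖ft (fun y => (kerK a b i y : ℂ)) ξ‖ ≤ 1 := by
  rw [ft_kerK ha hab, norm_mul, norm_neg, Complex.norm_I, one_mul, Complex.norm_real, norm_mul]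
  have hb := ha.trans_le hab
  have h0 := eucNorm_nonneg ξ
  have h1 : ‖ξ i / eucNorm ξ‖ ≤ 1 := by
    rw [norm_div, Real.norm_of_nonneg h0]
    exact div_le_one_of_le₀ (abs_apply_le_eucNorm ξ i) h0
  have h2 : ‖gamI 0 (eucNorm ξ / a) - gamI 0 (eucNorm ξ / b)‖ ≤ 1 := by
    have h3 := gamI_le 0 (div_nonneg h0 ha.le)
    have h4 := gamI_nonneg 0 (div_nonneg h0 hb.le)
    have h5 : gamI 0 (eucNorm ξ / b) ≤ gamI 0 (eucNorm ξ / a) :=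
      gamI_mono 0 (div_nonneg h0 hb.le) (by gcongr)
    rw [rieszConst_zero] at h3
    rw [Real.norm_of_nonneg (by linarith)]
    linarith
  exact mul_le_one₀ h1 (norm_nonneg _) h2

/-- The Riesz multiplier. -/
def rieszMul (i : Fin d) (ξ : Fin d → ℝ) : ℂ := -Complex.I * ((ξ i / eucNorm ξ : ℝ) : ℂ)

theorem tendsto_ft_kerK (i : Fin d) (ξ : Fin d → ℝ) :
    Tendsto (fun n : ℕ => ft (fun y => (kerK ((n : ℝ) + 1)⁻¹ ((n : ℝ) + 1) i y : ℂ)) ξ) atTop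
      (𝓝 (rieszMul i ξ)) := by
  have h1 : ∀ n : ℕ, ft (fun y => (kerK ((n : ℝ) + 1)⁻¹ ((n : ℝ) + 1) i y : ℂ)) ξ =
      -Complex.I * ((ξ i / eucNorm ξ) *
        (gamI 0 (eucNorm ξ * ((n : ℝ) + 1)) - gamI 0 (eucNorm ξ / ((n : ℝ) + 1))) : ℝ) := by
    intro n
    have hn : (0 : ℝ) ≤ n := n.cast_nonneg
    rw [ft_kerK (by positivity) ((inv_le_one_of_one_le₀ (by linarith)).trans (by linarith)),
      div_inv_eq_mul]
  simp only [h1, rieszMul]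
  apply Tendsto.const_mul
  apply (Complex.continuous_ofReal.tendsto _).comp
  by_cases h0 : ξ = 0
  · simp [h0]
  have hn : Tendsto (fun n : ℕ => (n : ℝ) + 1) atTop atTop :=
    tendsto_atTop_add_const_right _ _ tendsto_natCast_atTop_atTop
  have t1 := (tendsto_gamI 0).comp (hn.const_mul_atTop (eucNorm_pos h0))
  have t2 := ((continuous_gamI 0).tendsto 0).comp (hn.const_div_atTop (eucNorm ξ))
  have := (t1.sub t2).const_mul (ξ i / eucNorm ξ)
  simpa [rieszConst_zero, gamI_zero_right] using this

theorem eucNorm_sub_ge (x y : Fin d → ℝ) : eucNorm x - eucNorm y ≤ eucNorm (x - y) := by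
  simp only [eucNorm_eq_norm, WithLp.toLp_sub]
  exact norm_sub_norm_le _ _

theorem eucNorm_sub_le (x y : Fin d → ℝ) : eucNorm (x - y) ≤ eucNorm x + eucNorm y := by
  simp only [eucNorm_eq_norm, WithLp.toLp_sub]
  exact norm_sub_le _ _

theorem abs_exp_neg_sub_le {p q m : ℝ} (hp : m ≤ p) (hq : m ≤ q) :
    |Real.exp (-p) - Real.exp (-q)| ≤ |p - q| * Real.exp (-m) := by
  wlog h : p ≤ q generalizing p q
  · rw [abs_sub_comm, abs_sub_comm p]
    exact this hq hp (le_of_not_ge h)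
  have h1 : Real.exp (-q) ≤ Real.exp (-p) := Real.exp_le_exp.2 (by linarith)
  rw [abs_of_nonneg (by linarith), abs_of_nonpos (by linarith : p - q ≤ 0)]
  have h2 : Real.exp (-q) = Real.exp (-p) * Real.exp (p - q) := by rw [← Real.exp_add]; ring_nf
  have h3 := Real.add_one_le_exp (p - q)
  have h4 : Real.exp (-p) ≤ Real.exp (-m) := Real.exp_le_exp.2 (by linarith)
  calc Real.exp (-p) - Real.exp (-q) = Real.exp (-p) * (1 - Real.exp (p - q)) := by rw [h2]; ring
    _ ≤ Real.exp (-p) * (-(p - q)) := by gcongr; linarith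
    _ ≤ Real.exp (-m) * (-(p - q)) := by gcongr; linarith
    _ = _ := mul_comm _ _

theorem abs_gaussK_sub_le {w : ℝ} (hw : 0 ≤ w) (i : Fin d) {x y : Fin d → ℝ}
    (hxy : 2 * eucNorm y ≤ eucNorm x) :
    |gaussK i w (x - y) - gaussK i w x| ≤
      eucNorm y * (2 * w ^ d * Real.exp (-Real.pi * w ^ 2 * (eucNorm x / 2) ^ 2) +
        3 * Real.pi * eucNorm x ^ 2 *
          (2 * w ^ (d + 2) * Real.exp (-Real.pi * w ^ 2 * (eucNorm x / 2) ^ 2))) := by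
  have hpi := Real.pi_pos
  have hx0 := eucNorm_nonneg x
  have hy0 := eucNorm_nonneg y
  have h1 := eucNorm_sub_ge x y
  have h2 := eucNorm_sub_le x y
  set e := Real.exp (-Real.pi * w ^ 2 * (eucNorm x / 2) ^ 2) with he
  set e₁ := Real.exp (-Real.pi * w ^ 2 * sqN (x - y)) with he1
  set e₂ := Real.exp (-Real.pi * w ^ 2 * sqN x) with he2
  have hA : (eucNorm x / 2) ^ 2 ≤ sqN (x - y) := by
    rw [← eucNorm_sq]; gcongr; linarith
  have hB : (eucNorm x / 2) ^ 2 ≤ sqN x := by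
    rw [← eucNorm_sq]; gcongr; linarith
  have hp2 : 0 ≤ Real.pi * w ^ 2 := by positivity
  have h3 : e₁ ≤ e := by
    rw [he, he1, Real.exp_le_exp, neg_mul, neg_mul, neg_mul]
    linarith [mul_le_mul_of_nonneg_left hA hp2]
  have h4 : |e₁ - e₂| ≤ Real.pi * w ^ 2 * (3 * eucNorm x * eucNorm y) * e := by
    have h5 := abs_exp_neg_sub_le (mul_le_mul_of_nonneg_left hA hp2)
      (mul_le_mul_of_nonneg_left hB hp2)
    have e6 : ∀ t, -Real.pi * w ^ 2 * t = -(Real.pi * w ^ 2 * t) := fun t => by ring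
    rw [he, he1, he2, e6, e6, e6]
    refine h5.trans ?_
    gcongr
    rw [← mul_sub, abs_mul, abs_of_nonneg hp2]
    gcongr
    rw [← eucNorm_sq, ← eucNorm_sq, abs_le]
    have h7 := eucNorm_nonneg (x - y)
    constructor <;> nlinarith
  have hid : gaussK i w (x - y) - gaussK i w x =
      2 * w ^ d * (-(y i) * e₁ + x i * (e₁ - e₂)) := by
    simp only [gaussK, ← he1, ← he2, Pi.sub_apply]; ring
  rw [hid, abs_mul, abs_of_nonneg (by positivity : 0 ≤ 2 * w ^ d)]
  have h8 : |-(y i) * e₁ + x i * (e₁ - e₂)| ≤ eucNorm y * e +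
      eucNorm x * (Real.pi * w ^ 2 * (3 * eucNorm x * eucNorm y) * e) := by
    refine (abs_add_le _ _).trans ?_
    rw [abs_mul, abs_mul, abs_neg, abs_of_pos (Real.exp_pos _ : 0 < e₁)]
    have := abs_apply_le_eucNorm y i
    have := abs_apply_le_eucNorm x i
    gcongr
  calc _ ≤ 2 * w ^ d * (eucNorm y * e +
      eucNorm x * (Real.pi * w ^ 2 * (3 * eucNorm x * eucNorm y) * e)) := by gcongr
    _ = _ := by ring

/-- The constant in the Hörmander regularity estimate. -/
def hormConst (d : ℕ) : ℝ :=
  2 ^ (d + 1) * rieszConst d + 3 * Real.pi * 2 ^ (d + 3) * rieszConst (d + 2)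

theorem abs_kerK_sub_le {a b : ℝ} (ha : 0 ≤ a) (hab : a ≤ b) (i : Fin d) {x y : Fin d → ℝ}
    (hx : x ≠ 0) (hxy : 2 * eucNorm y ≤ eucNorm x) :
    |kerK a b i (x - y) - kerK a b i x| ≤ hormConst d * eucNorm y / eucNorm x ^ (d + 1) := by
  have hr : 0 < eucNorm x := eucNorm_pos hx
  have hy0 := eucNorm_nonneg y
  have hc : ∀ z : Fin d → ℝ, Continuous fun w => gaussK i w z := fun z =>
    (continuous_gaussK i).comp (by fun_prop : Continuous fun w : ℝ => (z, w))
  rw [kerK, kerK, ← intervalIntegral.integral_sub ((hc _).intervalIntegrable _ _)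
    ((hc _).intervalIntegrable _ _)]
  refine (intervalIntegral.norm_integral_le_of_norm_le hab
    (f := fun w => gaussK i w (x - y) - gaussK i w x) (g := fun w =>
      eucNorm y * (2 * w ^ d * Real.exp (-Real.pi * w ^ 2 * (eucNorm x / 2) ^ 2) +
        3 * Real.pi * eucNorm x ^ 2 *
          (2 * w ^ (d + 2) * Real.exp (-Real.pi * w ^ 2 * (eucNorm x / 2) ^ 2))))
      (Eventually.of_forall fun w hw => abs_gaussK_sub_le (ha.trans hw.1.le) i hxy)
      (Continuous.intervalIntegrable (by fun_prop) _ _)).trans ?_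
  rw [intervalIntegral.integral_const_mul, intervalIntegral.integral_add
    (Continuous.intervalIntegrable (by fun_prop) _ _)
    (Continuous.intervalIntegrable (by fun_prop) _ _), intervalIntegral.integral_const_mul]
  have h1 := integral_gam_comp_mul_le d (half_pos hr) ha hab
  have h2 := integral_gam_comp_mul_le (d + 2) (half_pos hr) ha hab
  have hpi := Real.pi_pos
  calc _ ≤ eucNorm y * (rieszConst d / (eucNorm x / 2) ^ (d + 1) + 3 * Real.pi * eucNorm x ^ 2 *
        (rieszConst (d + 2) / (eucNorm x / 2) ^ (d + 2 + 1))) := by gcongr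
    _ = _ := by
      rw [hormConst]
      simp only [div_pow]
      field_simp
      ring

end KernelEstimates

section PrincipalValue

variable {d : ℕ}

theorem measurable_rieszKernel (i : Fin d) : Measurable fun y => rieszKernel d y i := by
  have : (fun y => rieszKernel d y i) =
      fun y => if y = 0 then 0 else rieszConst d * y i / eucNorm y ^ (d + 1) := by
    ext y; simp only [rieszKernel]; split_ifs <;> simp
  rw [this]
  refine Measurable.ite (measurableSet_singleton 0) measurable_const ?_
  have := (continuous_eucNorm (d := d)).measurable
  fun_prop

theorem abs_rieszKernel_le (i : Fin d) (y : Fin d → ℝ) :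
    |rieszKernel d y i| * eucNorm y ^ d ≤ rieszConst d := by
  have hC := rieszConst_pos d
  by_cases hy : y = 0
  · simp [rieszKernel, hy, hC.le]
  have hr := eucNorm_pos hy
  simp only [rieszKernel, hy, if_false]
  rw [abs_div, abs_mul, abs_of_pos hC, abs_of_pos (by positivity : 0 < eucNorm y ^ (d + 1)),
    div_mul_eq_mul_div, div_le_iff₀ (by positivity), pow_succ]
  have := abs_apply_le_eucNorm y i
  calc rieszConst d * |y i| * eucNorm y ^ d ≤ rieszConst d * eucNorm y * eucNorm y ^ d := by gcongr
    _ = _ := by ring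

theorem kerK_eq_rieszKernel (a b : ℝ) (i : Fin d) (y : Fin d → ℝ) :
    rieszConst d * kerK a b i y =
      rieszKernel d y i * (gamI d (b * eucNorm y) - gamI d (a * eucNorm y)) := by
  by_cases hy : y = 0
  · simp [kerK, gaussK, rieszKernel, hy]
  have hr := eucNorm_pos hy
  have h : kerK a b i y =
      y i * ∫ w in a..b, 2 * w ^ d * Real.exp (-Real.pi * w ^ 2 * eucNorm y ^ 2) := by
    rw [← intervalIntegral.integral_const_mul, kerK]
    congr; ext w; rw [gaussK, eucNorm_sq]; ring
  rw [h, integral_gam_comp_mul d hr]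
  simp only [rieszKernel, hy, if_false]
  ring

theorem gamI_le_pow (m : ℕ) {s : ℝ} (hs : 0 ≤ s) : gamI m s ≤ s ^ m := by
  have h : gamI m s ≤ ∫ v in (0:ℝ)..s, s ^ m * gam 0 v := by
    apply intervalIntegral.integral_mono_on hs ((continuous_gam m).intervalIntegrable _ _)
      (((continuous_gam 0).const_mul _).intervalIntegrable _ _)
    intro v hv
    have : v ^ m ≤ s ^ m := pow_le_pow_left₀ hv.1 hv.2 m
    simp only [gam, pow_zero, mul_one]
    nlinarith [Real.exp_pos (-Real.pi * v ^ 2)]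
  rw [intervalIntegral.integral_const_mul] at h
  have h2 := gamI_le 0 hs
  rw [rieszConst_zero] at h2
  exact h.trans (mul_le_of_le_one_right (pow_nonneg hs m) h2)

theorem integrable_truncRiesz_component {f : (Fin d → ℝ) → ℂ} (hf : Integrable f) (x : Fin d → ℝ)
    (i : Fin d) {ε : ℝ} (hε : 0 < ε) :
    IntegrableOn (fun y => f (x - y) * ((rieszKernel d y i : ℝ) : ℂ)) {y | ε < eucNorm y} := by
  have hmeas : MeasurableSet {y : Fin d → ℝ | ε < eucNorm y} :=
    measurableSet_lt measurable_const continuous_eucNorm.measurable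
  refine Integrable.mul_bdd (c := rieszConst d / ε ^ d) (hf.comp_sub_left x).integrableOn
    (Complex.measurable_ofReal.comp (measurable_rieszKernel i)).aestronglyMeasurable ?_
  filter_upwards [ae_restrict_mem hmeas] with y hy
  rw [Complex.norm_real, Real.norm_eq_abs, le_div_iff₀ (by positivity)]
  refine le_trans ?_ (abs_rieszKernel_le i y)
  gcongr

theorem truncRiesz_apply {f : (Fin d → ℝ) → ℂ} (hf : Integrable f) (x : Fin d → ℝ)
    (i : Fin d) {ε : ℝ} (hε : 0 < ε) :
    truncRiesz f x ε i =
      ∫ y in {y | ε < eucNorm y}, f (x - y) * ((rieszKernel d y i : ℝ) : ℂ) :=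
  eval_integral (fun i => integrable_truncRiesz_component hf x i hε) i

theorem norm_truncRiesz_apply_le {f : (Fin d → ℝ) → ℂ} (hf : Integrable f) (x : Fin d → ℝ)
    (i : Fin d) {ε : ℝ} (hε : 0 < ε) :
    ‖truncRiesz f x ε i‖ ≤ rieszConst d / ε ^ d * ∫ y, ‖f y‖ := by
  have hmeas : MeasurableSet {y : Fin d → ℝ | ε < eucNorm y} :=
    measurableSet_lt measurable_const continuous_eucNorm.measurable
  have hC := (rieszConst_pos d).le
  rw [truncRiesz_apply hf x i hε]
  refine (norm_integral_le_of_norm_le (g := fun y => rieszConst d / ε ^ d * ‖f (x - y)‖)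
    ((hf.comp_sub_left x).norm.const_mul _).integrableOn ?_).trans ?_
  · filter_upwards [ae_restrict_mem hmeas] with y hy
    rw [norm_mul, mul_comm, Complex.norm_real, Real.norm_eq_abs]
    gcongr
    rw [le_div_iff₀ (by positivity)]
    refine le_trans ?_ (abs_rieszKernel_le i y)
    gcongr
  · refine (setIntegral_le_integral ((hf.comp_sub_left x).norm.const_mul _)
      (Eventually.of_forall fun y => by positivity)).trans_eq ?_
    rw [integral_const_mul, integral_sub_left_eq_self (fun y => ‖f y‖) volume x]

theorem integral_mul_rieszKernel_gamI {f : (Fin d → ℝ) → ℂ} (hf : Integrable f) (x : Fin d → ℝ)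
    (i : Fin d) {b : ℝ} (hb : 0 < b) :
    Integrable (fun y => f (x - y) * ((rieszKernel d y i * gamI d (b * eucNorm y) : ℝ) : ℂ)) ∧
    Integrable (fun v => (gam d v : ℂ) * truncRiesz f x (v / b) i) (volume.restrict (Ioi 0)) ∧
    ∫ y, f (x - y) * ((rieszKernel d y i * gamI d (b * eucNorm y) : ℝ) : ℂ) =
      ∫ v in Ioi (0 : ℝ), (gam d v : ℂ) * truncRiesz f x (v / b) i := by
  have hZ := measurable_rieszKernel i
  have hE := (continuous_eucNorm (d := d)).measurable
  have hfx := hf.comp_sub_left x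
  have hI1 : Integrable
      (fun y => f (x - y) * ((rieszKernel d y i * gamI d (b * eucNorm y) : ℝ) : ℂ)) := by
    refine hfx.mul_bdd (c := rieszConst d * b ^ d) ?_ (Eventually.of_forall fun y => ?_)
    · have := (continuous_gamI d).measurable
      exact (by fun_prop : Measurable fun y =>
        ((rieszKernel d y i * gamI d (b * eucNorm y) : ℝ) : ℂ)).aestronglyMeasurable
    · have h0 : 0 ≤ b * eucNorm y := mul_nonneg hb.le (eucNorm_nonneg y)
      rw [Complex.norm_real, norm_mul, Real.norm_of_nonneg (gamI_nonneg d h0), Real.norm_eq_abs]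
      calc _ ≤ |rieszKernel d y i| * (b * eucNorm y) ^ d := by gcongr; exact gamI_le_pow d h0
        _ = |rieszKernel d y i| * eucNorm y ^ d * b ^ d := by ring
        _ ≤ _ := by gcongr; exact abs_rieszKernel_le i y
  set F : ℝ → (Fin d → ℝ) → ℂ := fun v y =>
    {p : ℝ × (Fin d → ℝ) | p.1 < b * eucNorm p.2}.indicator
      (fun p => (gam d p.1 : ℂ) * (f (x - p.2) * ((rieszKernel d p.2 i : ℝ) : ℂ))) (v, y) with hF
  have hFmeas : AEStronglyMeasurable (Function.uncurry F)
      ((volume.restrict (Ioi (0:ℝ))).prod volume) := by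
    have hS : MeasurableSet {p : ℝ × (Fin d → ℝ) | p.1 < b * eucNorm p.2} :=
      measurableSet_lt measurable_fst (by fun_prop)
    refine AEStronglyMeasurable.indicator ?_ hS
    have hg := (continuous_gam d).measurable
    refine AEStronglyMeasurable.mul (by
      exact (by fun_prop : Measurable fun p : ℝ × (Fin d → ℝ) =>
        (gam d p.1 : ℂ)).aestronglyMeasurable) (AEStronglyMeasurable.mul ?_ (by
      exact (by fun_prop : Measurable fun p : ℝ × (Fin d → ℝ) =>
        ((rieszKernel d p.2 i : ℝ) : ℂ)).aestronglyMeasurable))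
    exact hfx.1.comp_snd
  have hsec : ∀ y, (fun v => F v y) = (Iio (b * eucNorm y)).indicator
      (fun v => (gam d v : ℂ) * (f (x - y) * ((rieszKernel d y i : ℝ) : ℂ))) := fun y => by
    ext v; simp only [hF, indicator, mem_ofPred_eq, mem_Iio]
  have hsect : ∀ v, F v = {y | v < b * eucNorm y}.indicator
      (fun y => (gam d v : ℂ) * (f (x - y) * ((rieszKernel d y i : ℝ) : ℂ))) := fun v => by
    ext y; simp only [hF, indicator, mem_ofPred_eq]
  have hset : ∀ s : ℝ, (Ioi 0 ∩ Iio s : Set ℝ) =ᵐ[volume] Ioc 0 s := fun s => by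
    rw [Ioi_inter_Iio]; exact Ioo_ae_eq_Ioc
  have hgamInt : IntegrableOn (fun v => (gam d v : ℂ)) (Ioi 0) := (integrableOn_gam d).ofReal
  have hFint : Integrable (Function.uncurry F) ((volume.restrict (Ioi (0:ℝ))).prod volume) := by
    rw [integrable_prod_iff' hFmeas]
    refine ⟨Eventually.of_forall fun y => ?_, ?_⟩
    · change Integrable (fun v => F v y) _
      rw [hsec]
      exact (hgamInt.mul_const _).indicator measurableSet_Iio
    · refine hI1.norm.congr (Eventually.of_forall fun y => ?_)
      change _ = ∫ v in Ioi (0:ℝ), ‖F v y‖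
      have h0 : 0 ≤ b * eucNorm y := mul_nonneg hb.le (eucNorm_nonneg y)
      have e : ∀ v, ‖F v y‖ = (Iio (b * eucNorm y)).indicator
        (fun v => ‖gam d v‖ * ‖f (x - y) * ((rieszKernel d y i : ℝ) : ℂ)‖) v := fun v => by
        rw [congrFun (hsec y) v, norm_indicator_eq_indicator_norm]
        simp only [norm_mul, Complex.norm_real]
      simp only [e]
      rw [setIntegral_indicator measurableSet_Iio, setIntegral_congr_set (hset _),
        integral_mul_const]
      have : ∫ v in Ioc 0 (b * eucNorm y), ‖gam d v‖ = gamI d (b * eucNorm y) := by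
        rw [gamI_eq h0]
        refine setIntegral_congr_fun measurableSet_Ioc fun v hv => ?_
        exact Real.norm_of_nonneg (gam_nonneg d hv.1.le)
      rw [this, Complex.ofReal_mul, ← mul_assoc, norm_mul, mul_comm, Complex.norm_real (gamI _ _),
        Real.norm_of_nonneg (gamI_nonneg d h0)]
  have hswap := integral_integral_swap hFint
  have hl : ∀ v ∈ Ioi (0:ℝ), ∫ y, F v y = (gam d v : ℂ) * truncRiesz f x (v / b) i := by
    intro v hv
    have hS : MeasurableSet {y : Fin d → ℝ | v < b * eucNorm y} :=
      measurableSet_lt measurable_const (by fun_prop)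
    rw [hsect, integral_indicator hS, integral_const_mul,
      truncRiesz_apply hf x i (div_pos hv hb)]
    congr 3
    ext y
    simp only [mem_ofPred_eq, div_lt_iff₀ hb, mul_comm]
  have hr : ∀ y, ∫ v in Ioi (0:ℝ), F v y =
      f (x - y) * ((rieszKernel d y i * gamI d (b * eucNorm y) : ℝ) : ℂ) := by
    intro y
    have h0 : 0 ≤ b * eucNorm y := mul_nonneg hb.le (eucNorm_nonneg y)
    rw [hsec, setIntegral_indicator measurableSet_Iio, setIntegral_congr_set (hset _),
        integral_mul_const, integral_complex_ofReal, ← gamI_eq h0]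
    push_cast; ring
  refine ⟨hI1, ?_, ?_⟩
  · refine hFint.integral_prod_left.congr ?_
    filter_upwards [ae_restrict_mem measurableSet_Ioi] with v hv
    exact hl v hv
  · simp only [hr] at hswap
    rw [← hswap]
    exact setIntegral_congr_fun measurableSet_Ioi hl

theorem conv_kerK_eq {f : (Fin d → ℝ) → ℂ} (hf : Integrable f) (x : Fin d → ℝ)
    (i : Fin d) {a b : ℝ} (ha : 0 < a) (hb : 0 < b) :
    (rieszConst d : ℂ) * conv f (fun y => (kerK a b i y : ℂ)) x =
      (∫ v in Ioi (0 : ℝ), (gam d v : ℂ) * truncRiesz f x (v / b) i) -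
      ∫ v in Ioi (0 : ℝ), (gam d v : ℂ) * truncRiesz f x (v / a) i := by
  obtain ⟨ia, -, ea⟩ := integral_mul_rieszKernel_gamI hf x i ha
  obtain ⟨ib, -, eb⟩ := integral_mul_rieszKernel_gamI hf x i hb
  rw [← ea, ← eb, ← integral_sub ib ia, conv, ← integral_const_mul,
    ← integral_sub_left_eq_self _ volume x]
  congr; ext y
  rw [sub_sub_cancel, ← mul_sub, mul_left_comm, ← Complex.ofReal_mul, kerK_eq_rieszKernel,
    ← Complex.ofReal_sub, mul_sub]

theorem exists_norm_truncRiesz_le {f : (Fin d → ℝ) → ℂ} (hf : Integrable f) {x : Fin d → ℝ}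
    {g : Fin d → ℂ} (hg : Tendsto (fun ε : ℝ => truncRiesz f x ε) (𝓝[>] 0) (𝓝 g)) (i : Fin d) :
    ∃ M, ∀ ε, 0 < ε → ‖truncRiesz f x ε i‖ ≤ M := by
  have h1 : ∀ᶠ ε in 𝓝[>] (0:ℝ), ‖truncRiesz f x ε i‖ < ‖g i‖ + 1 :=
    ((tendsto_pi_nhds.1 hg i).norm).eventually_lt_const (lt_add_one _)
  obtain ⟨ε₀, hε₀, h2⟩ := mem_nhdsGT_iff_exists_Ioo_subset.1 h1
  have hε₀ : 0 < ε₀ := hε₀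
  refine ⟨max (‖g i‖ + 1) (rieszConst d / ε₀ ^ d * ∫ y, ‖f y‖), fun ε hε => ?_⟩
  rcases lt_or_ge ε ε₀ with h | h
  · exact (le_of_lt (h2 ⟨hε, h⟩)).trans (le_max_left _ _)
  · refine le_trans ?_ (le_max_right _ _)
    refine (norm_truncRiesz_apply_le hf x i hε).trans ?_
    have := (rieszConst_pos d).le
    gcongr

theorem tendsto_conv_kerK {f : (Fin d → ℝ) → ℂ} (hf : Integrable f) {x : Fin d → ℝ}
    {g : Fin d → ℂ} (hg : Tendsto (fun ε : ℝ => truncRiesz f x ε) (𝓝[>] 0) (𝓝 g)) (i : Fin d) :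
    Tendsto (fun n : ℕ => conv f (fun y => (kerK ((n : ℝ) + 1)⁻¹ ((n : ℝ) + 1) i y : ℂ)) x) atTop
      (𝓝 (g i)) := by
  obtain ⟨M, hM⟩ := exists_norm_truncRiesz_le hf hg i
  have hC : (rieszConst d : ℂ) ≠ 0 := by exact_mod_cast (rieszConst_pos d).ne'
  have hd : d ≠ 0 := fun h => by subst h; exact i.elim0
  have hn : ∀ n : ℕ, (0 : ℝ) < (n : ℝ) + 1 := fun n => by positivity
  have hntop : Tendsto (fun n : ℕ => (n : ℝ) + 1) atTop atTop :=
    tendsto_atTop_add_const_right _ _ tendsto_natCast_atTop_atTop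
  have key : ∀ (c : ℕ → ℝ) (L : ℂ), (∀ n, 0 < c n) →
      (∀ v, 0 < v → Tendsto (fun n => truncRiesz f x (v / c n) i) atTop (𝓝 L)) →
      Tendsto (fun n => ∫ v in Ioi (0 : ℝ), (gam d v : ℂ) * truncRiesz f x (v / c n) i) atTop
        (𝓝 (rieszConst d * L)) := by
    intro c L hc hL
    have : (rieszConst d : ℂ) * L = ∫ v in Ioi (0 : ℝ), (gam d v : ℂ) * L := by
      rw [integral_mul_const, integral_complex_ofReal, integral_gam]
    rw [this]
    apply tendsto_integral_of_dominated_convergence (fun v => ‖gam d v‖ * M)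
    · exact fun n => (integral_mul_rieszKernel_gamI hf x i (hc n)).2.1.1
    · exact (integrableOn_gam d).norm.mul_const M
    · intro n
      filter_upwards [ae_restrict_mem measurableSet_Ioi] with v hv
      rw [norm_mul, Complex.norm_real]
      gcongr
      exact hM _ (div_pos hv (hc n))
    · filter_upwards [ae_restrict_mem measurableSet_Ioi] with v hv
      exact (hL v hv).const_mul _
  have t1 := key (fun n => (n : ℝ) + 1) (g i) hn fun v hv => by
    refine (tendsto_pi_nhds.1 hg i).comp (tendsto_nhdsWithin_iff.2
      ⟨hntop.const_div_atTop v, Eventually.of_forall fun n => div_pos hv (hn n)⟩)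
  have t2 := key (fun n => ((n : ℝ) + 1)⁻¹) 0 (fun n => inv_pos.2 (hn n)) fun v hv => by
    have hb : ∀ n : ℕ, ‖truncRiesz f x (v / ((n : ℝ) + 1)⁻¹) i‖ ≤
        rieszConst d / (v * ((n : ℝ) + 1)) ^ d * ∫ y, ‖f y‖ := fun n => by
      rw [div_inv_eq_mul]
      exact norm_truncRiesz_apply_le hf x i (mul_pos hv (hn n))
    refine squeeze_zero_norm hb ?_
    have h1 : Tendsto (fun n : ℕ => (v * ((n : ℝ) + 1)) ^ d) atTop atTop :=
      (tendsto_pow_atTop hd).comp (hntop.const_mul_atTop hv)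
    simpa using (h1.const_div_atTop (rieszConst d)).mul_const (∫ y, ‖f y‖)
  have t3 := (t1.sub t2).const_mul ((rieszConst d : ℂ)⁻¹)
  refine (t3.congr fun n => ?_).trans_eq ?_
  · rw [← conv_kerK_eq hf x i (inv_pos.2 (hn n)) (hn n), inv_mul_cancel_left₀ hC]
  · rw [mul_zero, sub_zero, inv_mul_cancel_left₀ hC]

end PrincipalValue

section ScaledIntegrals

theorem lintegral_rpow_scaled {d : ℕ} {ρ : ℝ} (hρ : 0 < ρ) :
    ∫⁻ x : Fin d → ℝ, ENNReal.ofReal (ρ⁻¹ ^ d * (1 + ‖ρ⁻¹ • x‖) ^ (-((d : ℝ) + 1))) =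
      ENNReal.ofReal (∫ x : Fin d → ℝ, (1 + ‖x‖) ^ (-((d : ℝ) + 1))) := by
  have hI : Integrable (fun x : Fin d → ℝ => (1 + ‖x‖) ^ (-((d : ℝ) + 1))) :=
    integrable_one_add_norm (by simp)
  rw [← ofReal_integral_eq_lintegral_ofReal]
  · congr 1
    rw [integral_const_mul]
    rw [Measure.integral_comp_inv_smul_of_nonneg volume
      (fun x : Fin d → ℝ => (1 + ‖x‖) ^ (-((d : ℝ) + 1))) hρ.le]
    have : ρ ^ d ≠ 0 := (pow_pos hρ d).ne'
    simp [this]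
  · exact (hI.comp_smul (inv_ne_zero hρ.ne')).const_mul _
  · exact Eventually.of_forall fun x => by positivity

theorem exists_lintegral_kerK_sub_le (d : ℕ) : ∃ C : ℝ≥0, ∀ a b : ℝ, 0 < a → a ≤ b →
    ∀ (i : Fin d) (ρ : ℝ), 0 < ρ → ∀ y : Fin d → ℝ, ‖y‖ ≤ ρ →
      ∫⁻ x in {x | 2 * d * ρ ≤ ‖x‖}, ‖kerK a b i (x - y) - kerK a b i x‖ₑ ≤ C := by
  set J := ∫ x : Fin d → ℝ, (1 + ‖x‖) ^ (-((d : ℝ) + 1)) with hJ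
  set A : ℝ := |hormConst d| * d * 2 ^ (d + 1) with hA
  have hA0 : 0 ≤ A := by positivity
  refine ⟨(A * J).toNNReal, fun a b ha hab i ρ hρ y hy => ?_⟩
  have hd : (1 : ℝ) ≤ d := by exact_mod_cast Fin.pos i
  have key : ∀ x ∈ {x : Fin d → ℝ | 2 * d * ρ ≤ ‖x‖},
      ‖kerK a b i (x - y) - kerK a b i x‖ₑ ≤
        ENNReal.ofReal A * ENNReal.ofReal (ρ⁻¹ ^ d * (1 + ‖ρ⁻¹ • x‖) ^ (-((d : ℝ) + 1))) := by
    intro x hx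
    have hx : 2 * d * ρ ≤ ‖x‖ := hx
    have hρx : ρ ≤ ‖x‖ := by nlinarith
    have hx0 : x ≠ 0 := norm_pos_iff.1 (hρ.trans_le hρx)
    have hey : eucNorm y ≤ d * ρ := (eucNorm_le y).trans (by gcongr)
    have hex : ‖x‖ ≤ eucNorm x := norm_le_eucNorm x
    have h1 := abs_kerK_sub_le (i := i) ha.le hab hx0 (y := y) (by nlinarith)
    rw [← ENNReal.ofReal_mul hA0, ← ofReal_norm, Real.norm_eq_abs]
    refine ENNReal.ofReal_le_ofReal (h1.trans ?_)
    have hxp : 0 < ‖x‖ := norm_pos_iff.2 hx0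
    have h2 : hormConst d * eucNorm y / eucNorm x ^ (d + 1) ≤
        |hormConst d| * (d * ρ) / ‖x‖ ^ (d + 1) := by
      have := eucNorm_nonneg y
      gcongr
      exact le_abs_self _
    refine h2.trans ?_
    have h3 : (1 + ‖ρ⁻¹ • x‖) ^ (-((d : ℝ) + 1)) = ((1 + ‖ρ⁻¹ • x‖) ^ (d + 1))⁻¹ := by
      rw [Real.rpow_neg (by positivity), ← Real.rpow_natCast]; push_cast; rfl
    have h4 : 1 + ‖ρ⁻¹ • x‖ ≤ 2 * (ρ⁻¹ * ‖x‖) := by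
      rw [norm_smul, Real.norm_of_nonneg (by positivity)]
      have : 1 ≤ ρ⁻¹ * ‖x‖ := by
        rw [inv_mul_eq_div, one_le_div hρ]; exact hρx
      linarith
    have h5 : (2 * (ρ⁻¹ * ‖x‖)) ^ (d + 1) ≥ (1 + ‖ρ⁻¹ • x‖) ^ (d + 1) := by gcongr
    rw [h3]
    calc |hormConst d| * (d * ρ) / ‖x‖ ^ (d + 1)
        = A * (ρ⁻¹ ^ d * ((2 * (ρ⁻¹ * ‖x‖)) ^ (d + 1))⁻¹) := by
          rw [hA, mul_pow, mul_pow, inv_pow, inv_pow]; field_simp; ring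
      _ ≤ _ := by gcongr
  calc _ ≤ ∫⁻ x in {x : Fin d → ℝ | 2 * d * ρ ≤ ‖x‖}, ENNReal.ofReal A *
          ENNReal.ofReal (ρ⁻¹ ^ d * (1 + ‖ρ⁻¹ • x‖) ^ (-((d : ℝ) + 1))) :=
        setLIntegral_mono' (measurableSet_le measurable_const measurable_norm) key
    _ ≤ ∫⁻ x : Fin d → ℝ, ENNReal.ofReal A *
          ENNReal.ofReal (ρ⁻¹ ^ d * (1 + ‖ρ⁻¹ • x‖) ^ (-((d : ℝ) + 1))) :=
        setLIntegral_le_lintegral _ _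
    _ = ENNReal.ofReal (A * J) := by
        rw [lintegral_const_mul' _ _ ENNReal.ofReal_ne_top, lintegral_rpow_scaled hρ,
          ← ENNReal.ofReal_mul hA0]
    _ = _ := rfl

end ScaledIntegrals

section StoppingBalls

open Metric

/-- The parameters `(x, r)` of balls on which the mean of `‖f‖` exceeds `l`, while the mean over
every ball with the same centre and at least twice the radius does not. -/
def stoppingBalls {d : ℕ} (f : (Fin d → ℝ) → ℂ) (l : ℝ) : Set ((Fin d → ℝ) × ℝ) :=
  {p | 0 < p.2 ∧ l * (2 * p.2) ^ d < ∫ y in closedBall p.1 p.2, ‖f y‖ ∧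
    ∀ ρ, 2 * p.2 ≤ ρ → ∫ y in closedBall p.1 ρ, ‖f y‖ ≤ l * (2 * ρ) ^ d}

theorem radius_le_of_mean_gt {d : ℕ} (hd : d ≠ 0) {f : (Fin d → ℝ) → ℂ} (hf : Integrable f)
    {l : ℝ} (hl : 0 < l) {x : Fin d → ℝ} {r : ℝ} 
    (h : l * (2 * r) ^ d < ∫ y in closedBall x r, ‖f y‖) : r ≤ 1 + (∫ y, ‖f y‖) / l := by
  have h1 : ∫ y in closedBall x r, ‖f y‖ ≤ ∫ y, ‖f y‖ :=
    setIntegral_le_integral hf.norm (Eventually.of_forall fun _ => norm_nonneg _)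
  have h0 : 0 ≤ ∫ y, ‖f y‖ := integral_nonneg fun _ => norm_nonneg _
  by_contra! hc
  have h2 : 0 ≤ (∫ y, ‖f y‖) / l := by positivity
  have h3 : 2 * r ≤ (2 * r) ^ d := le_self_pow₀ (by linarith) hd
  have h4 : (∫ y, ‖f y‖) / l < (2 * r) ^ d := by linarith
  rw [div_lt_iff₀ hl] at h4
  nlinarith

theorem exists_mem_stoppingBalls {d : ℕ} (hd : d ≠ 0) {f : (Fin d → ℝ) → ℂ} (hf : Integrable f)
    {l : ℝ} (hl : 0 < l) {x : Fin d → ℝ} {r : ℝ} (hr : 0 < r)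
    (h : l * (2 * r) ^ d < ∫ y in closedBall x r, ‖f y‖) :
    ∃ r', (x, r') ∈ stoppingBalls f l := by
  set S : Set ℝ := {r | 0 < r ∧ l * (2 * r) ^ d < ∫ y in closedBall x r, ‖f y‖}
  have hS : BddAbove S := ⟨_, fun r hr => radius_le_of_mean_gt hd hf hl hr.2⟩
  have hrS : r ∈ S := ⟨hr, h⟩
  have hs : 0 < sSup S := hr.trans_le (le_csSup hS hrS)
  obtain ⟨r', hr', hlt⟩ := exists_lt_of_lt_csSup ⟨r, hrS⟩ (half_lt_self hs)
  refine ⟨r', hr'.1, hr'.2, fun ρ hρ => ?_⟩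
  by_contra! hc
  have : ρ ∈ S := ⟨by have := hr'.1; dsimp at *; linarith, hc⟩
  have := le_csSup hS this
  dsimp at *
  linarith

theorem ae_norm_le_of_mean_le {d : ℕ} {f : (Fin d → ℝ) → ℂ} (hf : Integrable f) (l : ℝ) :
    ∀ᵐ x, (∀ r, 0 < r → ∫ y in closedBall x r, ‖f y‖ ≤ l * (2 * r) ^ d) → ‖f x‖ ≤ l := by
  filter_upwards [IsUnifLocDoublingMeasure.ae_tendsto_average volume hf.norm.locallyIntegrable 1]
    with x hx h
  have h1 := hx (ι := ℝ) (l := 𝓝[>] 0) (fun _ => x) id tendsto_id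
    (eventually_mem_nhdsWithin.mono fun r hr => by
      have hr : 0 < r := hr
      simpa using hr.le)
  refine le_of_tendsto h1 (eventually_mem_nhdsWithin.mono fun r hr => ?_)
  have hr : 0 < r := hr
  have hp : 0 < (2 * r) ^ d := by positivity
  rw [id, setAverage_eq, Measure.real, Real.volume_pi_closedBall _ hr.le, Fintype.card_fin,
    ENNReal.toReal_ofReal hp.le, smul_eq_mul, inv_mul_le_iff₀ hp, mul_comm]
  exact h r hr

/-- At most one of the terms of a sum of indicators of pairwise disjoint sets is nonzero. -/
theorem exists_hasSum_indicator {ι X : Type*} {A : ι → Set X} (hA : Pairwise (Function.onFun Disjoint A))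
    (h : ι → X → ℂ) (x : X) : ∃ v, HasSum (fun p => (A p).indicator (h p) x) v ∧
      (x ∉ ⋃ p, A p → v = 0) ∧ ∀ p, x ∈ A p → v = h p x := by
  by_cases hx : x ∈ ⋃ p, A p
  · obtain ⟨p, hp⟩ := mem_iUnion.1 hx
    have hu : ∀ q, x ∈ A q → q = p := fun q hq => by
      by_contra hne
      exact Set.disjoint_left.1 (hA hne) hq hp
    refine ⟨h p x, ?_, fun h => (h hx).elim, fun q hq => by rw [hu q hq]⟩
    have := hasSum_single (f := fun p => (A p).indicator (h p) x) p fun q hq =>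
      indicator_of_notMem (fun h => hq (hu q h)) _
    simpa [hp] using this
  · have h0 : ∀ p, x ∉ A p := fun p hp => hx (mem_iUnion.2 ⟨p, hp⟩)
    refine ⟨0, ?_, fun _ => rfl, fun p hp => (h0 p hp).elim⟩
    simp [h0, hasSum_zero]

theorem exists_disjoint_refinement {ι X : Type*} [Countable ι] [MeasurableSpace X] {A : ι → Set X}
    (hA : ∀ p, MeasurableSet (A p)) : ∃ E : ι → Set X, (∀ p, MeasurableSet (E p)) ∧
      (∀ p, E p ⊆ A p) ∧ Pairwise (Function.onFun Disjoint E) ∧ ⋃ p, E p = ⋃ p, A p := by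
  obtain ⟨e, he⟩ := Countable.exists_injective_nat ι
  refine ⟨fun p => A p \ ⋃ q ∈ {q | e q < e p}, A q, fun p => ?_, fun p => sdiff_subset, ?_, ?_⟩
  · exact (hA p).diff (MeasurableSet.biUnion (to_countable _) fun q _ => hA q)
  · have : ∀ p q, e p < e q → 
        Disjoint (A p \ ⋃ r ∈ {r | e r < e p}, A r) (A q \ ⋃ r ∈ {r | e r < e q}, A r) := by
      intro p q hpq
      refine Set.disjoint_left.2 fun x hx hy => hy.2 (mem_biUnion (x := p) hpq hx.1)
    intro p q hpq
    rcases lt_or_gt_of_ne (he.ne hpq) with h | h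
    · exact this p q h
    · exact (this q p h).symm
  · refine Subset.antisymm (iUnion_mono fun p => sdiff_subset) fun x hx => ?_
    obtain ⟨p, hp⟩ := mem_iUnion.1 hx
    have hne : {p | x ∈ A p}.Nonempty := ⟨p, hp⟩
    let q := Function.argminOn e {p | x ∈ A p} hne
    have hq : x ∈ A q := Function.argminOn_mem e _ hne
    refine mem_iUnion.2 ⟨q, hq, fun h => ?_⟩
    obtain ⟨r, hr, hxr⟩ := mem_iUnion₂.1 h
    exact Function.not_lt_argminOn e {p | x ∈ A p} hxr hr

end StoppingBalls

section Decomposition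

open Metric

/-- A decomposition `f = G + ∑ β p` at height `l` into a bounded part and atoms of mean zero
supported in dilates of disjoint balls, all living in the exceptional set `Ω`. -/
structure IsCZDecomposition {d : ℕ} {ι : Type} (f : (Fin d → ℝ) → ℂ) (l : ℝ)
    (Ω : Set (Fin d → ℝ)) (c : ι → Fin d → ℝ) (r : ι → ℝ) (β : ι → (Fin d → ℝ) → ℂ)
    (G : (Fin d → ℝ) → ℂ) : Prop where
  measurableSet : MeasurableSet Ω
  volume_le : ENNReal.ofReal l * volume Ω ≤ 5 ^ d * ∫⁻ x, ‖f x‖ₑ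
  radius_pos : ∀ p, 0 < r p
  integrable : ∀ p, Integrable (β p)
  integral_eq_zero : ∀ p, ∫ x, β p x = 0
  eq_zero_of_notMem : ∀ p x, x ∉ closedBall (c p) (5 * r p) → β p x = 0
  tsum_lintegral_le : ∑' p, ∫⁻ x, ‖β p x‖ₑ ≤ 2 * ∫⁻ x in Ω, ‖f x‖ₑ
  tsum_volume_le : ENNReal.ofReal l * ∑' p, volume (closedBall (c p) (r p)) ≤ ∫⁻ x in Ω, ‖f x‖ₑ
  ae_norm_le : ∀ᵐ x, ‖G x‖ ≤ (1 + 5 ^ d) * l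
  hasSum : ∀ x, HasSum (fun p => β p x) (f x - G x)

theorem volume_closedBall_mul {d : ℕ} (c : Fin d → ℝ) {r t : ℝ} (hr : 0 ≤ r) (ht : 0 ≤ t) :
    volume (closedBall c (t * r)) = ENNReal.ofReal (t ^ d) * volume (closedBall c r) := by
  rw [Real.volume_pi_closedBall _ hr, Real.volume_pi_closedBall _ (by positivity),
    ← ENNReal.ofReal_mul (by positivity), Fintype.card_fin, ← mul_pow]
  ring_nf

theorem exists_isCZDecomposition {d : ℕ} (hd : d ≠ 0) {f : (Fin d → ℝ) → ℂ} (hf : Integrable f)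
    {l : ℝ} (hl : 0 < l) : ∃ (ι : Type) (_ : Countable ι) (Ω : Set (Fin d → ℝ))
      (c : ι → Fin d → ℝ) (r : ι → ℝ) (β : ι → (Fin d → ℝ) → ℂ) (G : (Fin d → ℝ) → ℂ),
      IsCZDecomposition f l Ω c r β G := by
  obtain ⟨u, hut, hud, hcov⟩ := Vitali.exists_disjoint_subfamily_covering_enlargement_closedBall
    (stoppingBalls f l) Prod.fst Prod.snd (1 + (∫ y, ‖f y‖) / l)
    (fun p hp => radius_le_of_mean_gt hd hf hl hp.2.1) 5 (by norm_num)
  have hr : ∀ p : u, 0 < p.1.2 := fun p => (hut p.2).1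
  have huc : u.Countable := hud.countable_of_nonempty_interior fun p hp => by
    have : (ball p.1 p.2).Nonempty := nonempty_ball.2 (hut hp).1
    exact this.mono (interior_maximal ball_subset_closedBall isOpen_ball)
  have : Countable u := huc.to_subtype
  obtain ⟨E, hEm, hEs, hEd, hEu⟩ := exists_disjoint_refinement
    (A := fun p : u => closedBall p.1.1 (5 * p.1.2)) fun p => measurableSet_closedBall
  set Ω := ⋃ p : u, closedBall p.1.1 (5 * p.1.2) with hΩ
  set B : u → Set (Fin d → ℝ) := fun p => closedBall p.1.1 p.1.2 with hB
  have hBm : ∀ p, MeasurableSet (B p) := fun p => measurableSet_closedBall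
  have hBd : Pairwise (Function.onFun Disjoint B) := fun p q hpq =>
    hud p.2 q.2 (fun h => hpq (Subtype.ext h))
  have hBsub : ∀ p : u, B p ⊆ closedBall p.1.1 (5 * p.1.2) := fun p =>
    closedBall_subset_closedBall (by linarith [hr p])
  have hΩm : MeasurableSet Ω := MeasurableSet.iUnion fun p => measurableSet_closedBall
  set V : u → ℝ := fun p => (2 * p.1.2) ^ d with hV
  have hVpos : ∀ p, 0 < V p := fun p => pow_pos (by linarith [hr p]) d
  have hvol : ∀ p, volume (B p) = ENNReal.ofReal (V p) := fun p => by
    rw [hB, Real.volume_pi_closedBall _ (hr p).le, Fintype.card_fin]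
  set m : u → ℂ := fun p => ((V p)⁻¹ : ℝ) • ∫ x in E p, f x with hm
  have hmV : ∀ p, V p * ‖m p‖ ≤ ∫ x in E p, ‖f x‖ := fun p => by
    rw [hm, norm_smul, Real.norm_of_nonneg (inv_nonneg.2 (hVpos p).le), ← mul_assoc,
      mul_inv_cancel₀ (hVpos p).ne', one_mul]
    exact norm_integral_le_integral_norm _
  have hml : ∀ p, ‖m p‖ ≤ 5 ^ d * l := fun p => by
    have h1 : ∫ x in E p, ‖f x‖ ≤ ∫ x in closedBall p.1.1 (5 * p.1.2), ‖f x‖ :=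
      setIntegral_mono_set hf.norm.integrableOn (Eventually.of_forall fun _ => norm_nonneg _)
        (hEs p).eventuallyLE
    have h2 := (hut p.2).2.2 (5 * p.1.2) (by linarith [hr p])
    have h3 : l * (2 * (5 * p.1.2)) ^ d = V p * (5 ^ d * l) := by
      rw [hV, show 2 * (5 * p.1.2) = 5 * (2 * p.1.2) by ring, mul_pow]; ring
    have h4 := ((hmV p).trans h1).trans (h2.trans_eq h3)
    exact le_of_mul_le_mul_left h4 (hVpos p)
  set β : u → (Fin d → ℝ) → ℂ := fun p x =>
    (E p).indicator f x - (B p).indicator (fun _ => m p) x with hβ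
  have hi1 : ∀ p, Integrable ((E p).indicator f) := fun p => hf.indicator (hEm p)
  have hi2 : ∀ p, Integrable ((B p).indicator fun _ => m p) := fun p =>
    (integrable_indicator_iff (hBm p)).2 (integrableOn_const (by rw [hvol]; simp) (by simp))
  choose vE hvE hvE0 hvE1 using fun x => exists_hasSum_indicator hEd (fun _ => f) x
  choose vB hvB hvB0 hvB1 using fun x => exists_hasSum_indicator hBd (fun p _ => m p) x
  have hEf : ∑' p, ∫⁻ x in E p, ‖f x‖ₑ = ∫⁻ x in Ω, ‖f x‖ₑ := by
    rw [← hEu, lintegral_iUnion hEm hEd]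
  have hmE : ∀ p, ∫⁻ x in B p, ‖m p‖ₑ ≤ ∫⁻ x in E p, ‖f x‖ₑ := fun p => by
    rw [setLIntegral_const, hvol, ← ofReal_norm, mul_comm,
      ← ENNReal.ofReal_mul (hVpos p).le, ← ofReal_integral_norm_eq_lintegral_enorm hf.integrableOn]
    exact ENNReal.ofReal_le_ofReal (hmV p)
  have hsumvol : ENNReal.ofReal l * ∑' p, volume (B p) ≤ ∫⁻ x in Ω, ‖f x‖ₑ := by
    rw [← ENNReal.tsum_mul_left]
    have h1 : ∀ p, ENNReal.ofReal l * volume (B p) ≤ ∫⁻ x in B p, ‖f x‖ₑ := fun p => by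
      rw [hvol, ← ENNReal.ofReal_mul hl.le,
        ← ofReal_integral_norm_eq_lintegral_enorm hf.integrableOn]
      exact ENNReal.ofReal_le_ofReal (hut p.2).2.1.le
    refine (ENNReal.tsum_le_tsum h1).trans ?_
    rw [← lintegral_iUnion hBm hBd]
    exact lintegral_mono_set (iUnion_mono hBsub)
  refine ⟨u, inferInstance, Ω, fun p => p.1.1, fun p => p.1.2, β, fun x => f x - vE x + vB x,
    hΩm, ?_, hr, fun p => (hi1 p).sub (hi2 p), fun p => ?_, fun p x hx => ?_, ?_, hsumvol, ?_,
    fun x => ?_⟩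
  · have h1 : volume Ω ≤ 5 ^ d * ∑' p, volume (B p) := by
      rw [← ENNReal.tsum_mul_left]
      refine (measure_iUnion_le _).trans (ENNReal.tsum_le_tsum fun p => ?_)
      rw [volume_closedBall_mul _ (hr p).le (by norm_num), ENNReal.ofReal_pow (by norm_num)]
      simp [hB]
    calc ENNReal.ofReal l * volume Ω
        ≤ ENNReal.ofReal l * (5 ^ d * ∑' p, volume (B p)) := by gcongr
      _ = 5 ^ d * (ENNReal.ofReal l * ∑' p, volume (B p)) := by ring
      _ ≤ 5 ^ d * ∫⁻ x, ‖f x‖ₑ := by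
        gcongr
        exact hsumvol.trans (setLIntegral_le_lintegral _ _)
  · rw [hβ, integral_sub (hi1 p) (hi2 p), integral_indicator (hEm p), integral_indicator (hBm p),
      setIntegral_const, Measure.real, hvol, ENNReal.toReal_ofReal (hVpos p).le, hm, smul_smul,
      mul_inv_cancel₀ (hVpos p).ne', one_smul, sub_self]
  · have h1 : x ∉ E p := fun h => hx (hEs p h)
    have h2 : x ∉ B p := fun h => hx (hBsub p h)
    simp [hβ, h1, h2]
  · rw [two_mul, ← hEf, ← ENNReal.tsum_add]
    refine ENNReal.tsum_le_tsum fun p => ?_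
    calc ∫⁻ x, ‖β p x‖ₑ
        ≤ ∫⁻ x, (E p).indicator (fun x => ‖f x‖ₑ) x + (B p).indicator (fun _ => ‖m p‖ₑ) x := by
          refine lintegral_mono fun x => (enorm_sub_le).trans_eq ?_
          rw [enorm_indicator_eq_indicator_enorm, enorm_indicator_eq_indicator_enorm]
      _ = (∫⁻ x in E p, ‖f x‖ₑ) + ∫⁻ x in B p, ‖m p‖ₑ := by
          rw [lintegral_add_right _ (measurable_const.indicator (hBm p)),
            lintegral_indicator (hEm p), lintegral_indicator (hBm p)]
      _ ≤ _ := add_le_add le_rfl (hmE p)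
  · filter_upwards [ae_norm_le_of_mean_le hf l] with x hx
    have h5 : (0 : ℝ) ≤ 5 ^ d * l := by positivity
    have hvBle : ‖vB x‖ ≤ 5 ^ d * l := by
      by_cases h : x ∈ ⋃ p, B p
      · obtain ⟨p, hp⟩ := mem_iUnion.1 h
        rw [hvB1 x p hp]; exact hml p
      · rw [hvB0 x h]; simpa using h5
    have hfle : ‖f x - vE x‖ ≤ l := by
      by_cases h : x ∈ Ω
      · rw [← hEu] at h
        obtain ⟨p, hp⟩ := mem_iUnion.1 h
        rw [hvE1 x p hp]; simpa using hl.le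
      · rw [hvE0 x (by rwa [hEu]), sub_zero]
        refine hx fun r hr => ?_
        by_contra! hc
        obtain ⟨r', hr'⟩ := exists_mem_stoppingBalls hd hf hl hr hc
        obtain ⟨q, hq, hsub⟩ := hcov _ hr'
        exact h (mem_iUnion.2 ⟨⟨q, hq⟩, hsub (mem_closedBall_self hr'.1.le)⟩)
    calc _ ≤ ‖f x - vE x‖ + ‖vB x‖ := norm_add_le _ _
      _ ≤ _ := by linarith
  · have := (hvE x).sub (hvB x)
    rw [show f x - (f x - vE x + vB x) = vE x - vB x by ring]
    exact this

end Decomposition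

section DecompositionBounds

open Metric

namespace IsCZDecomposition

variable {d : ℕ} {ι : Type} {f : (Fin d → ℝ) → ℂ} {l : ℝ} {Ω : Set (Fin d → ℝ)}
  {c : ι → Fin d → ℝ} {r : ι → ℝ} {β : ι → (Fin d → ℝ) → ℂ} {G : (Fin d → ℝ) → ℂ}

theorem tsum_lintegral_ne_top (h : IsCZDecomposition f l Ω c r β G) (hf : Integrable f) :
    ∑' p, ∫⁻ x, ‖β p x‖ₑ ≠ ⊤ :=
  ne_top_of_le_ne_top
    (ENNReal.mul_ne_top (by simp) ((setLIntegral_le_lintegral _ _).trans_lt hf.2).ne)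
    h.tsum_lintegral_le

variable [Countable ι]

theorem aestronglyMeasurable_sub (h : IsCZDecomposition f l Ω c r β G) :
    AEStronglyMeasurable (fun x => f x - G x) :=
  aestronglyMeasurable_of_tendsto_ae atTop
    (f := fun (s : Finset ι) x => ∑ p ∈ s, β p x)
    (fun s => by
      simpa [Finset.sum_fn] using
        s.aestronglyMeasurable_sum (fun p _ => (h.integrable p).aestronglyMeasurable))
    (Eventually.of_forall fun x => h.hasSum x)

theorem lintegral_sub_le (h : IsCZDecomposition f l Ω c r β G) :
    ∫⁻ x, ‖f x - G x‖ₑ ≤ 2 * ∫⁻ x in Ω, ‖f x‖ₑ := by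
  refine le_trans ?_ h.tsum_lintegral_le
  rw [← lintegral_tsum fun p => (h.integrable p).aestronglyMeasurable.enorm]
  refine lintegral_mono fun x => ?_
  rw [← (h.hasSum x).tsum_eq]
  exact enorm_tsum_le_tsum_enorm

theorem integrable_sub (h : IsCZDecomposition f l Ω c r β G) (hf : Integrable f) :
    Integrable fun x => f x - G x := by
  refine ⟨h.aestronglyMeasurable_sub, h.lintegral_sub_le.trans_lt ?_⟩
  exact ENNReal.mul_lt_top (by simp) ((setLIntegral_le_lintegral _ _).trans_lt hf.2)

theorem enorm_conv_sub_le (h : IsCZDecomposition f l Ω c r β G) (hf : Integrable f)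
    {K : (Fin d → ℝ) → ℝ} (hK : Continuous K) {M : ℝ} (hM : ∀ x, |K x| ≤ M) (x : Fin d → ℝ) :
    ‖conv (fun x => f x - G x) (fun y => (K y : ℂ)) x‖ₑ ≤
      ∑' p, ∫⁻ y, ‖β p y‖ₑ * ‖K (x - y) - K (x - c p)‖ₑ := by
  have hK' : Continuous fun y => (K (x - y) : ℂ) := by fun_prop
  have hM' : ∀ y, ‖(K (x - y) : ℂ)‖ ≤ M := fun y => by
    rw [Complex.norm_real]; exact hM _
  have hi : ∀ p, Integrable fun y => β p y * (K (x - y) : ℂ) := fun p =>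
    (h.integrable p).mul_bdd (c := M) hK'.aestronglyMeasurable (Eventually.of_forall hM')
  have hs : Summable fun p => ∫ y, ‖β p y * (K (x - y) : ℂ)‖ := by
    have h1 : Summable fun p => M * ∫ y, ‖β p y‖ := by
      refine Summable.mul_left M ?_
      refine (ENNReal.summable_toReal (h.tsum_lintegral_ne_top hf)).congr fun p => ?_
      rw [integral_norm_eq_lintegral_enorm (h.integrable p).aestronglyMeasurable]
    refine h1.of_nonneg_of_le (fun p => integral_nonneg fun _ => norm_nonneg _) fun p => ?_
    rw [← integral_const_mul]
    refine integral_mono (hi p).norm ((h.integrable p).norm.const_mul M) fun y => ?_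
    dsimp only
    rw [norm_mul, mul_comm]
    exact mul_le_mul_of_nonneg_right (hM' y) (norm_nonneg _)
  have hconv : conv (fun x => f x - G x) (fun y => (K y : ℂ)) x =
      ∑' p, ∫ y, β p y * (K (x - y) : ℂ) := by
    rw [(hasSum_integral_of_summable_integral_norm hi hs).tsum_eq, conv]
    refine integral_congr_ae (Eventually.of_forall fun y => ?_)
    exact ((h.hasSum y).mul_right _).tsum_eq.symm
  rw [hconv]
  refine enorm_tsum_le_tsum_enorm.trans (ENNReal.tsum_le_tsum fun p => ?_)
  have : ∫ y, β p y * (K (x - y) : ℂ) = ∫ y, β p y * ((K (x - y) - K (x - c p) : ℝ) : ℂ) := by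
    have h2 : ∫ y, β p y * (K (x - c p) : ℂ) = 0 := by
      rw [integral_mul_const, h.integral_eq_zero, zero_mul]
    rw [← sub_zero (∫ y, β p y * (K (x - y) : ℂ)), ← h2,
      ← integral_sub (hi p) ((h.integrable p).mul_const _)]
    refine integral_congr_ae (Eventually.of_forall fun y => ?_)
    push_cast; ring
  rw [this]
  refine (enorm_integral_le_lintegral_enorm _).trans_eq (lintegral_congr fun y => ?_)
  rw [enorm_mul]
  congr 1
  rw [← ofReal_norm, Complex.norm_real, ofReal_norm]

theorem lintegral_conv_sub_le (h : IsCZDecomposition f l Ω c r β G) (hf : Integrable f)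
    {K : (Fin d → ℝ) → ℝ} (hK : Continuous K) {M : ℝ} (hM : ∀ x, |K x| ≤ M) {C : ℝ≥0∞}
    (hC : ∀ ρ : ℝ, 0 < ρ → ∀ y : Fin d → ℝ, ‖y‖ ≤ ρ →
      ∫⁻ x in {x | 2 * d * ρ ≤ ‖x‖}, ‖K (x - y) - K x‖ₑ ≤ C) :
    ∫⁻ x in (⋃ p, closedBall (c p) (10 * d * r p))ᶜ,
      ‖conv (fun x => f x - G x) (fun y => (K y : ℂ)) x‖ₑ ≤ C * (2 * ∫⁻ x in Ω, ‖f x‖ₑ) := by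
  set S := (⋃ p, closedBall (c p) (10 * d * r p))ᶜ with hS
  have hmeas : ∀ p, AEMeasurable
      (fun z : (Fin d → ℝ) × (Fin d → ℝ) => ‖β p z.2‖ₑ * ‖K (z.1 - z.2) - K (z.1 - c p)‖ₑ)
      ((volume.restrict S).prod volume) := fun p =>
    (h.integrable p).aestronglyMeasurable.comp_snd.enorm.mul
      (Continuous.aestronglyMeasurable (by fun_prop)).enorm
  calc _ ≤ ∫⁻ x in S, ∑' p, ∫⁻ y, ‖β p y‖ₑ * ‖K (x - y) - K (x - c p)‖ₑ :=
        lintegral_mono fun x => h.enorm_conv_sub_le hf hK hM x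
    _ = ∑' p, ∫⁻ x in S, ∫⁻ y, ‖β p y‖ₑ * ‖K (x - y) - K (x - c p)‖ₑ :=
        lintegral_tsum fun p => (hmeas p).lintegral_prod_right'
    _ = ∑' p, ∫⁻ y, ∫⁻ x in S, ‖β p y‖ₑ * ‖K (x - y) - K (x - c p)‖ₑ :=
        tsum_congr fun p => lintegral_lintegral_swap (hmeas p)
    _ ≤ ∑' p, ∫⁻ y, C * ‖β p y‖ₑ := by
        refine ENNReal.tsum_le_tsum fun p => lintegral_mono fun y => ?_
        dsimp only
        rw [lintegral_const_mul' _ _ enorm_ne_top, mul_comm]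
        by_cases hy : y ∈ closedBall (c p) (5 * r p)
        · gcongr
          have h1 := hC (5 * r p) (by linarith [h.radius_pos p]) (y - c p)
            (by rwa [← dist_eq_norm])
          refine le_trans ?_ h1
          rw [← lintegral_indicator (measurableSet_le measurable_const measurable_norm)]
          refine le_trans ?_ (lintegral_sub_right_eq_self _ (c p)).le
          refine le_trans ?_ (setLIntegral_le_lintegral S _)
          refine setLIntegral_mono_ae' (by
            rw [hS]; exact (MeasurableSet.iUnion fun p => measurableSet_closedBall).compl) ?_
          refine Eventually.of_forall fun x hx => ?_
          have hx' : 10 * d * r p < ‖x - c p‖ := by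
            rw [← dist_eq_norm]
            by_contra! hc
            exact hx (mem_iUnion.2 ⟨p, hc⟩)
          rw [indicator_of_mem]
          · rw [sub_sub_sub_cancel_right]
          · rw [mem_ofPred_eq]
            linarith
        · simp [h.eq_zero_of_notMem p y hy]
    _ = C * ∑' p, ∫⁻ y, ‖β p y‖ₑ := by
        rw [← ENNReal.tsum_mul_left]
        refine tsum_congr fun p => lintegral_const_mul'' _ ?_
        exact (h.integrable p).aestronglyMeasurable.enorm
    _ ≤ _ := by gcongr; exact h.tsum_lintegral_le

theorem volume_iUnion_le (h : IsCZDecomposition f l Ω c r β G) :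
    ENNReal.ofReal l * volume (⋃ p, closedBall (c p) (10 * d * r p)) ≤
      ENNReal.ofReal ((10 * d) ^ d) * ∫⁻ x in Ω, ‖f x‖ₑ := by
  calc _ ≤ ENNReal.ofReal l * ∑' p, volume (closedBall (c p) (10 * d * r p)) := by
        gcongr; exact measure_iUnion_le _
    _ = ENNReal.ofReal ((10 * d) ^ d) *
        (ENNReal.ofReal l * ∑' p, volume (closedBall (c p) (r p))) := by
        rw [← ENNReal.tsum_mul_left, ← ENNReal.tsum_mul_left, ← ENNReal.tsum_mul_left]
        refine tsum_congr fun p => ?_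
        rw [mul_left_comm]
        congr 1
        exact volume_closedBall_mul _ (h.radius_pos p).le (by positivity)
    _ ≤ _ := by gcongr; exact h.tsum_volume_le

end IsCZDecomposition
end DecompositionBounds

section BoundedApproximation

open Metric

/-- Every integrable function is a bounded function up to an arbitrarily small error in `L¹` on
which the truncated Riesz kernels act with small `L¹` norm outside a small set. -/
theorem exists_bounded_approx_conv_kerK {d : ℕ} (hd : d ≠ 0) {f : (Fin d → ℝ) → ℂ}
    (hf : Integrable f) {ε : ℝ≥0} (hε : 0 < ε) :
    ∃ (G : (Fin d → ℝ) → ℂ) (E : Set (Fin d → ℝ)) (Λ : ℝ≥0), Integrable G ∧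
      (∀ᵐ x, ‖G x‖ ≤ Λ) ∧ ∫⁻ x, ‖f x - G x‖ₑ ≤ ε ∧ MeasurableSet E ∧ volume E ≤ ε ∧
      volume E * (Λ * ∫⁻ x, ‖G x‖ₑ) ≤ ε ∧
      ∀ a b : ℝ, 0 < a → a ≤ b → ∀ i : Fin d,
        ∫⁻ x in Eᶜ, ‖conv (fun x => f x - G x) (fun y => (kerK a b i y : ℂ)) x‖ₑ ≤ ε := by
  obtain ⟨C, hC⟩ := exists_lintegral_kerK_sub_le d
  obtain ⟨N, hN⟩ : ∃ N : ℝ≥0, ∫⁻ x, ‖f x‖ₑ = N := 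
    ⟨_, (ENNReal.coe_toNNReal hf.2.ne).symm⟩
  set K : ℝ≥0 := (10 * d) ^ d with hK
  set A : ℝ≥0 := 2 * C + 2 + K + K * (1 + 5 ^ d) * (N + 2) with hA
  have hA0 : 0 < A := by positivity
  set η : ℝ≥0 := min 1 (ε / A) with hη
  have hη0 : 0 < η := lt_min one_pos (by positivity)
  have hη1 : η ≤ 1 := min_le_left _ _
  have hAη : A * η ≤ ε := by
    calc A * η ≤ A * (ε / A) := by gcongr; exact min_le_right _ _
      _ = ε := by field_simp
  obtain ⟨δ, hδ, hδ'⟩ := exists_pos_setLIntegral_lt_of_measure_lt (μ := volume)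
    (f := fun x => ‖f x‖ₑ) hf.2.ne (ε := (η : ℝ≥0∞)) (by simpa using hη0.ne')
  obtain ⟨δ', hδ'0, hδ'le⟩ := ENNReal.lt_iff_exists_nnreal_btwn.1 hδ
  have hδ'0 : 0 < δ' := by simpa using hδ'0
  set l : ℝ≥0 := 1 + 5 ^ d * N / δ' with hl
  have hl1 : 1 ≤ l := by simp [hl]
  have hl0 : 0 < l := one_pos.trans_le hl1
  obtain ⟨ι, _, Ω, c, r, β, G, h⟩ := exists_isCZDecomposition hd hf (l := l) (by exact_mod_cast hl0)
  have hΩ : ∫⁻ x in Ω, ‖f x‖ₑ ≤ η := by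
    refine (hδ' Ω (lt_of_le_of_lt ?_ hδ'le)).le
    have h1 := h.volume_le
    rw [hN, ENNReal.ofReal_coe_nnreal] at h1
    have h2 : (5 : ℝ≥0∞) ^ d * N ≤ l * δ' := by
      have : 5 ^ d * N ≤ l * δ' := by
        rw [hl, add_mul, div_mul_cancel₀ _ hδ'0.ne']; exact le_add_self
      exact_mod_cast this
    exact (ENNReal.mul_le_mul_iff_right (by simpa using hl0.ne') ENNReal.coe_ne_top).1
      (h1.trans h2)
  have hd1 := h.lintegral_sub_le
  have hfG := h.integrable_sub hf
  have hG : Integrable G := (hf.sub hfG).congr (Eventually.of_forall fun x => by simp)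
  have hGN : ∫⁻ x, ‖G x‖ₑ ≤ N + 2 := by
    calc ∫⁻ x, ‖G x‖ₑ ≤ ∫⁻ x, ‖f x‖ₑ + ‖f x - G x‖ₑ := by
          refine lintegral_mono fun x => ?_
          calc ‖G x‖ₑ = ‖f x - (f x - G x)‖ₑ := by rw [sub_sub_cancel]
            _ ≤ _ := enorm_sub_le
      _ = (∫⁻ x, ‖f x‖ₑ) + ∫⁻ x, ‖f x - G x‖ₑ :=
          lintegral_add_left' hf.aestronglyMeasurable.enorm _
      _ ≤ N + 2 * η := by rw [hN]; gcongr; exact hd1.trans (by gcongr)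
      _ ≤ N + 2 * 1 := by gcongr; exact_mod_cast hη1
      _ = _ := by rw [mul_one]
  set E := ⋃ p, closedBall (c p) (10 * d * r p) with hE
  have hEl : l * volume E ≤ K * η := by
    have h1 := h.volume_iUnion_le
    have h2 : ENNReal.ofReal ((10 * d) ^ d) = K := by
      rw [hK, ← ENNReal.ofReal_coe_nnreal]; push_cast; rfl
    rw [ENNReal.ofReal_coe_nnreal, h2] at h1
    exact h1.trans (by gcongr)
  refine ⟨G, E, (1 + 5 ^ d) * l, hG, ?_, ?_, ?_, ?_, ?_, fun a b ha hab i => ?_⟩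
  · simpa using h.ae_norm_le
  · refine hd1.trans ((mul_le_mul_right hΩ 2).trans ?_)
    have : 2 * η ≤ ε := le_trans (by gcongr; rw [hA]; exact le_add_right (le_add_right le_add_self)) hAη
    exact_mod_cast this
  · exact MeasurableSet.iUnion fun p => measurableSet_closedBall
  · have : K * η ≤ ε := le_trans (by gcongr; rw [hA]; exact le_add_right le_add_self) hAη
    refine le_trans ?_ (hEl.trans (by exact_mod_cast this))
    exact le_mul_of_one_le_left zero_le (by exact_mod_cast hl1)
  · have : K * (1 + 5 ^ d) * (N + 2) * η ≤ ε := le_trans (by gcongr; rw [hA]; exact le_add_self) hAη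
    calc volume E * (((1 + 5 ^ d) * l : ℝ≥0) * ∫⁻ x, ‖G x‖ₑ)
        ≤ volume E * (((1 + 5 ^ d) * l : ℝ≥0) * (N + 2)) := by gcongr
      _ = (1 + 5 ^ d) * (N + 2) * (l * volume E) := by push_cast; ring
      _ ≤ (1 + 5 ^ d) * (N + 2) * (K * η) := by gcongr
      _ = ((K * (1 + 5 ^ d) * (N + 2) * η : ℝ≥0) : ℝ≥0∞) := by push_cast; ring
      _ ≤ ε := by exact_mod_cast this
  · obtain ⟨M, hM⟩ := exists_abs_kerK_le ha hab i
    refine (h.lintegral_conv_sub_le hf (continuous_kerK a b i) hM (C := C)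
      fun ρ hρ y hy => hC a b ha hab i ρ hρ y hy).trans ?_
    have : C * (2 * η) ≤ ε := by
      refine le_trans ?_ hAη
      rw [← mul_assoc, mul_comm C]
      gcongr
      rw [hA]; exact le_add_right (le_add_right le_self_add)
    calc _ ≤ (C : ℝ≥0∞) * (2 * η) := by gcongr
      _ ≤ ε := by exact_mod_cast this

end BoundedApproximation

section Mollification

theorem conv_eq_convolution {d : ℕ} (f g : (Fin d → ℝ) → ℂ) :
    conv f g = convolution f g (ContinuousLinearMap.mul ℝ ℂ) volume := rfl

theorem integrable_conv {d : ℕ} {f g : (Fin d → ℝ) → ℂ} (hf : Integrable f) (hg : Integrable g) :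
    Integrable (conv f g) := by
  rw [conv_eq_convolution]
  exact hf.integrable_convolution _ hg

theorem ft_conv {d : ℕ} {f g : (Fin d → ℝ) → ℂ} (hf : Integrable f) (hg : Integrable g)
    (ξ : Fin d → ℝ) : ft (conv f g) ξ = ft f ξ * ft g ξ := by
  have he : Continuous fun x : Fin d → ℝ =>
      Complex.exp ((-(2 * Real.pi * dotP ξ x) : ℝ) * Complex.I) := by
    unfold dotP; fun_prop
  have hi : ∀ {u : (Fin d → ℝ) → ℂ}, Integrable u → Integrable fun x =>
      Complex.exp ((-(2 * Real.pi * dotP ξ x) : ℝ) * Complex.I) * u x := fun hu =>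
    hu.bdd_mul (c := 1) he.aestronglyMeasurable
      (Eventually.of_forall fun x => (Complex.norm_exp_ofReal_mul_I _).le)
  have h := integral_convolution (μ := volume) (ν := volume) (ContinuousLinearMap.mul ℝ ℂ)
    (hi hf) (hi hg)
  simp only [ContinuousLinearMap.mul_apply'] at h
  rw [ft, ft, ft, ← h]
  congr 1
  ext x
  rw [conv, convolution_def, ← integral_const_mul]
  congr 1
  ext y
  have hx : (-(2 * Real.pi * dotP ξ x) : ℝ) * Complex.I =
      (-(2 * Real.pi * dotP ξ y) : ℝ) * Complex.I +
        (-(2 * Real.pi * dotP ξ (x - y)) : ℝ) * Complex.I := by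
    have : dotP ξ x = dotP ξ y + dotP ξ (x - y) := by
      simp only [dotP, ← Finset.sum_add_distrib, ← mul_add, Pi.sub_apply, add_sub_cancel]
    rw [this]; push_cast; ring
  rw [ContinuousLinearMap.mul_apply', hx, Complex.exp_add]
  ring

theorem norm_conv_le {d : ℕ} {f K : (Fin d → ℝ) → ℂ} (hf : Integrable f) {C : ℝ}
    (hC : ∀ x, ‖K x‖ ≤ C) (x : Fin d → ℝ) : ‖conv f K x‖ ≤ C * ∫ y, ‖f y‖ := by
  rw [← integral_const_mul]
  refine norm_integral_le_of_norm_le (hf.norm.const_mul C) (Eventually.of_forall fun y => ?_)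
  rw [norm_mul, mul_comm]
  exact mul_le_mul_of_nonneg_right (hC _) (norm_nonneg _)

theorem continuous_conv {d : ℕ} {f K : (Fin d → ℝ) → ℂ} (hf : Integrable f) (hK : Continuous K)
    {C : ℝ} (hC : ∀ x, ‖K x‖ ≤ C) : Continuous (conv f K) := by
  refine continuous_of_dominated (bound := fun y => C * ‖f y‖) (fun x => ?_) (fun x => ?_)
    (hf.norm.const_mul C) (Eventually.of_forall fun y => by fun_prop)
  · exact hf.aestronglyMeasurable.mul (Continuous.aestronglyMeasurable (by fun_prop))
  · refine Eventually.of_forall fun y => ?_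
    rw [norm_mul, mul_comm]
    exact mul_le_mul_of_nonneg_right (hC _) (norm_nonneg _)

theorem conv_sub_left {d : ℕ} {f G K : (Fin d → ℝ) → ℂ} (hf : Integrable f) (hG : Integrable G)
    (hK : Continuous K) {C : ℝ} (hC : ∀ x, ‖K x‖ ≤ C) (x : Fin d → ℝ) :
    conv (fun x => f x - G x) K x = conv f K x - conv G K x := by
  have hi : ∀ {u : (Fin d → ℝ) → ℂ}, Integrable u → Integrable fun y => u y * K (x - y) :=
    fun hu => hu.mul_bdd (c := C) (Continuous.aestronglyMeasurable (by fun_prop))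
      (Eventually.of_forall fun y => hC _)
  rw [conv, conv, conv, ← integral_sub (hi hf) (hi hG)]
  simp only [sub_mul]

theorem eLpNorm_two_sq {α : Type*} [MeasurableSpace α] {μ : Measure α} (u : α → ℂ) :
    eLpNorm u 2 μ ^ 2 = ∫⁻ x, ‖u x‖ₑ ^ 2 ∂μ := by
  rw [eLpNorm_eq_lintegral_rpow_enorm_toReal (by simp) (by simp), ← ENNReal.rpow_natCast,
    ← ENNReal.rpow_mul]
  simp

theorem lintegral_sq_le_of_ae_norm_le {d : ℕ} {G : (Fin d → ℝ) → ℂ} {Λ : ℝ≥0}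
    (hΛ : ∀ᵐ x, ‖G x‖ ≤ Λ) : ∫⁻ x, ‖G x‖ₑ ^ 2 ≤ Λ * ∫⁻ x, ‖G x‖ₑ := by
  rw [← lintegral_const_mul' _ _ ENNReal.coe_ne_top]
  refine lintegral_mono_ae (hΛ.mono fun x hx => ?_)
  rw [sq]
  gcongr
  rw [← ofReal_norm]
  exact ENNReal.ofReal_le_of_le_toReal (by simpa using hx)

theorem lintegral_conv_sq_le {d : ℕ} {G K : (Fin d → ℝ) → ℂ} (hG : Integrable G) {Λ : ℝ≥0}
    (hΛ : ∀ᵐ x, ‖G x‖ ≤ Λ) (hK : Integrable K) {C : ℝ}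
    (hC : ∀ x, ‖K x‖ ≤ C) (hK1 : ∀ ξ, ‖ft K ξ‖ ≤ 1) :
    ∫⁻ x, ‖conv G K x‖ₑ ^ 2 ≤ Λ * ∫⁻ x, ‖G x‖ₑ := by
  have hfin : ∀ {u : (Fin d → ℝ) → ℂ} {A : ℝ}, Integrable u → (∀ᵐ x, ‖u x‖ ≤ A) → MemLp u 2 :=
    fun {u A} hu hA => (memLp_two_iff_integrable_sq_norm hu.1).2
      ((hu.norm.mul_bdd (c := A) hu.1.norm (hA.mono fun x hx => by simpa using hx)).congr
        (Eventually.of_forall fun x => (sq _).symm))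
  refine le_trans ?_ (lintegral_sq_le_of_ae_norm_le hΛ)
  rw [← eLpNorm_two_sq, ← eLpNorm_two_sq]
  gcongr 1
  rw [← eLpNorm_ft_eq hG (hfin hG hΛ), ← eLpNorm_ft_eq (integrable_conv hG hK)
    (hfin (integrable_conv hG hK) (Eventually.of_forall (norm_conv_le hG hC)))]
  refine eLpNorm_mono fun ξ => ?_
  rw [ft_conv hG hK, norm_mul]
  exact mul_le_of_le_one_right (norm_nonneg _) (hK1 ξ)

/-- A pointwise convergent sequence is uniformly bounded off a set of small mass. -/
theorem exists_uniform_bound_off_small {d : ℕ} {A : ℕ → (Fin d → ℝ) → ℂ} {g : (Fin d → ℝ) → ℂ}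
    (hA : ∀ n, Continuous (A n)) (hlim : ∀ᵐ x, Tendsto (fun n => A n x) atTop (𝓝 (g x)))
    {w : (Fin d → ℝ) → ℝ≥0∞} (hwm : AEMeasurable w) (hw : ∫⁻ x, w x ≠ ⊤) {ε : ℝ≥0∞} (hε : ε ≠ 0) :
    ∃ (S : Set (Fin d → ℝ)) (M : ℝ), MeasurableSet S ∧ (∀ x ∈ S, ∀ n, ‖A n x‖ ≤ M) ∧
      ∫⁻ x in Sᶜ, w x ≤ ε := by
  set S : ℕ → Set (Fin d → ℝ) := fun M => {x | ∀ n, ‖A n x‖ ≤ M} with hS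
  have hSm : ∀ M, MeasurableSet (S M) := fun M => by
    have : S M = ⋂ n, {x | ‖A n x‖ ≤ M} := by ext; simp [hS]
    rw [this]
    exact MeasurableSet.iInter fun n => (isClosed_le (hA n).norm continuous_const).measurableSet
  have h : Tendsto (fun M : ℕ => ∫⁻ x, (S M)ᶜ.indicator w x) atTop (𝓝 (∫⁻ _ : Fin d → ℝ, 0)) := by
    refine tendsto_lintegral_of_dominated_convergence' w
      (fun M => hwm.indicator (hSm M).compl)
      (fun M => Eventually.of_forall fun x => indicator_le_self' (by simp) x) hw ?_
    filter_upwards [hlim] with x hx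
    obtain ⟨C, hC⟩ := hx.norm.bddAbove_range
    refine tendsto_const_nhds.congr' ?_
    filter_upwards [eventually_ge_atTop ⌈C⌉₊] with M hM
    rw [indicator_of_notMem]
    exact fun hc => hc fun n => (hC ⟨n, rfl⟩).trans ((Nat.le_ceil C).trans (by exact_mod_cast hM))
  rw [lintegral_zero] at h
  obtain ⟨M, hM⟩ := (h.eventually (ge_mem_nhds (pos_iff_ne_zero.2 hε))).exists
  exact ⟨S M, M, hSm M, fun x hx n => hx n, by rwa [lintegral_indicator (hSm M).compl] at hM⟩

end Mollification

section RieszFourier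

theorem norm_rieszMul_le {d : ℕ} (i : Fin d) (ξ : Fin d → ℝ) : ‖rieszMul i ξ‖ ≤ 1 :=
  le_of_tendsto (tendsto_ft_kerK i ξ).norm (Eventually.of_forall fun n =>
    norm_ft_kerK_le (by positivity) ((inv_le_one_of_one_le₀ (by simp)).trans (by simp)) i ξ)

theorem measurable_rieszMul {d : ℕ} (i : Fin d) : Measurable (rieszMul i : (Fin d → ℝ) → ℂ) := by
  have h : Continuous (eucNorm : (Fin d → ℝ) → ℝ) := continuous_eucNorm
  unfold rieszMul
  have := h.measurable
  fun_prop

theorem tendsto_integral_conv_kerK {d : ℕ} {f W : (Fin d → ℝ) → ℂ} (hf : Integrable f)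
    (hW : Integrable W) (i : Fin d) :
    Tendsto (fun n : ℕ => ∫ x, conv f (fun y => (kerK ((n : ℝ) + 1)⁻¹ ((n : ℝ) + 1) i y : ℂ)) x *
      ft W x) atTop (𝓝 (∫ ξ, ft f ξ * rieszMul i ξ * W ξ)) := by
  have hn0 : ∀ n : ℕ, (0 : ℝ) < ((n : ℝ) + 1)⁻¹ := fun n => by positivity
  have hn1 : ∀ n : ℕ, ((n : ℝ) + 1)⁻¹ ≤ (n : ℝ) + 1 := fun n =>
    (inv_le_one_of_one_le₀ (by simp)).trans (by simp)
  have hKi : ∀ n : ℕ, Integrable fun y => (kerK ((n : ℝ) + 1)⁻¹ ((n : ℝ) + 1) i y : ℂ) := fun n =>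
    (integrable_kerK (hn0 n) (hn1 n) i).ofReal
  have h1 : ∀ n : ℕ, ∫ x, conv f (fun y => (kerK ((n : ℝ) + 1)⁻¹ ((n : ℝ) + 1) i y : ℂ)) x *
      ft W x = ∫ ξ, ft f ξ * ft (fun y => (kerK ((n : ℝ) + 1)⁻¹ ((n : ℝ) + 1) i y : ℂ)) ξ * W ξ :=
    fun n => by
      rw [← integral_ft_mul (integrable_conv hf (hKi n)) hW]
      simp only [ft_conv hf (hKi n)]
  simp only [h1]
  refine tendsto_integral_of_dominated_convergence (fun ξ => (∫ x, ‖f x‖) * ‖W ξ‖) (fun n => ?_)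
    (hW.norm.const_mul _) (fun n => Eventually.of_forall fun ξ => ?_)
    (Eventually.of_forall fun ξ => ((tendsto_ft_kerK i ξ).const_mul _).mul_const _)
  · exact ((continuous_ft hf).mul (continuous_ft (hKi n))).aestronglyMeasurable.mul hW.1
  · rw [norm_mul, norm_mul]
    gcongr
    calc _ ≤ (∫ x, ‖f x‖) * 1 := by
          gcongr
          · exact norm_ft_le f ξ
          · exact norm_ft_kerK_le (hn0 n) (hn1 n) i ξ
      _ = _ := mul_one _

theorem enorm_ft_le {d : ℕ} {f : (Fin d → ℝ) → ℂ} (hf : Integrable f) (ξ : Fin d → ℝ) :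
    ‖ft f ξ‖ₑ ≤ ∫⁻ x, ‖f x‖ₑ := by
  rw [← ofReal_integral_norm_eq_lintegral_enorm hf, ← ofReal_norm]
  exact ENNReal.ofReal_le_ofReal (norm_ft_le f ξ)

theorem enorm_integral_conv_mul_ft_le {d : ℕ} {f K W : (Fin d → ℝ) → ℂ} (hf : Integrable f)
    (hK : Integrable K) (hW : Integrable W) (hK1 : ∀ ξ, ‖ft K ξ‖ ≤ 1) :
    ‖∫ x, conv f K x * ft W x‖ₑ ≤ (∫⁻ x, ‖f x‖ₑ) * ∫⁻ x, ‖W x‖ₑ := by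
  rw [← integral_ft_mul (integrable_conv hf hK) hW, ← lintegral_const_mul'' _ hW.1.enorm]
  refine (enorm_integral_le_lintegral_enorm _).trans (lintegral_mono fun ξ => ?_)
  rw [ft_conv hf hK, enorm_mul, enorm_mul]
  gcongr
  calc _ ≤ (∫⁻ x, ‖f x‖ₑ) * 1 := by
        gcongr
        · exact enorm_ft_le hf ξ
        · rw [← ofReal_norm]; exact ENNReal.ofReal_le_one.2 (hK1 ξ)
    _ = _ := mul_one _

theorem lintegral_mul_le_sqrt {α : Type*} [MeasurableSpace α] {μ : Measure α} {u v : α → ℂ}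
    (hu : AEStronglyMeasurable u μ) (hv : AEStronglyMeasurable v μ) :
    ∫⁻ x, ‖u x‖ₑ * ‖v x‖ₑ ∂μ ≤
      ((∫⁻ x, ‖u x‖ₑ ^ 2 ∂μ) * ∫⁻ x, ‖v x‖ₑ ^ 2 ∂μ) ^ (1 / 2 : ℝ) := by
  have := ENNReal.lintegral_mul_le_Lp_mul_Lq μ Real.HolderConjugate.two_two hu.enorm hv.enorm
  rw [ENNReal.mul_rpow_of_nonneg _ _ (by norm_num)]
  simpa using this

theorem tendsto_lintegral_sub_mul {d : ℕ} {A : ℕ → (Fin d → ℝ) → ℂ} {g h : (Fin d → ℝ) → ℂ}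
    (hA : ∀ n, Continuous (A n)) (hlim : ∀ᵐ x, Tendsto (fun n => A n x) atTop (𝓝 (g x)))
    (hg : AEStronglyMeasurable g) (hh : Integrable h) {S : Set (Fin d → ℝ)} (hS : MeasurableSet S)
    {M : ℝ} (hM : ∀ x ∈ S, ∀ n, ‖A n x‖ ≤ M) :
    Tendsto (fun n => ∫⁻ x in S, ‖g x - A n x‖ₑ * ‖h x‖ₑ) atTop (𝓝 0) := by
  rw [← lintegral_zero (μ := volume.restrict S)]
  refine tendsto_lintegral_of_dominated_convergence' (fun x => ENNReal.ofReal (2 * M) * ‖h x‖ₑ)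
    (fun n => ?_) (fun n => ?_) ?_ ?_
  · exact ((hg.sub (hA n).aestronglyMeasurable).enorm.mul hh.1.enorm).restrict
  · filter_upwards [ae_restrict_of_ae hlim, ae_restrict_mem hS] with x hx hxS
    gcongr
    rw [← ofReal_norm]
    refine ENNReal.ofReal_le_ofReal ((norm_sub_le _ _).trans ?_)
    have := le_of_tendsto hx.norm (Eventually.of_forall fun n => hM x hxS n)
    linarith [hM x hxS n]
  · rw [lintegral_const_mul' _ _ ENNReal.ofReal_ne_top]
    exact ENNReal.mul_ne_top ENNReal.ofReal_ne_top
      ((setLIntegral_le_lintegral _ _).trans_lt hh.2).ne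
  · filter_upwards [ae_restrict_of_ae hlim] with x hx
    have h1 : Tendsto (fun n => ‖g x - A n x‖ₑ) atTop (𝓝 0) := by
      have := (tendsto_const_nhds.sub hx : Tendsto (fun n => g x - A n x) atTop (𝓝 (g x - g x)))
      simpa using this.enorm
    simpa using ENNReal.Tendsto.mul_const h1 (Or.inr enorm_ne_top)

/-- The integrable principal value Riesz transform has the Fourier transform prescribed by the
multiplier, in the weak sense. -/
theorem integral_riesz_mul_ft {d : ℕ} {f : (Fin d → ℝ) → ℂ} {g : (Fin d → ℝ) → Fin d → ℂ}
    (hf : Integrable f) (hg : Integrable g) (hR : HasRiesz f g) {W : (Fin d → ℝ) → ℂ}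
    (hW : Integrable W) (hW' : Integrable (ft W)) (i : Fin d) :
    ∫ x, g x i * ft W x = ∫ ξ, ft f ξ * rieszMul i ξ * W ξ := by
  have hd : d ≠ 0 := (Fin.pos i).ne'
  have hn0 : ∀ n : ℕ, (0 : ℝ) < ((n : ℝ) + 1)⁻¹ := fun n => by positivity
  have hn1 : ∀ n : ℕ, ((n : ℝ) + 1)⁻¹ ≤ (n : ℝ) + 1 := fun n =>
    (inv_le_one_of_one_le₀ (by simp)).trans (by simp)
  set K : ℕ → (Fin d → ℝ) → ℂ := fun n y => (kerK ((n : ℝ) + 1)⁻¹ ((n : ℝ) + 1) i y : ℂ) with hK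
  have hKi : ∀ n, Integrable (K n) := fun n => (integrable_kerK (hn0 n) (hn1 n) i).ofReal
  have hKc : ∀ n, Continuous (K n) := fun n =>
    Complex.continuous_ofReal.comp (continuous_kerK _ _ i)
  have hKb : ∀ n, ∃ C, ∀ y, ‖K n y‖ ≤ C := fun n => by
    simpa [hK] using exists_abs_kerK_le (hn0 n) (hn1 n) i
  have hK1 : ∀ n ξ, ‖ft (K n) ξ‖ ≤ 1 := fun n ξ => norm_ft_kerK_le (hn0 n) (hn1 n) i ξ
  set A : ℕ → (Fin d → ℝ) → ℂ := fun n => conv f (K n) with hA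
  have hAc : ∀ n, Continuous (A n) := fun n =>
    (hKb n).elim fun C hC => continuous_conv hf (hKc n) hC
  have hgi : Integrable fun x => g x i := hg.eval i
  have hlim : ∀ᵐ x, Tendsto (fun n => A n x) atTop (𝓝 (g x i)) :=
    hR.mono fun x hx => tendsto_conv_kerK hf hx i
  have hI := tendsto_integral_conv_kerK hf hW i
  set h := ft W with hh
  obtain ⟨H, hH⟩ : ∃ H : ℝ≥0, ∫⁻ x, ‖W x‖ₑ = H := ⟨_, (ENNReal.coe_toNNReal hW.2.ne).symm⟩
  have hhH : ∀ x, ‖h x‖ₑ ≤ H := fun x => hH ▸ enorm_ft_le hW x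
  have hhc : Continuous h := continuous_ft hW
  have hmulh : ∀ {u : (Fin d → ℝ) → ℂ}, Integrable u → Integrable fun x => u x * h x := fun hu =>
    hu.mul_bdd (c := ∫ x, ‖W x‖) hhc.aestronglyMeasurable (Eventually.of_forall (norm_ft_le W))
  set D := (∫ x, g x i * h x) - ∫ ξ, ft f ξ * rieszMul i ξ * W ξ with hD
  have hDlim : Tendsto (fun n => ‖(∫ x, g x i * h x) - ∫ x, A n x * h x‖ₑ) atTop (𝓝 ‖D‖ₑ) :=
    (tendsto_const_nhds.sub hI).enorm
  have key : ∀ ε : ℝ≥0, 0 < ε →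
      ‖D‖ₑ ≤ ((4 * H * ε + NNReal.sqrt ((H ^ 2 + 1) * ε) : ℝ≥0) : ℝ≥0∞) := by
    intro ε hε
    obtain ⟨δ, hδ, hδE⟩ := exists_pos_setLIntegral_lt_of_measure_lt (μ := volume)
      (f := fun x => ‖g x i‖ₑ) hgi.2.ne (ε := (ε : ℝ≥0∞)) (by simpa using hε.ne')
    obtain ⟨δ', hδ'0, hδ'⟩ := ENNReal.lt_iff_exists_nnreal_btwn.1 hδ
    have hδ'0 : 0 < δ' := by simpa using hδ'0
    obtain ⟨G, E, Λ, hG, hΛ, hfG, hEm, hEv, hEΛ, hbad⟩ :=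
      exists_bounded_approx_conv_kerK hd hf (lt_min hε hδ'0)
    have hle : ((min ε δ' : ℝ≥0) : ℝ≥0∞) ≤ ε := by exact_mod_cast min_le_left _ _
    have hgE : ∫⁻ x in E, ‖g x i‖ₑ ≤ ε := (hδE E (lt_of_le_of_lt (hEv.trans
      (by exact_mod_cast min_le_right _ _)) hδ')).le
    set P : ℝ≥0∞ := Λ * ∫⁻ x, ‖G x‖ₑ with hP
    have hPtop : P ≠ ⊤ := ENNReal.mul_ne_top (by simp) hG.2.ne
    obtain ⟨S, M, hSm, hSM, hSw⟩ := exists_uniform_bound_off_small hAc hlim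
      (w := fun x => ‖g x i‖ₑ + P * H * ‖h x‖ₑ)
      (hgi.1.enorm.add (hW'.1.enorm.const_mul _)) (by
        rw [lintegral_add_left' hgi.1.enorm,
          lintegral_const_mul' _ _ (ENNReal.mul_ne_top hPtop (by simp))]
        exact ENNReal.add_ne_top.2 ⟨hgi.2.ne, ENNReal.mul_ne_top
          (ENNReal.mul_ne_top hPtop (by simp)) hW'.2.ne⟩) (ε := (ε : ℝ≥0∞)) (by simpa using hε.ne')
    have hgS : ∫⁻ x in Sᶜ, ‖g x i‖ₑ ≤ ε :=
      (lintegral_mono fun x => le_self_add).trans hSw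
    have hhS : P * H * ∫⁻ x in Sᶜ, ‖h x‖ₑ ≤ ε := by
      rw [← lintegral_const_mul' _ _ (ENNReal.mul_ne_top hPtop (by simp))]
      exact (lintegral_mono fun x => le_add_self).trans hSw
    set F := E ∪ Sᶜ with hF
    have hFm : MeasurableSet F := hEm.union hSm.compl
    have hFE : Fᶜ ⊆ Eᶜ := compl_subset_compl.2 subset_union_left
    have hFS : Fᶜ ⊆ S := by rw [hF, compl_union, compl_compl]; exact inter_subset_right
    have hT := tendsto_lintegral_sub_mul hAc hlim hgi.1 hW' hSm hSM
    have hB : Integrable fun x => f x - G x := hf.sub hG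
    have hgF : ∫⁻ x in F, ‖g x i‖ₑ * ‖h x‖ₑ ≤ H * (ε + ε) := by
      calc _ ≤ ∫⁻ x in F, H * ‖g x i‖ₑ := lintegral_mono fun x => by
            rw [mul_comm]; gcongr; exact hhH x
        _ = H * ∫⁻ x in F, ‖g x i‖ₑ := lintegral_const_mul' _ _ (by simp)
        _ ≤ _ := by
          gcongr
          exact (lintegral_union_le _ _ _).trans (add_le_add hgE hgS)
    have hhF : P * ∫⁻ x in F, ‖h x‖ₑ ^ 2 ≤ (H ^ 2 + 1) * ε := by
      have h1 : ∫⁻ x in E, ‖h x‖ₑ ^ 2 ≤ H ^ 2 * volume E := by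
        rw [← setLIntegral_const]
        exact lintegral_mono fun x => by gcongr; exact hhH x
      have h2 : ∫⁻ x in Sᶜ, ‖h x‖ₑ ^ 2 ≤ H * ∫⁻ x in Sᶜ, ‖h x‖ₑ := by
        rw [← lintegral_const_mul' _ _ (by simp)]
        exact lintegral_mono fun x => by rw [sq]; gcongr; exact hhH x
      calc _ ≤ P * (H ^ 2 * volume E + H * ∫⁻ x in Sᶜ, ‖h x‖ₑ) := by
            gcongr
            exact (lintegral_union_le _ _ _).trans (add_le_add h1 h2)
        _ = H ^ 2 * (volume E * P) + P * H * ∫⁻ x in Sᶜ, ‖h x‖ₑ := by ring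
        _ ≤ H ^ 2 * ε + ε := by gcongr; exact hEΛ.trans hle
        _ = _ := by ring
    have hbound : ∀ n, ‖(∫ x, g x i * h x) - ∫ x, A n x * h x‖ₑ ≤
        ((4 * H * ε + NNReal.sqrt ((H ^ 2 + 1) * ε) : ℝ≥0) : ℝ≥0∞) +
          ∫⁻ x in S, ‖g x i - A n x‖ₑ * ‖h x‖ₑ := by
      intro n
      obtain ⟨C, hC⟩ := hKb n
      set u := conv G (K n) with hu
      set v := conv (fun x => f x - G x) (K n) with hv
      have hAuv : ∀ x, A n x = u x + v x := fun x => by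
        rw [hv, conv_sub_left hf hG (hKc n) hC]; simp [hA, hu]
      have hui : Integrable u := integrable_conv hG (hKi n)
      have hvi : Integrable v := integrable_conv hB (hKi n)
      have hsplit : (∫ x, g x i * h x) - ∫ x, A n x * h x =
          (∫ x, (g x i - u x) * h x) - ∫ x, v x * h x := by
        have hAi : Integrable (A n) := integrable_conv hf (hKi n)
        have hgu : Integrable fun x => g x i - u x := hgi.sub hui
        rw [← integral_sub (hmulh hgi) (hmulh hAi), ← integral_sub (hmulh hgu) (hmulh hvi)]
        refine integral_congr_ae (.of_forall fun x => ?_)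
        simp only [hAuv]
        ring
      have hv1 : ‖∫ x, v x * h x‖ₑ ≤ H * ε := by
        refine (enorm_integral_conv_mul_ft_le hB (hKi n) hW (hK1 n)).trans ?_
        rw [hH, mul_comm]
        gcongr
        exact hfG.trans hle
      have hin : ∫⁻ x in F, ‖g x i - u x‖ₑ * ‖h x‖ₑ ≤
          H * (ε + ε) + NNReal.sqrt ((H ^ 2 + 1) * ε) := by
        have h2 : ∫⁻ x in F, ‖u x‖ₑ * ‖h x‖ₑ ≤ NNReal.sqrt ((H ^ 2 + 1) * ε) := by
          refine (lintegral_mul_le_sqrt hui.1.restrict hhc.aestronglyMeasurable).trans ?_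
          rw [NNReal.sqrt_eq_rpow, ENNReal.coe_rpow_of_nonneg _ (by norm_num)]
          refine ENNReal.rpow_le_rpow ?_ (by norm_num)
          refine le_trans ?_ (hhF.trans_eq (by push_cast; rfl))
          gcongr
          exact (setLIntegral_le_lintegral _ _).trans (lintegral_conv_sq_le hG hΛ (hKi n) hC (hK1 n))
        calc _ ≤ ∫⁻ x in F, ‖g x i‖ₑ * ‖h x‖ₑ + ‖u x‖ₑ * ‖h x‖ₑ := lintegral_mono fun x => by
              rw [← add_mul]; gcongr; exact enorm_sub_le
          _ = (∫⁻ x in F, ‖g x i‖ₑ * ‖h x‖ₑ) + ∫⁻ x in F, ‖u x‖ₑ * ‖h x‖ₑ :=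
              lintegral_add_left' (hgi.1.enorm.mul hhc.aestronglyMeasurable.enorm).restrict _
          _ ≤ _ := add_le_add hgF h2
      have hout : ∫⁻ x in Fᶜ, ‖g x i - u x‖ₑ * ‖h x‖ₑ ≤
          (∫⁻ x in S, ‖g x i - A n x‖ₑ * ‖h x‖ₑ) + H * ε := by
        calc _ ≤ ∫⁻ x in Fᶜ, ‖g x i - A n x‖ₑ * ‖h x‖ₑ + H * ‖v x‖ₑ := lintegral_mono fun x => by
              dsimp only
              rw [show g x i - u x = (g x i - A n x) + v x by rw [hAuv]; ring, mul_comm (H : ℝ≥0∞)]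
              calc _ ≤ (‖g x i - A n x‖ₑ + ‖v x‖ₑ) * ‖h x‖ₑ := by gcongr; exact enorm_add_le _ _
                _ ≤ _ := by rw [add_mul]; gcongr; exact hhH x
          _ = (∫⁻ x in Fᶜ, ‖g x i - A n x‖ₑ * ‖h x‖ₑ) + H * ∫⁻ x in Fᶜ, ‖v x‖ₑ := by
              rw [lintegral_add_right' _ (hvi.1.enorm.const_mul _).restrict,
                lintegral_const_mul' _ _ (by simp)]
          _ ≤ _ := by
              gcongr
              exact (lintegral_mono_set hFE).trans
                ((hbad _ _ (hn0 n) (hn1 n) i).trans hle)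
      rw [hsplit]
      calc _ ≤ ‖∫ x, (g x i - u x) * h x‖ₑ + ‖∫ x, v x * h x‖ₑ := enorm_sub_le
        _ ≤ (∫⁻ x, ‖g x i - u x‖ₑ * ‖h x‖ₑ) + H * ε := by
          gcongr
          refine (enorm_integral_le_lintegral_enorm _).trans_eq (lintegral_congr fun x => ?_)
          rw [enorm_mul]
        _ ≤ (H * (ε + ε) + NNReal.sqrt ((H ^ 2 + 1) * ε) +
            ((∫⁻ x in S, ‖g x i - A n x‖ₑ * ‖h x‖ₑ) + H * ε)) + H * ε := by
          gcongr
          rw [← lintegral_add_compl _ hFm]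
          exact add_le_add hin hout
        _ = _ := by push_cast; ring
    refine le_of_tendsto_of_tendsto' hDlim ?_ hbound
    simpa using tendsto_const_nhds.add hT
  have hD0 : ‖D‖ₑ ≤ 0 := by
    have hc : Tendsto (fun ε : ℝ≥0 => ((4 * H * ε + NNReal.sqrt ((H ^ 2 + 1) * ε) : ℝ≥0) : ℝ≥0∞))
        (𝓝[>] 0) (𝓝 0) := by
      have : Continuous fun ε : ℝ≥0 =>
          ((4 * H * ε + NNReal.sqrt ((H ^ 2 + 1) * ε) : ℝ≥0) : ℝ≥0∞) :=
        ENNReal.continuous_coe.comp (by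
          have := NNReal.sqrt.continuous
          fun_prop)
      have h0 := this.tendsto 0
      simp only [mul_zero, NNReal.sqrt_zero, add_zero, ENNReal.coe_zero] at h0
      exact h0.mono_left nhdsWithin_le_nhds
    exact ge_of_tendsto hc (eventually_mem_nhdsWithin.mono fun ε hε => key ε hε)
  have : D = 0 := by simpa using hD0
  exact sub_eq_zero.1 this

end RieszFourier

section Parseval

local instance : MeasureSpace UnitAddCircle := ⟨AddCircle.haarAddCircle⟩

local instance : IsProbabilityMeasure (volume : Measure UnitAddCircle) :=
  inferInstanceAs (IsProbabilityMeasure AddCircle.haarAddCircle)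

/-- The character `ξ ↦ e^{2πi ξ·k}` of the torus. -/
def latticeChar {d : ℕ} (k : Fin d → ℤ) (ξ : Fin d → ℝ) : ℂ :=
  Complex.exp (((2 * Real.pi * ∑ i, ξ i * (k i : ℝ) : ℝ)) * Complex.I)

variable {d : ℕ}

theorem continuous_latticeChar (k : Fin d → ℤ) : Continuous (latticeChar k) := by
  unfold latticeChar
  fun_prop

theorem norm_latticeChar (k : Fin d → ℤ) (ξ : Fin d → ℝ) : ‖latticeChar k ξ‖ = 1 :=
  Complex.norm_exp_ofReal_mul_I _

theorem latticeChar_add (k l : Fin d → ℤ) (ξ : Fin d → ℝ) :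
    latticeChar (k + l) ξ = latticeChar k ξ * latticeChar l ξ := by
  simp only [latticeChar, ← Complex.exp_add, ← add_mul, ← Complex.ofReal_add, ← mul_add,
    ← Finset.sum_add_distrib, Pi.add_apply, Int.cast_add]

theorem mFourier_coe (k : Fin d → ℤ) (ξ : Fin d → ℝ) :
    UnitAddTorus.mFourier k (fun i => (ξ i : UnitAddCircle)) = latticeChar k ξ := by
  simp only [UnitAddTorus.mFourier, ContinuousMap.coe_mk, fourier_coe_apply, latticeChar,
    ← Complex.exp_sum]
  congr 1
  push_cast
  rw [Finset.mul_sum, Finset.sum_mul]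
  refine Finset.sum_congr rfl fun i _ => ?_
  ring

theorem centeredCube_ae_eq : (centeredCube d : Set (Fin d → ℝ)) =ᵐ[volume]
    {x : Fin d → ℝ | ∀ i, x i ∈ Ioc ((fun _ => -(1 / 2) : Fin d → ℝ) i)
      ((fun _ => -(1 / 2) : Fin d → ℝ) i + 1)} := by
  have h1 := Measure.univ_pi_Ioo_ae_eq_Icc (μ := fun _ : Fin d => (volume : Measure ℝ))
    (f := fun _ => -(1 / 2)) (g := fun _ => 1 / 2)
  have h2 := Measure.univ_pi_Ioc_ae_eq_Icc (μ := fun _ : Fin d => (volume : Measure ℝ))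
    (f := fun _ => -(1 / 2)) (g := fun _ => 1 / 2)
  have h3 : {x : Fin d → ℝ | ∀ i, x i ∈ Ioc ((fun _ => -(1 / 2) : Fin d → ℝ) i)
      ((fun _ => -(1 / 2) : Fin d → ℝ) i + 1)} =
      Set.univ.pi fun _ => Set.Ioc (-(1/2) : ℝ) (1/2) := by
    ext x
    norm_num [Set.mem_pi]
  rw [h3]
  exact h1.trans h2.symm

/-- Parseval's identity for the Fourier coefficients over the centered cube. -/
theorem hasSum_mul_latticeChar {A B : (Fin d → ℝ) → ℂ} (hA : Measurable A) (hB : Measurable B)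
    {M : ℝ} (hAM : ∀ ξ, ‖A ξ‖ ≤ M) (hBM : ∀ ξ, ‖B ξ‖ ≤ M) :
    HasSum (fun l : Fin d → ℤ => (∫ ξ in centeredCube d, latticeChar (-l) ξ * A ξ) *
      ∫ ξ in centeredCube d, latticeChar l ξ * B ξ) (∫ ξ in centeredCube d, A ξ * B ξ) := by
  set a : Fin d → ℝ := fun _ => -(1 / 2) with ha
  set p : UnitAddTorus (Fin d) → (Fin d → ℝ) := fun t => (UnitAddTorus.measurableEquivPiIoc a t).1
    with hp
  have hpm : Measurable p :=
    measurable_subtype_coe.comp (UnitAddTorus.measurableEquivPiIoc a).measurable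
  have hpx : ∀ x : Fin d → ℝ, (∀ i, x i ∈ Ioc (a i) (a i + 1)) →
      p (fun i => (x i : UnitAddCircle)) = x := fun x hx => by
    have := (UnitAddTorus.measurableEquivPiIoc a).apply_symm_apply ⟨x, hx⟩
    exact congrArg Subtype.val this
  have hmeas : MeasurableSet {x : Fin d → ℝ | ∀ i, x i ∈ Ioc (a i) (a i + 1)} :=
    MeasurableSet.univ_pi' fun i => measurableSet_Ioc
  have hint : ∀ F : UnitAddTorus (Fin d) → ℂ, ∀ G : (Fin d → ℝ) → ℂ,
      (∀ x : Fin d → ℝ, (∀ i, x i ∈ Ioc (a i) (a i + 1)) →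
        F (fun i => (x i : UnitAddCircle)) = G x) → ∫ t, F t = ∫ ξ in centeredCube d, G ξ := by
    intro F G h
    rw [UnitAddTorus.integral_preimage F a, setIntegral_congr_set centeredCube_ae_eq]
    exact setIntegral_congr_fun hmeas fun x hx => h x hx
  have hmem : ∀ {u : (Fin d → ℝ) → ℂ}, Measurable u → (∀ ξ, ‖u ξ‖ ≤ M) →
      MemLp (fun t => u (p t)) 2 (volume : Measure (UnitAddTorus (Fin d))) := fun hu hM =>
    .of_bound (hu.comp hpm).aestronglyMeasurable M (.of_forall fun t => hM _)
  have hA' := hmem (u := fun ξ => (starRingEnd ℂ) (A ξ)) (Complex.continuous_conj.measurable.comp hA)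
    (by simpa using hAM)
  have hB' := hmem hB hBM
  have key := UnitAddTorus.hasSum_prod_mFourierCoeff (hA'.toLp) (hB'.toLp)
  have hcoef : ∀ {u : UnitAddTorus (Fin d) → ℂ} (hu : MemLp u 2) n,
      UnitAddTorus.mFourierCoeff (hu.toLp u) n = ∫ t, UnitAddTorus.mFourier (-n) t * u t :=
    fun hu n => integral_congr_ae (by
      filter_upwards [hu.coeFn_toLp] with t ht
      rw [ht, smul_eq_mul])
  have hlim : ∫ t, (starRingEnd ℂ) (hA'.toLp _ t) * hB'.toLp _ t = ∫ ξ in centeredCube d, A ξ * B ξ := by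
    rw [← hint (fun t => A (p t) * B (p t)) _ fun x hx => by simp only [hpx x hx]]
    refine integral_congr_ae ?_
    filter_upwards [hA'.coeFn_toLp, hB'.coeFn_toLp] with t h1 h2
    simp [h1, h2]
  rw [hlim, ← (Equiv.neg _).hasSum_iff] at key
  refine key.congr_fun fun l => ?_
  simp only [Function.comp_apply, Equiv.neg_apply, hcoef, neg_neg, ← integral_conj]
  congr 1
  · refine (hint _ _ fun x hx => ?_).symm
    rw [map_mul, ← UnitAddTorus.mFourier_neg, mFourier_coe]
    simp [hpx x hx]
  · refine (hint _ _ fun x hx => ?_).symm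
    rw [mFourier_coe, hpx x hx]

end Parseval

section SchwartzFourier

open scoped FourierTransform ContDiff

variable {d : ℕ}

theorem IsSchwartz.integrable {f : (Fin d → ℝ) → ℂ} (hf : IsSchwartz f) : Integrable f := by
  obtain ⟨Φ, hΦ⟩ := hf
  exact Φ.integrable.congr (.of_forall fun x => (hΦ x).symm)

theorem IsSchwartz.contDiff {f : (Fin d → ℝ) → ℂ} (hf : IsSchwartz f) : ContDiff ℝ ∞ f := by
  obtain ⟨Φ, hΦ⟩ := hf
  rw [show f = Φ from funext hΦ]
  exact Φ.smooth ⊤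

theorem IsSchwartz.continuous {f : (Fin d → ℝ) → ℂ} (hf : IsSchwartz f) : Continuous f :=
  hf.contDiff.continuous

theorem IsSchwartz.exists_schwartzMap {f : (Fin d → ℝ) → ℂ} (hf : IsSchwartz f) :
    ∃ Φ : SchwartzMap (EuclideanSpace ℝ (Fin d)) ℂ, ∀ x, f x.ofLp = Φ x := by
  obtain ⟨Φ, hΦ⟩ := hf
  refine ⟨SchwartzMap.compCLMOfContinuousLinearEquiv ℂ
    (PiLp.continuousLinearEquiv 2 ℝ (fun _ : Fin d => ℝ)) Φ, fun x => ?_⟩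
  exact hΦ _

theorem IsSchwartz.ft {f : (Fin d → ℝ) → ℂ} (hf : IsSchwartz f) : IsSchwartz (ft f) := by
  obtain ⟨Φ, hΦ⟩ := hf.exists_schwartzMap
  refine ⟨SchwartzMap.compCLMOfContinuousLinearEquiv ℂ
    (PiLp.continuousLinearEquiv 2 ℝ (fun _ : Fin d => ℝ)).symm (𝓕 Φ), fun x => ?_⟩
  rw [ft_eq_fourier, funext hΦ]
  simp [SchwartzMap.fourier_coe]

theorem IsSchwartz.conj {f : (Fin d → ℝ) → ℂ} (hf : IsSchwartz f) :
    IsSchwartz fun x => (starRingEnd ℂ) (f x) := by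
  obtain ⟨Φ, hΦ⟩ := hf
  refine ⟨SchwartzMap.postcompCLM (𝕜 := ℝ) (Complex.conjCLE : ℂ →L[ℝ] ℂ) Φ, fun x => ?_⟩
  simp [hΦ]

/-- Fourier inversion, in the form used for sampling. -/
theorem IsSchwartz.ft_conj_ft {f : (Fin d → ℝ) → ℂ} (hf : IsSchwartz f) (y : Fin d → ℝ) :
    AffinePaper.ft (fun ξ => (starRingEnd ℂ) (AffinePaper.ft f ξ)) y = (starRingEnd ℂ) (f y) := by
  obtain ⟨Φ, hΦ⟩ := hf.exists_schwartzMap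
  have h1 : (𝓕⁻ (𝓕 Φ) : SchwartzMap (EuclideanSpace ℝ (Fin d)) ℂ) (WithLp.toLp 2 y) = f y := by
    rw [FourierTransform.fourierInv_fourier_eq, ← hΦ]
  rw [← h1, SchwartzMap.fourierInv_coe, Real.fourierInv_eq', ← integral_conj, AffinePaper.ft,
    ← (PiLp.volume_preserving_toLp (Fin d)).integral_comp
    (MeasurableEquiv.toLp 2 (Fin d → ℝ)).measurableEmbedding]
  refine integral_congr_ae (.of_forall fun ξ => ?_)
  simp only [ft_eq_fourier, funext hΦ, SchwartzMap.fourier_coe, smul_eq_mul, map_mul,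
    ← Complex.exp_conj, Complex.conj_ofReal, Complex.conj_I]
  congr 2
  simp only [dotP, PiLp.inner_apply, RCLike.inner_apply, conj_trivial]
  push_cast
  ring

theorem IsSchwartz.integral_ft {f : (Fin d → ℝ) → ℂ} (hf : IsSchwartz f) :
    ∫ ξ, AffinePaper.ft f ξ = f 0 := by
  have h := hf.ft_conj_ft 0
  rw [AffinePaper.ft] at h
  simp only [dotP, Pi.zero_apply, zero_mul, Finset.sum_const_zero, mul_zero, neg_zero,
    Complex.ofReal_zero, Complex.exp_zero, one_mul] at h
  rw [integral_conj] at h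
  exact (starRingEnd ℂ).injective h

theorem IsCutoff.hasCompactSupport_comp {ν : (Fin d → ℝ) → ℝ} (hν : IsCutoff d ν)
    {b : Matrix (Fin d) (Fin d) ℝ} (hb : b.det ≠ 0) :
    HasCompactSupport fun u : Fin d → ℝ => ν (u ᵥ* b) := by
  have hc : HasCompactSupport ν := by
    refine Metric.isCompact_of_isClosed_isBounded (isClosed_tsupport _) (.subset ?_ hν.supp)
    exact Bornology.IsBounded.pi fun _ => Metric.isBounded_Ioo _ _
  have hu : IsUnit b.det := hb.isUnit
  let e : (Fin d → ℝ) ≃ₜ (Fin d → ℝ) :=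
    { toFun := fun u => u ᵥ* b
      invFun := fun u => u ᵥ* b⁻¹
      left_inv := fun u => by simp [Matrix.vecMul_vecMul, Matrix.mul_nonsing_inv _ hu]
      right_inv := fun u => by simp [Matrix.vecMul_vecMul, Matrix.nonsing_inv_mul _ hu]
      continuous_toFun := by fun_prop
      continuous_invFun := by fun_prop }
  exact hc.comp_homeomorph e

theorem IsCutoff.isSchwartz_mul {ν : (Fin d → ℝ) → ℝ} (hν : IsCutoff d ν)
    {b : Matrix (Fin d) (Fin d) ℝ} (hb : b.det ≠ 0) {θ : (Fin d → ℝ) → ℂ} (hθ : IsSchwartz θ) :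
    IsSchwartz fun u => θ u * (ν (u ᵥ* b) : ℂ) := by
  have hs : HasCompactSupport fun u : Fin d → ℝ => θ u * (ν (u ᵥ* b) : ℂ) :=
    ((hν.hasCompactSupport_comp hb).comp_left (g := fun t : ℝ => (t : ℂ)) (by simp)).mul_left
  refine ⟨hs.toSchwartzMap (hθ.contDiff.mul ?_), fun x => rfl⟩
  have h1 : ContDiff ℝ ∞ fun u : Fin d → ℝ => u ᵥ* b :=
    (Matrix.vecMulLinear b).toContinuousLinearMap.contDiff
  exact Complex.ofRealCLM.contDiff.comp (hν.smooth.comp h1)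

end SchwartzFourier

section Dilation

variable {d : ℕ}

theorem integral_dilate {a : ℝ} (ha : a ≠ 0) (G : (Fin d → ℝ) → ℂ) :
    ∫ η, ((|a| ^ d : ℝ) : ℂ)⁻¹ * G (a⁻¹ • η) = ∫ u, G u := by
  rw [integral_const_mul, Measure.integral_comp_smul]
  have : ((|a| ^ d : ℝ) : ℂ) ≠ 0 := by exact_mod_cast pow_ne_zero _ (abs_ne_zero.2 ha)
  simp only [Module.finrank_fin_fun, inv_pow, inv_inv, abs_pow, Complex.real_smul]
  rw [inv_mul_cancel_left₀ this]

theorem integral_comp_vecMul_inv {b : Matrix (Fin d) (Fin d) ℝ} (hb : b.det ≠ 0)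
    (G : (Fin d → ℝ) → ℂ) : ∫ ξ, G (ξ ᵥ* b⁻¹) = (|b.det| : ℝ) * ∫ u, G u := by
  have hu : IsUnit b.det := hb.isUnit
  have hdet : (bᵀ).det ≠ 0 := by rwa [Matrix.det_transpose]
  have hmap := Real.map_matrix_volume_pi_eq_smul_volume_pi hdet
  let e : (Fin d → ℝ) ≃ₜ (Fin d → ℝ) :=
    { toFun := fun u => u ᵥ* b
      invFun := fun u => u ᵥ* b⁻¹
      left_inv := fun u => by simp [Matrix.vecMul_vecMul, Matrix.mul_nonsing_inv _ hu]
      right_inv := fun u => by simp [Matrix.vecMul_vecMul, Matrix.nonsing_inv_mul _ hu]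
      continuous_toFun := by fun_prop
      continuous_invFun := by fun_prop }
  have he : (Matrix.toLin' bᵀ : (Fin d → ℝ) → (Fin d → ℝ)) = e := by
    ext1 u
    simp [e, Matrix.mulVec_transpose]
  rw [he] at hmap
  have h := e.measurableEmbedding.integral_map (μ := volume) fun ξ => G (ξ ᵥ* b⁻¹)
  rw [hmap, integral_smul_measure, Matrix.det_transpose] at h
  have h2 : ∀ u, (e u) ᵥ* b⁻¹ = u := e.left_inv
  simp only [h2] at h
  rw [← h, abs_inv, ENNReal.toReal_ofReal (by positivity), Complex.real_smul, Complex.ofReal_inv,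
    mul_inv_cancel_left₀]
  exact_mod_cast abs_ne_zero.2 hb

/-- The function whose Fourier transform is `x ↦ ft θ (a x - b k)`. -/
def dilMod (a : ℝ) (b : Matrix (Fin d) (Fin d) ℝ) (θ : (Fin d → ℝ) → ℂ) (k : Fin d → ℤ)
    (η : Fin d → ℝ) : ℂ :=
  ((|a| ^ d : ℝ) : ℂ)⁻¹ * (θ (a⁻¹ • η) *
    Complex.exp ((2 * Real.pi * dotP (b *ᵥ intVec k) (a⁻¹ • η) : ℝ) * Complex.I))

theorem ft_dilMod {a : ℝ} (ha : a ≠ 0) (b : Matrix (Fin d) (Fin d) ℝ) (θ : (Fin d → ℝ) → ℂ)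
    (k : Fin d → ℤ) (x : Fin d → ℝ) :
    ft (dilMod a b θ k) x = ft θ (a • x - b *ᵥ intVec k) := by
  rw [ft, ft]
  refine Eq.trans (integral_congr_ae (.of_forall fun η => ?_)) (integral_dilate ha _)
  simp only [dilMod]
  have : dotP (a • x - b *ᵥ intVec k) (a⁻¹ • η) =
      dotP x η - dotP (b *ᵥ intVec k) (a⁻¹ • η) := by
    simp only [dotP, ← Finset.sum_sub_distrib, Pi.sub_apply, Pi.smul_apply, smul_eq_mul]
    refine Finset.sum_congr rfl fun i _ => ?_
    field_simp
  rw [this, show ((-(2 * Real.pi * (dotP x η - dotP (b *ᵥ intVec k) (a⁻¹ • η))) : ℝ) : ℂ) *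
      Complex.I = ((-(2 * Real.pi * dotP x η) : ℝ) : ℂ) * Complex.I +
      ((2 * Real.pi * dotP (b *ᵥ intVec k) (a⁻¹ • η) : ℝ) : ℂ) * Complex.I by push_cast; ring,
    Complex.exp_add]
  ring

theorem integral_mul_dilMod {a : ℝ} (ha : a ≠ 0) {b : Matrix (Fin d) (Fin d) ℝ} (hb : b.det ≠ 0)
    (θ H : (Fin d → ℝ) → ℂ) (k : Fin d → ℤ) :
    (|b.det| : ℝ) * ∫ η, H η * dilMod a b θ k η =
      ∫ ξ, latticeChar k ξ * (H (a • (ξ ᵥ* b⁻¹)) * θ (ξ ᵥ* b⁻¹)) := by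
  have hu : IsUnit b.det := hb.isUnit
  have h1 : ∫ η, H η * dilMod a b θ k η = ∫ u, Complex.exp
      ((2 * Real.pi * dotP (b *ᵥ intVec k) u : ℝ) * Complex.I) * (H (a • u) * θ u) := by
    refine Eq.trans (integral_congr_ae (.of_forall fun η => ?_)) (integral_dilate ha _)
    simp only [dilMod, smul_inv_smul₀ ha]
    ring
  rw [h1, ← integral_comp_vecMul_inv hb]
  refine integral_congr_ae (.of_forall fun ξ => ?_)
  have : dotP (b *ᵥ intVec k) (ξ ᵥ* b⁻¹) = ∑ i, ξ i * (k i : ℝ) := by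
    rw [dotP_comm]
    change (ξ ᵥ* b⁻¹) ⬝ᵥ (b *ᵥ intVec k) = _
    rw [Matrix.dotProduct_mulVec, Matrix.vecMul_vecMul, Matrix.nonsing_inv_mul _ hu,
      Matrix.vecMul_one]
    rfl
  simp only [this, latticeChar]

theorem integrable_dilMod {a : ℝ} (ha : a ≠ 0) (b : Matrix (Fin d) (Fin d) ℝ)
    {θ : (Fin d → ℝ) → ℂ} (hθ : Integrable θ) (k : Fin d → ℤ) : Integrable (dilMod a b θ k) := by
  refine Integrable.const_mul (Integrable.mul_bdd (c := 1)
    (hθ.comp_smul (inv_ne_zero ha)) ?_ (.of_forall fun η => (Complex.norm_exp_ofReal_mul_I _).le)) _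
  refine Continuous.aestronglyMeasurable ?_
  simp only [dotP]
  fun_prop

theorem integrable_comp_smul_sub {E : Type*} [NormedAddCommGroup E] {a : ℝ} (ha : a ≠ 0)
    {Θ : (Fin d → ℝ) → E} (hΘ : Integrable Θ) (y : Fin d → ℝ) :
    Integrable fun x => Θ (a • x - y) :=
  (hΘ.comp_sub_right y).comp_smul ha

end Dilation

section Sampling

variable {d : ℕ}

/-- The weighted samples `|det b| ∫ Θ(a x - b k) g(x) dx`. -/
def sampAvg {E : Type*} [NormedAddCommGroup E] [NormedSpace ℂ E] (a : ℝ)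
    (b : Matrix (Fin d) (Fin d) ℝ) (Θ : (Fin d → ℝ) → ℂ) (g : (Fin d → ℝ) → E)
    (k : Fin d → ℤ) : E :=
  ((|b.det| : ℝ) : ℂ) • ∫ x, Θ (a • x - b *ᵥ intVec k) • g x

theorem TjH_eq_sampAvg (α : ℕ → ℝ) (b : Matrix (Fin d) (Fin d) ℝ) (φ f : (Fin d → ℝ) → ℂ)
    (j : ℕ) (k : Fin d → ℤ) :
    TjH α b φ f j k = sampAvg (α j) b (fun x => (starRingEnd ℂ) (φ x)) f k := by
  simp only [TjH, sampAvg, smul_eq_mul, mul_comm]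

theorem eucNorm_smul (a : ℝ) (u : Fin d → ℝ) : eucNorm (a • u) = |a| * eucNorm u := by
  simp only [eucNorm, Pi.smul_apply, smul_eq_mul, mul_pow, ← Finset.mul_sum]
  rw [Real.sqrt_mul (sq_nonneg a), Real.sqrt_sq_eq_abs]

theorem rieszMul_smul (i : Fin d) (a : ℝ) (u : Fin d → ℝ) :
    rieszMul i (a • u) = ((a / |a| : ℝ) : ℂ) * rieszMul i u := by
  have h : (a • u) i / eucNorm (a • u) = a / |a| * (u i / eucNorm u) := by
    rw [eucNorm_smul, Pi.smul_apply, smul_eq_mul, mul_div_mul_comm]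
  rw [rieszMul, rieszMul, h]
  push_cast
  ring

theorem zetaFn_apply (b : Matrix (Fin d) (Fin d) ℝ) (ν : (Fin d → ℝ) → ℝ) (ξ : Fin d → ℝ)
    (i : Fin d) : zetaFn b ν ξ i = rieszMul i (ξ ᵥ* b⁻¹) * (ν ξ : ℂ) := rfl

theorem volume_centeredCube_lt_top : volume (centeredCube d) < ⊤ :=
  (Bornology.IsBounded.pi fun _ => Metric.isBounded_Ioo _ _).measure_lt_top

theorem IsCutoff.exists_bound {ν : (Fin d → ℝ) → ℝ} (hν : IsCutoff d ν) :
    ∃ M : ℝ, ∀ ξ, ‖(ν ξ : ℂ)‖ ≤ M := by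
  have h := hν.hasCompactSupport_comp (b := 1) (by simp)
  simp only [Matrix.vecMul_one] at h
  obtain ⟨M, hM⟩ := h.exists_bound_of_continuous hν.smooth.continuous
  exact ⟨M, fun ξ => by simpa using hM ξ⟩

theorem norm_zetaFn_apply_le (b : Matrix (Fin d) (Fin d) ℝ) {ν : (Fin d → ℝ) → ℝ} {M : ℝ}
    (hM : ∀ ξ, ‖(ν ξ : ℂ)‖ ≤ M) (i : Fin d) (ξ : Fin d → ℝ) : ‖zetaFn b ν ξ i‖ ≤ M := by
  rw [zetaFn_apply, norm_mul]
  exact (mul_le_of_le_one_left (norm_nonneg _) (norm_rieszMul_le _ _)).trans (hM ξ)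

theorem IsCutoff.measurable_zetaFn {ν : (Fin d → ℝ) → ℝ} (hν : IsCutoff d ν)
    (b : Matrix (Fin d) (Fin d) ℝ) (i : Fin d) : Measurable fun ξ => zetaFn b ν ξ i := by
  simp only [zetaFn_apply]
  refine ((measurable_rieszMul i).comp ?_).mul
    (Complex.continuous_ofReal.comp hν.smooth.continuous).measurable
  exact Continuous.measurable (by fun_prop)

theorem IsCutoff.zKernel_apply {ν : (Fin d → ℝ) → ℝ} (hν : IsCutoff d ν)
    (b : Matrix (Fin d) (Fin d) ℝ) (l : Fin d → ℤ) (i : Fin d) :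
    zKernel b ν l i = ∫ ξ in centeredCube d, latticeChar l ξ * zetaFn b ν ξ i := by
  obtain ⟨M, hM⟩ := hν.exists_bound
  rw [zKernel, eval_integral]
  · rfl
  · intro i
    have : IsFiniteMeasure (volume.restrict (centeredCube d)) :=
      ⟨by simpa using volume_centeredCube_lt_top⟩
    refine Integrable.of_bound (C := M) ?_ (.of_forall fun ξ => ?_)
    · exact ((continuous_latticeChar l).measurable.mul
        (hν.measurable_zetaFn b i)).aestronglyMeasurable
    · change ‖latticeChar l ξ * zetaFn b ν ξ i‖ ≤ M
      rw [norm_mul, norm_latticeChar, one_mul]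
      exact norm_zetaFn_apply_le b hM i ξ

variable {b : Matrix (Fin d) (Fin d) ℝ} {φ f : (Fin d → ℝ) → ℂ}

/-- Samples against a band-limited analyzer are Fourier coefficients over the unit cube. -/
theorem sampAvg_eq_setIntegral (hb : b.det ≠ 0) {a : ℝ} (ha : a ≠ 0) (hφS : IsSchwartz φ)
    (hφsupp : Function.support (ft φ) ⊆ {ξ : Fin d → ℝ | ξ ᵥ* b ∈ centeredCube d})
    (hf : Integrable f) (k : Fin d → ℤ) :
    sampAvg a b (fun x => (starRingEnd ℂ) (φ x)) f k =
      ∫ ξ in centeredCube d, latticeChar k ξ *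
        (ft f (a • (ξ ᵥ* b⁻¹)) * (starRingEnd ℂ) (ft φ (ξ ᵥ* b⁻¹))) := by
  have hθ := hφS.ft.conj.integrable
  rw [sampAvg, smul_eq_mul, setIntegral_eq_integral_of_forall_compl_eq_zero,
    ← integral_mul_dilMod ha hb (fun u => (starRingEnd ℂ) (ft φ u)),
    integral_ft_mul hf (integrable_dilMod ha b hθ k)]
  · congr 1
    refine integral_congr_ae (.of_forall fun x => ?_)
    simp only [ft_dilMod ha, hφS.ft_conj_ft, smul_eq_mul, mul_comm]
  · intro ξ hξ
    have : ft φ (ξ ᵥ* b⁻¹) = 0 := by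
      by_contra h
      have := hφsupp h
      rw [mem_ofPred_eq, Matrix.vecMul_vecMul, Matrix.nonsing_inv_mul _ hb.isUnit,
        Matrix.vecMul_one] at this
      exact hξ this
    simp [this]

/-- The discrete Riesz transform of the samples of `f` is a sequence of samples of the Riesz
transform of `f`. -/
theorem dConv_sampAvg (hb : b.det ≠ 0) {a : ℝ} (ha : a ≠ 0) (hφS : IsSchwartz φ)
    (hφsupp : Function.support (ft φ) ⊆ {ξ : Fin d → ℝ | ξ ᵥ* b ∈ centeredCube d})
    {ν : (Fin d → ℝ) → ℝ} (hν : IsCutoff d ν) (hf : Integrable f)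
    {g : (Fin d → ℝ) → Fin d → ℂ} (hg : Integrable g) (hR : HasRiesz f g) (k : Fin d → ℤ) :
    dConv (sampAvg a b (fun x => (starRingEnd ℂ) (φ x)) f) (zKernel b ν) k =
      ((a / |a| : ℝ) : ℂ) • sampAvg a b
        (ft fun u => (starRingEnd ℂ) (ft φ u) * (ν (u ᵥ* b) : ℂ)) g k := by
  set θ : (Fin d → ℝ) → ℂ := fun u => (starRingEnd ℂ) (ft φ u) * (ν (u ᵥ* b) : ℂ) with hθdef
  have hθS : IsSchwartz θ := hν.isSchwartz_mul hb hφS.ft.conj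
  obtain ⟨M, hM⟩ := hν.exists_bound
  set S : (Fin d → ℝ) → ℂ := fun ξ =>
    ft f (a • (ξ ᵥ* b⁻¹)) * (starRingEnd ℂ) (ft φ (ξ ᵥ* b⁻¹)) with hS
  have hSc : Continuous S := by
    have h1 : Continuous fun ξ : Fin d → ℝ => ξ ᵥ* b⁻¹ := by fun_prop
    exact ((continuous_ft hf).comp (h1.const_smul a)).mul
      (Complex.continuous_conj.comp (hφS.ft.continuous.comp h1))
  have hSM : ∀ ξ, ‖S ξ‖ ≤ (∫ x, ‖f x‖) * ∫ x, ‖φ x‖ := fun ξ => by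
    rw [hS, norm_mul, RCLike.norm_conj]
    gcongr
    exacts [norm_ft_le _ _, norm_ft_le _ _]
  have hu : IsUnit b.det := hb.isUnit
  have hcoord : ∀ i, HasSum (fun l : Fin d → ℤ =>
      sampAvg a b (fun x => (starRingEnd ℂ) (φ x)) f (k - l) * zKernel b ν l i)
      (((a / |a| : ℝ) : ℂ) * sampAvg a b (ft θ) g k i) := by
    intro i
    have hP := hasSum_mul_latticeChar (A := fun ξ => latticeChar k ξ * S ξ)
      (B := fun ξ => zetaFn b ν ξ i) ((continuous_latticeChar k).mul hSc).measurable
      (hν.measurable_zetaFn b i) (M := max ((∫ x, ‖f x‖) * ∫ x, ‖φ x‖) M)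
      (fun ξ => by
        rw [norm_mul, norm_latticeChar, one_mul]
        exact (hSM ξ).trans (le_max_left _ _))
      (fun ξ => (norm_zetaFn_apply_le b hM i ξ).trans (le_max_right _ _))
    have hcoef : ∀ l : Fin d → ℤ, sampAvg a b (fun x => (starRingEnd ℂ) (φ x)) f (k - l) =
        ∫ ξ in centeredCube d, latticeChar (-l) ξ * (latticeChar k ξ * S ξ) := fun l => by
      rw [sampAvg_eq_setIntegral hb ha hφS hφsupp hf]
      refine integral_congr_ae (.of_forall fun ξ => ?_)
      simp only [hS]
      rw [sub_eq_neg_add, latticeChar_add]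
      ring
    simp only [hcoef, hν.zKernel_apply]
    convert hP using 1
    have hI := integral_mul_dilMod ha hb θ (fun η => ((a / |a| : ℝ) : ℂ) * (ft f η * rieszMul i η)) k
    have hW := integrable_dilMod ha b hθS.integrable k
    have hW' : Integrable (ft (dilMod a b θ k)) := by
      rw [show ft (dilMod a b θ k) = fun x => ft θ (a • x - b *ᵥ intVec k) from
        funext (ft_dilMod ha b θ k)]
      exact integrable_comp_smul_sub ha hθS.ft.integrable _
    have hRm := integral_riesz_mul_ft hf hg hR hW hW' i
    rw [setIntegral_eq_integral_of_forall_compl_eq_zero (fun ξ hξ => ?_)]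
    · refine Eq.trans ?_ (hI.trans (integral_congr_ae (.of_forall fun ξ => ?_)))
      · simp only [mul_assoc] at hRm ⊢
        rw [integral_const_mul, ← hRm, sampAvg, Pi.smul_apply, smul_eq_mul, eval_integral]
        · simp only [ft_dilMod ha, Pi.smul_apply, smul_eq_mul, mul_comm, mul_left_comm]
        · intro i
          obtain ⟨C, hC⟩ : ∃ C, ∀ x, ‖ft θ x‖ ≤ C := ⟨_, norm_ft_le θ⟩
          refine (hg.eval i).bdd_mul (c := C) ?_ (.of_forall fun x => hC _)
          exact Continuous.aestronglyMeasurable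
            (hθS.ft.continuous.comp (by fun_prop))
      · simp only [rieszMul_smul, zetaFn_apply, hθdef, hS, Matrix.vecMul_vecMul,
          Matrix.nonsing_inv_mul _ hu, Matrix.vecMul_one]
        have hs : ((a / |a| : ℝ) : ℂ) * ((a / |a| : ℝ) : ℂ) = 1 := by
          rw [← Complex.ofReal_mul, div_mul_div_comm, abs_mul_abs_self,
            div_self (mul_self_ne_zero.2 ha), Complex.ofReal_one]
        linear_combination (latticeChar k ξ * ft f (a • (ξ ᵥ* b⁻¹)) * rieszMul i (ξ ᵥ* b⁻¹) *
          (starRingEnd ℂ) (ft φ (ξ ᵥ* b⁻¹)) * (ν ξ : ℂ)) * hs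
    · have : ν ξ = 0 := by
        by_contra h
        exact hξ (hν.supp (subset_tsupport _ h))
      simp [zetaFn_apply, this]
  rw [dConv]
  refine HasSum.tsum_eq (Pi.hasSum.2 fun i => ?_)
  simpa using hcoord i

end Sampling

section LatticeSums

variable {d : ℕ}

/-- The coordinatewise integer part. -/
def floorVec (w : Fin d → ℝ) : Fin d → ℤ := fun i => ⌊w i⌋

theorem measurable_floorVec : Measurable (floorVec : (Fin d → ℝ) → Fin d → ℤ) :=
  measurable_pi_lambda _ fun i => Int.measurable_floor.comp (measurable_pi_apply i)

theorem norm_sub_floorVec_le (w : Fin d → ℝ) : ‖w - intVec (floorVec w)‖ ≤ 1 := by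
  refine (pi_norm_le_iff_of_nonneg zero_le_one).2 fun i => ?_
  simp only [Pi.sub_apply, intVec, floorVec, Real.norm_eq_abs, Int.self_sub_floor]
  rw [abs_of_nonneg (Int.fract_nonneg (w i))]
  exact (Int.fract_lt_one _).le

/-- A sum over the integer lattice as the integral of a step function. -/
theorem lintegral_comp_floorVec (H : (Fin d → ℤ) → ℝ≥0∞) :
    ∫⁻ w : Fin d → ℝ, H (floorVec w) = ∑' k, H k := by
  rw [← lintegral_map (Measurable.of_discrete (f := H)) measurable_floorVec, lintegral_countable']
  refine tsum_congr fun k => ?_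
  rw [Measure.map_apply measurable_floorVec (measurableSet_singleton k)]
  have : floorVec ⁻¹' {k} = Set.univ.pi fun i => Set.Ico (k i : ℝ) (k i + 1) := by
    ext w
    simp [floorVec, funext_iff, Int.floor_eq_iff]
  rw [this, Real.volume_pi_Ico]
  simp

theorem lintegral_comp_mulVec {M : Matrix (Fin d) (Fin d) ℝ} (hM : M.det ≠ 0)
    {H : (Fin d → ℝ) → ℝ≥0∞} (hH : Measurable H) :
    ∫⁻ w, H (M *ᵥ w) = ENNReal.ofReal |M.det⁻¹| * ∫⁻ u, H u := by
  rw [← smul_eq_mul, ← lintegral_smul_measure, ← Real.map_matrix_volume_pi_eq_smul_volume_pi hM,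
    lintegral_map hH]
  · simp
  · exact (Matrix.toLin' M).continuous_of_finiteDimensional.measurable

theorem exists_norm_mulVec_le (b : Matrix (Fin d) (Fin d) ℝ) :
    ∃ B : ℝ, 0 ≤ B ∧ ∀ v, ‖v‖ ≤ 1 → ‖b *ᵥ v‖ ≤ B := by
  set L := (Matrix.mulVecLin b).toContinuousLinearMap
  exact ⟨‖L‖, norm_nonneg _, fun v hv =>
    (L.le_opNorm v).trans (mul_le_of_le_one_right (norm_nonneg _) hv)⟩

theorem IsSchwartz.exists_norm_le {Θ : (Fin d → ℝ) → ℂ} (hΘ : IsSchwartz Θ) (n : ℕ) :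
    ∃ C : ℝ, 0 ≤ C ∧ ∀ x, ‖Θ x‖ ≤ C * (1 + ‖x‖) ^ (-(n : ℝ)) := by
  obtain ⟨Φ, hΦ⟩ := hΘ
  refine ⟨2 ^ n * ((Finset.Iic (n, 0)).sup fun m => SchwartzMap.seminorm ℝ m.1 m.2) Φ,
    by positivity, fun x => ?_⟩
  have h := SchwartzMap.one_add_le_sup_seminorm_apply (𝕜 := ℝ) (m := (n, 0)) (k := n) (n := 0)
    le_rfl le_rfl Φ x
  rw [norm_iteratedFDeriv_zero, mul_comm] at h
  rw [hΦ, Real.rpow_neg (by positivity), Real.rpow_natCast, ← div_eq_mul_inv]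
  exact (le_div_iff₀ (by positivity)).2 h

/-- The lattice translates of a Schwartz function have a bounded absolute sum. -/
theorem IsSchwartz.exists_tsum_enorm_le {Θ : (Fin d → ℝ) → ℂ} (hΘ : IsSchwartz Θ)
    {b : Matrix (Fin d) (Fin d) ℝ} (hb : b.det ≠ 0) :
    ∃ C : ℝ≥0, ∀ y, ∑' k : Fin d → ℤ, ‖Θ (y - b *ᵥ intVec k)‖ₑ ≤ C := by
  obtain ⟨C, hC0, hC⟩ := hΘ.exists_norm_le (d + 1)
  obtain ⟨B, hB0, hB⟩ := exists_norm_mulVec_le b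
  set r : ℝ := ((d + 1 : ℕ) : ℝ) with hr
  have hI : ∫⁻ u : Fin d → ℝ, ENNReal.ofReal ((1 + ‖u‖) ^ (-r)) < ⊤ :=
    finite_integral_one_add_norm (by simp [hr])
  have hfin : ENNReal.ofReal (C * (1 + B) ^ r) * (ENNReal.ofReal |b.det⁻¹| *
      ∫⁻ u : Fin d → ℝ, ENNReal.ofReal ((1 + ‖u‖) ^ (-r))) ≠ ⊤ :=
    ENNReal.mul_ne_top (by simp) (ENNReal.mul_ne_top (by simp) hI.ne)
  refine ⟨_, fun y => le_of_le_of_eq ?_ (ENNReal.coe_toNNReal hfin).symm⟩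
  rw [← lintegral_comp_floorVec, ← lintegral_sub_left_eq_self
    (fun u => ENNReal.ofReal ((1 + ‖u‖) ^ (-r))) y, ← lintegral_comp_mulVec hb
    (H := fun u => ENNReal.ofReal ((1 + ‖y - u‖) ^ (-r))) (by fun_prop),
    ← lintegral_const_mul' _ _ (by simp)]
  refine lintegral_mono fun w => ?_
  rw [← ENNReal.ofReal_mul (by positivity), ← ofReal_norm]
  refine ENNReal.ofReal_le_ofReal ((hC _).trans ?_)
  rw [mul_assoc]
  gcongr
  have h1 : ‖y - b *ᵥ w‖ ≤ ‖y - b *ᵥ intVec (floorVec w)‖ + B := by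
    have : y - b *ᵥ w = (y - b *ᵥ intVec (floorVec w)) - b *ᵥ (w - intVec (floorVec w)) := by
      rw [Matrix.mulVec_sub]
      abel
    rw [this]
    exact (norm_sub_le _ _).trans (by gcongr; exact hB _ (norm_sub_floorVec_le w))
  have h2 : 1 + ‖y - b *ᵥ w‖ ≤ (1 + B) * (1 + ‖y - b *ᵥ intVec (floorVec w)‖) := by
    nlinarith [norm_nonneg (y - b *ᵥ intVec (floorVec w))]
  rw [Real.rpow_neg (by positivity), Real.rpow_neg (by positivity), ← div_eq_mul_inv,
    inv_eq_one_div, div_le_div_iff₀ (by positivity) (by positivity), one_mul,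
    ← Real.mul_rpow (by positivity) (by positivity)]
  exact Real.rpow_le_rpow (by positivity) h2 (by positivity)

end LatticeSums

section SampleBounds

variable {d : ℕ} {E : Type*} [NormedAddCommGroup E] [NormedSpace ℂ E]
  {b : Matrix (Fin d) (Fin d) ℝ} {Θ : (Fin d → ℝ) → ℂ}

/-- The `ℓ¹` norm of weighted samples is controlled by the `L¹` norm. -/
theorem tsum_enorm_sampAvg_le {C : ℝ≥0}
    (hC : ∀ y, ∑' k : Fin d → ℤ, ‖Θ (y - b *ᵥ intVec k)‖ₑ ≤ C) (hΘ : Continuous Θ) (a : ℝ)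
    {g : (Fin d → ℝ) → E} (hg : Integrable g) :
    ∑' k, ‖sampAvg a b Θ g k‖ₑ ≤ ENNReal.ofReal |b.det| * C * ∫⁻ x, ‖g x‖ₑ := by
  calc _ ≤ ∑' k : Fin d → ℤ, ENNReal.ofReal |b.det| *
        ∫⁻ x, ‖Θ (a • x - b *ᵥ intVec k)‖ₑ * ‖g x‖ₑ := by
        refine ENNReal.tsum_le_tsum fun k => ?_
        rw [sampAvg, enorm_smul, ← ofReal_norm, Complex.norm_real, norm_abs_eq_norm,
          Real.norm_eq_abs]
        gcongr
        refine (enorm_integral_le_lintegral_enorm _).trans_eq (lintegral_congr fun x => ?_)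
        rw [enorm_smul]
    _ = ENNReal.ofReal |b.det| *
        ∫⁻ x, ∑' k : Fin d → ℤ, ‖Θ (a • x - b *ᵥ intVec k)‖ₑ * ‖g x‖ₑ := by
        rw [ENNReal.tsum_mul_left, lintegral_tsum]
        intro k
        refine AEMeasurable.mul ?_ hg.1.enorm
        exact (Continuous.measurable (by fun_prop)).aemeasurable
    _ ≤ ENNReal.ofReal |b.det| * ∫⁻ x, C * ‖g x‖ₑ := by
        gcongr with x
        rw [ENNReal.tsum_mul_right]
        gcongr
        exact hC _
    _ = _ := by rw [lintegral_const_mul' _ _ (by simp), mul_assoc]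

theorem sampAvg_sub {C : ℝ} (hΘ : Continuous Θ) (hC : ∀ x, ‖Θ x‖ ≤ C) (a : ℝ)
    {g h : (Fin d → ℝ) → E} (hg : Integrable g) (hh : Integrable h) (k : Fin d → ℤ) :
    sampAvg a b Θ (fun x => g x - h x) k = sampAvg a b Θ g k - sampAvg a b Θ h k := by
  have hi : ∀ {u : (Fin d → ℝ) → E}, Integrable u →
      Integrable fun x => Θ (a • x - b *ᵥ intVec k) • u x := fun hu =>
    hu.bdd_smul C (Continuous.aestronglyMeasurable (by fun_prop)) (.of_forall fun x => hC _)
  simp only [sampAvg, smul_sub]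
  rw [integral_sub (hi hg) (hi hh), smul_sub]

theorem sampAvg_eq_rescaled {a : ℝ} (ha : a ≠ 0) (g : (Fin d → ℝ) → E) (k : Fin d → ℤ) :
    sampAvg a b Θ g k = ((|b.det| * (|a| ^ d)⁻¹ : ℝ) : ℂ) •
      ∫ u, Θ u • g (a⁻¹ • (u + b *ᵥ intVec k)) := by
  have h1 : ∫ x, Θ (a • x - b *ᵥ intVec k) • g x = ((|a| ^ d)⁻¹ : ℝ) •
      ∫ u, Θ (u - b *ᵥ intVec k) • g (a⁻¹ • u) := by
    have := Measure.integral_comp_smul (volume : Measure (Fin d → ℝ))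
      (fun u => Θ (u - b *ᵥ intVec k) • g (a⁻¹ • u)) a
    simp only [inv_smul_smul₀ ha, Module.finrank_fin_fun, abs_inv, abs_pow] at this
    exact this
  have h2 : ∫ u, Θ (u - b *ᵥ intVec k) • g (a⁻¹ • u) =
      ∫ u, Θ u • g (a⁻¹ • (u + b *ᵥ intVec k)) := by
    rw [← integral_add_right_eq_self _ (b *ᵥ intVec k)]
    simp
  rw [sampAvg, h1, h2, Complex.ofReal_mul, mul_smul]
  simp only [Complex.coe_smul]

/-- The step function with the values of the normalised samples. -/
theorem lintegral_rescaled_floorVec (hb : b.det ≠ 0) {a : ℝ} (ha : a ≠ 0) (g : (Fin d → ℝ) → E) :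
    ∫⁻ y, ‖∫ u, Θ u • g (a⁻¹ • (u + b *ᵥ intVec (floorVec ((a • b⁻¹) *ᵥ y))))‖ₑ =
      ∑' k, ‖sampAvg a b Θ g k‖ₑ := by
  have hM : (a • b⁻¹).det ≠ 0 := by
    rw [Matrix.det_smul, Matrix.det_nonsing_inv]
    exact mul_ne_zero (pow_ne_zero _ ha) (by simpa using hb)
  have hH : Measurable fun w : Fin d → ℝ =>
      ‖∫ u, Θ u • g (a⁻¹ • (u + b *ᵥ intVec (floorVec w)))‖ₑ :=
    (Measurable.of_discrete (f := fun k : Fin d → ℤ =>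
      ‖∫ u, Θ u • g (a⁻¹ • (u + b *ᵥ intVec k))‖ₑ)).comp measurable_floorVec
  rw [lintegral_comp_mulVec hM hH, lintegral_comp_floorVec
    (fun k => ‖∫ u, Θ u • g (a⁻¹ • (u + b *ᵥ intVec k))‖ₑ), ← ENNReal.tsum_mul_left]
  refine tsum_congr fun k => ?_
  rw [sampAvg_eq_rescaled ha, enorm_smul]
  congr 1
  rw [← ofReal_norm, Complex.norm_real, Real.norm_eq_abs]
  congr 1
  rw [Matrix.det_smul, Matrix.det_nonsing_inv, Ring.inverse_eq_inv', Fintype.card_fin, mul_inv,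
    inv_inv, abs_mul, abs_mul, abs_abs, abs_inv, abs_inv, abs_pow, abs_pow, abs_abs, mul_comm]

/-- For continuous functions of compact support the `L¹` norm is dominated by the limit of the
`ℓ¹` norms of the samples. -/
theorem lintegral_enorm_le_iSup_of_hasCompactSupport [CompleteSpace E] (hb : b.det ≠ 0) {α : ℕ → ℝ}
    (hα : ∀ j, α j ≠ 0) (hαtop : Tendsto (fun j => |α j|) atTop atTop) (hΘ : Integrable Θ)
    (hΘ1 : ∫ x, Θ x = 1) {g : (Fin d → ℝ) → E} (hg : Continuous g) (hgs : HasCompactSupport g) :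
    ∫⁻ x, ‖g x‖ₑ ≤ ⨆ j, ∑' k, ‖sampAvg (α j) b Θ g k‖ₑ := by
  obtain ⟨M, hM⟩ := hgs.exists_bound_of_continuous hg
  obtain ⟨B, hB0, hB⟩ := exists_norm_mulVec_le b
  set F : ℕ → (Fin d → ℝ) → E := fun j y =>
    ∫ u, Θ u • g ((α j)⁻¹ • (u + b *ᵥ intVec (floorVec ((α j • b⁻¹) *ᵥ y)))) with hF
  have hinv : Tendsto (fun j => (α j)⁻¹) atTop (𝓝 0) := by
    rw [tendsto_zero_iff_abs_tendsto_zero]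
    simpa [Function.comp_def, abs_inv] using tendsto_inv_atTop_zero.comp hαtop
  have hpt : ∀ y u, Tendsto (fun j => (α j)⁻¹ •
      (u + b *ᵥ intVec (floorVec ((α j • b⁻¹) *ᵥ y)))) atTop (𝓝 y) := by
    intro y u
    have hby : ∀ j, b *ᵥ ((α j • b⁻¹) *ᵥ y) = α j • y := fun j => by
      rw [Matrix.mulVec_mulVec, Matrix.mul_smul, Matrix.mul_nonsing_inv _ hb.isUnit,
        Matrix.smul_mulVec, Matrix.one_mulVec]
    have hy : ∀ j, (α j)⁻¹ • (u + b *ᵥ intVec (floorVec ((α j • b⁻¹) *ᵥ y))) - y = (α j)⁻¹ •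
        (u - b *ᵥ ((α j • b⁻¹) *ᵥ y - intVec (floorVec ((α j • b⁻¹) *ᵥ y)))) := fun j => by
      rw [Matrix.mulVec_sub, hby, ← sub_add, smul_add, smul_add, smul_sub,
        inv_smul_smul₀ (hα j)]
      abel
    rw [tendsto_iff_norm_sub_tendsto_zero]
    refine squeeze_zero (fun _ => norm_nonneg _) (g := fun j => |(α j)⁻¹| * (‖u‖ + B)) (fun j => ?_) ?_
    · rw [hy, norm_smul, Real.norm_eq_abs]
      gcongr
      exact (norm_sub_le _ _).trans (by gcongr; exact hB _ (norm_sub_floorVec_le _))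
    · simpa using hinv.abs.mul_const (‖u‖ + B)
  have hlim : ∀ y, Tendsto (fun j => F j y) atTop (𝓝 (g y)) := by
    intro y
    have h1 : ∫ u, Θ u • g y = g y := by rw [integral_smul_const, hΘ1, one_smul]
    rw [← h1]
    refine tendsto_integral_of_dominated_convergence (fun u => ‖Θ u‖ * M) (fun j => ?_)
      (hΘ.norm.mul_const M) (fun j => .of_forall fun u => ?_) (.of_forall fun u => ?_)
    · exact hΘ.1.smul (Continuous.aestronglyMeasurable (hg.comp (by fun_prop)))
    · rw [norm_smul]
      gcongr
      exact hM _
    · exact ((hg.tendsto y).comp (hpt y u)).const_smul _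
  have hFm : ∀ j, Measurable fun y => ‖F j y‖ₑ := fun j =>
    (Measurable.of_discrete (f := fun k : Fin d → ℤ =>
      ‖∫ u, Θ u • g ((α j)⁻¹ • (u + b *ᵥ intVec k))‖ₑ)).comp
      (measurable_floorVec.comp (Continuous.measurable (by fun_prop)))
  calc ∫⁻ x, ‖g x‖ₑ = ∫⁻ x, liminf (fun j => ‖F j x‖ₑ) atTop :=
        lintegral_congr fun x => (((hlim x).enorm).liminf_eq).symm
    _ ≤ liminf (fun j => ∫⁻ x, ‖F j x‖ₑ) atTop := lintegral_liminf_le hFm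
    _ ≤ ⨆ j, ∫⁻ x, ‖F j x‖ₑ :=
        (liminf_le_limsup).trans (limsup_le_iSup)
    _ = _ := iSup_congr fun j => lintegral_rescaled_floorVec hb (hα j) g

/-- The `L¹` norm is dominated by the supremum over scales of the `ℓ¹` norms of the samples. -/
theorem lintegral_enorm_le_iSup_sampAvg [CompleteSpace E] (hb : b.det ≠ 0) {α : ℕ → ℝ}
    (hα : ∀ j, α j ≠ 0) (hαtop : Tendsto (fun j => |α j|) atTop atTop) (hΘ : IsSchwartz Θ)
    (hΘ1 : ∫ x, Θ x = 1) {g : (Fin d → ℝ) → E} (hg : Integrable g) :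
    ∫⁻ x, ‖g x‖ₑ ≤ ⨆ j, ∑' k, ‖sampAvg (α j) b Θ g k‖ₑ := by
  obtain ⟨C, hC⟩ := hΘ.exists_tsum_enorm_le hb
  obtain ⟨C₀, hC₀⟩ : ∃ C₀ : ℝ, ∀ x, ‖Θ x‖ ≤ C₀ := by
    obtain ⟨C₀, -, h⟩ := hΘ.exists_norm_le 0
    exact ⟨C₀, fun x => by simpa using h x⟩
  set D : ℝ≥0 := Real.toNNReal |b.det| * C with hD
  have hN : ∀ {u : (Fin d → ℝ) → E}, Integrable u → ∀ j,
      ∑' k, ‖sampAvg (α j) b Θ u k‖ₑ ≤ D * ∫⁻ x, ‖u x‖ₑ := fun hu j =>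
    (tsum_enorm_sampAvg_le hC hΘ.continuous (α j) hu).trans_eq (by simp [hD, ENNReal.ofReal])
  have hD1 : 0 < D + 1 := by simp
  refine ENNReal.le_of_forall_pos_le_add fun ε hε _ => ?_
  obtain ⟨h, hhs, hgh, hhc, hhi⟩ := hg.exists_hasCompactSupport_lintegral_sub_le
    (ε := ((ε / (D + 1) : ℝ≥0) : ℝ≥0∞)) (ENNReal.coe_ne_zero.2 (div_pos hε hD1).ne')
  have hgh' : ∫⁻ x, ‖h x - g x‖ₑ ≤ ((ε / (D + 1) : ℝ≥0) : ℝ≥0∞) := by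
    simpa only [enorm_sub_rev] using hgh
  have h1 := lintegral_enorm_le_iSup_of_hasCompactSupport hb hα hαtop hΘ.integrable hΘ1 hhc hhs
  have h2 : ∀ j, ∑' k, ‖sampAvg (α j) b Θ h k‖ₑ ≤
      (∑' k, ‖sampAvg (α j) b Θ g k‖ₑ) + D * ((ε / (D + 1) : ℝ≥0) : ℝ≥0∞) := by
    intro j
    calc _ ≤ ∑' k, (‖sampAvg (α j) b Θ g k‖ₑ + ‖sampAvg (α j) b Θ (fun x => h x - g x) k‖ₑ) := by
          refine ENNReal.tsum_le_tsum fun k => ?_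
          rw [sampAvg_sub hΘ.continuous hC₀ _ hhi hg]
          refine le_trans ?_ (enorm_add_le _ _)
          rw [add_sub_cancel]
      _ ≤ _ := by
          rw [ENNReal.tsum_add]
          gcongr
          have hi : Integrable fun x => h x - g x := hhi.sub hg
          exact (hN hi j).trans (by gcongr)
  calc ∫⁻ x, ‖g x‖ₑ ≤ ∫⁻ x, ‖g x - h x‖ₑ + ‖h x‖ₑ := lintegral_mono fun x => by
        simpa using enorm_add_le (g x - h x) (h x)
    _ = (∫⁻ x, ‖g x - h x‖ₑ) + ∫⁻ x, ‖h x‖ₑ := lintegral_add_right' _ hhi.1.enorm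
    _ ≤ ((ε / (D + 1) : ℝ≥0) : ℝ≥0∞) + ((⨆ j, ∑' k, ‖sampAvg (α j) b Θ g k‖ₑ) +
        D * ((ε / (D + 1) : ℝ≥0) : ℝ≥0∞)) := by
        refine add_le_add hgh (h1.trans (iSup_le fun j => (h2 j).trans ?_))
        gcongr
        exact le_iSup (fun j => ∑' k, ‖sampAvg (α j) b Θ g k‖ₑ) j
    _ = (⨆ j, ∑' k, ‖sampAvg (α j) b Θ g k‖ₑ) + ((ε / (D + 1) * (D + 1) : ℝ≥0) : ℝ≥0∞) := by
        push_cast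
        ring
    _ = _ := by rw [div_mul_cancel₀ _ hD1.ne']

end SampleBounds

section Norms

variable {d : ℕ}

theorem hardyNorm_eq {f : (Fin d → ℝ) → ℂ} {g : (Fin d → ℝ) → Fin d → ℂ} (hf : Integrable f)
    (hg : Integrable g) (hR : HasRiesz f g) :
    hardyNorm f = (∫⁻ x, ‖f x‖ₑ) + ∫⁻ x, ‖g x‖ₑ := by
  have hset : {r : ℝ≥0∞ | ∃ g : (Fin d → ℝ) → Fin d → ℂ, Integrable g volume ∧ HasRiesz f g ∧
      r = ENNReal.ofReal (∫ x : Fin d → ℝ, ‖g x‖)} = {∫⁻ x, ‖g x‖ₑ} := by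
    ext r
    constructor
    · rintro ⟨g', hg', hR', rfl⟩
      rw [mem_singleton_iff, ofReal_integral_norm_eq_lintegral_enorm hg']
      refine lintegral_congr_ae ?_
      filter_upwards [hR, hR'] with x hx hx'
      rw [tendsto_nhds_unique hx hx']
    · rintro rfl
      exact ⟨g, hg, hR, (ofReal_integral_norm_eq_lintegral_enorm hg).symm⟩
  rw [hardyNorm, hset, sInf_singleton, ofReal_integral_norm_eq_lintegral_enorm hf]

theorem h1Norm_TjH {b : Matrix (Fin d) (Fin d) ℝ} (hb : b.det ≠ 0) {α : ℕ → ℝ} {j : ℕ}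
    (hα : α j ≠ 0) {ν : (Fin d → ℝ) → ℝ} (hν : IsCutoff d ν) {φ : (Fin d → ℝ) → ℂ}
    (hφ : IsSchwartz φ)
    (hφsupp : Function.support (ft φ) ⊆ {ξ : Fin d → ℝ | ξ ᵥ* b ∈ centeredCube d})
    {f : (Fin d → ℝ) → ℂ} {g : (Fin d → ℝ) → Fin d → ℂ} (hf : Integrable f) (hg : Integrable g)
    (hR : HasRiesz f g) :
    h1Norm b ν (fun k => TjH α b φ f j k) =
      (∑' k, ‖sampAvg (α j) b (fun x => (starRingEnd ℂ) (φ x)) f k‖ₑ) +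
      ∑' k, ‖sampAvg (α j) b (ft fun u => (starRingEnd ℂ) (ft φ u) * (ν (u ᵥ* b) : ℂ)) g k‖ₑ := by
  have hT : (fun k => TjH α b φ f j k) = sampAvg (α j) b (fun x => (starRingEnd ℂ) (φ x)) f :=
    funext fun k => TjH_eq_sampAvg α b φ f j k
  have hs : ‖((α j / |α j| : ℝ) : ℂ)‖ₑ = 1 := by
    rw [← ofReal_norm, Complex.norm_real, norm_div, norm_abs_eq_norm,
      div_self (norm_ne_zero_iff.2 hα), ENNReal.ofReal_one]
  rw [hT]
  simp only [h1Norm, ← enorm_eq_nnnorm, dConv_sampAvg hb hα hφ hφsupp hν hf hg hR, enorm_smul, hs,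
    one_mul]

end Norms

/-- Corollary: Analysis norm for `H¹`.
Isotropic expanding dilations.  Let the analyzer `φ ∈ L¹` be a Schwartz function with
`∫ φ = 1` and `φ̂` supported in `C₀ b⁻¹`.  Then
`‖f‖_{H¹} ≈ ‖Tf‖_{ℓ^∞(h¹)} = sup_j ‖{|det b| ⟨f, φ_{j,k}⟩}_k‖_{h¹}` for all `f ∈ H¹`,
with constants independent of `f`. -/
theorem statement10
    (d : ℕ) (b : Matrix (Fin d) (Fin d) ℝ) (hb : b.det ≠ 0)
    (α : ℕ → ℝ) (hα : ∀ j, α j ≠ 0) (hαtop : Tendsto (fun j => |α j|) atTop atTop)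
    (ν : (Fin d → ℝ) → ℝ) (hν : IsCutoff d ν)
    (φ : (Fin d → ℝ) → ℂ) (hφ : Integrable φ volume) (hφS : IsSchwartz φ)
    (hφint : ∫ x : Fin d → ℝ, φ x = 1)
    (hφsupp : Function.support (ft φ) ⊆ {ξ : Fin d → ℝ | ξ ᵥ* b ∈ centeredCube d}) :
    ∃ C₁ C₂ : ℝ≥0∞, 0 < C₁ ∧ C₂ ≠ ⊤ ∧
      ∀ f : (Fin d → ℝ) → ℂ, MemH1 f →
        C₁ * hardyNorm f ≤ (⨆ j : ℕ, h1Norm b ν (fun k => TjH α b φ f j k)) ∧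
          (⨆ j : ℕ, h1Norm b ν (fun k => TjH α b φ f j k)) ≤ C₂ * hardyNorm f := by
  set Φ : (Fin d → ℝ) → ℂ := fun x => (starRingEnd ℂ) (φ x)
  set Ψ : (Fin d → ℝ) → ℂ := ft fun u => (starRingEnd ℂ) (ft φ u) * (ν (u ᵥ* b) : ℂ)
  have hΦ : IsSchwartz Φ := hφS.conj
  have hθ : IsSchwartz fun u => (starRingEnd ℂ) (ft φ u) * (ν (u ᵥ* b) : ℂ) :=
    hν.isSchwartz_mul hb hφS.ft.conj
  have hΨ : IsSchwartz Ψ := hθ.ft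
  have hΦ1 : ∫ x, Φ x = 1 := by
    rw [integral_conj, hφint, map_one]
  have hΨ1 : ∫ x, Ψ x = 1 := by
    have h0 : ft φ 0 = 1 := by simpa [ft, dotP] using hφint
    rw [hθ.integral_ft, h0, Matrix.zero_vecMul, hν.one_near_zero.self_of_nhds]
    simp
  obtain ⟨C, hC⟩ := hΦ.exists_tsum_enorm_le hb
  obtain ⟨D, hD⟩ := hΨ.exists_tsum_enorm_le hb
  refine ⟨2⁻¹, ENNReal.ofReal |b.det| * C + ENNReal.ofReal |b.det| * D, by simp,
    by finiteness, ?_⟩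
  rintro f ⟨hf, g, hg, hR⟩
  simp only [hardyNorm_eq hf hg hR, h1Norm_TjH hb (hα _) hν hφS hφsupp hf hg hR]
  constructor
  · have h1 := lintegral_enorm_le_iSup_sampAvg hb hα hαtop hΦ hΦ1 hf
    have h2 := lintegral_enorm_le_iSup_sampAvg hb hα hαtop hΨ hΨ1 hg
    rw [ENNReal.inv_mul_le_iff (by simp) (by simp), two_mul]
    refine (add_le_add h1 h2).trans (add_le_add ?_ ?_)
    · exact iSup_mono fun j => le_self_add
    · exact iSup_mono fun j => le_add_self
  · refine iSup_le fun j => ?_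
    refine (add_le_add (tsum_enorm_sampAvg_le hC hΦ.continuous (α j) hf)
      (tsum_enorm_sampAvg_le hD hΨ.continuous (α j) hg)).trans ?_
    rw [mul_add]
    gcongr
    · exact le_self_add
    · exact le_add_self

end AffinePaper
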